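/- arXiv:2208.11987 — 11 statements merged into one kernel-verified Lean document; each statement's English description precedes it below -/
import Mathlib

section
/- Let X be a real Banach space. Then BSa(X,Y) = L(X,Y) for every real Banach space Y (every bounded linear operator from X into any Banach space Y has the adjusted Bhatia-Šemrl property) if and only if X is one-dimensional. -/
open scoped BigOperators

section Defs

variable {E : Type*} [NormedAddCommGroup E] [NormedSpace ℝ E]

/-- Birkhoff-James orthogonality: `x ⊥_B y` iff `‖x‖ ≤ ‖x + t • y‖` for all real `t`. -/
def BJOrth (x y : E) : Prop := ∀ t : ℝ, ‖x‖ ≤ ‖x + t • y‖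

/-- Strong Birkhoff-James orthogonality: `x ⊥_S y` iff `‖x‖ < ‖x + t • y‖` for all real `t ≠ 0`. -/
def SBJOrth (x y : E) : Prop := ∀ t : ℝ, t ≠ 0 → ‖x‖ < ‖x + t • y‖

variable {X Y : Type*} [NormedAddCommGroup X] [NormedSpace ℝ X]
  [NormedAddCommGroup Y] [NormedSpace ℝ Y]

/-- A bounded linear operator attains its norm. -/
def NormAttaining (T : X →L[ℝ] Y) : Prop := ∃ x : X, ‖x‖ = 1 ∧ ‖T x‖ = ‖T‖

/-- The adjusted Bhatia-Šemrl property. -/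
def HasBSa (T : X →L[ℝ] Y) : Prop :=
  NormAttaining T ∧ ∀ S : X →L[ℝ] Y, SBJOrth T S →
    ∃ x : X, ‖x‖ = 1 ∧ ‖T x‖ = ‖T‖ ∧ BJOrth (T x) (S x)

/-- The Bhatia-Šemrl property. -/
def HasBS (T : X →L[ℝ] Y) : Prop :=
  NormAttaining T ∧ ∀ S : X →L[ℝ] Y, BJOrth T S →
    ∃ x : X, ‖x‖ = 1 ∧ ‖T x‖ = ‖T‖ ∧ BJOrth (T x) (S x)

end Defs

lemma aux_pair {E : Type*} [NormedAddCommGroup E] [NormedSpace ℝ E] (h : 1 < Module.rank ℝ E) :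
    ∃ f g : E, ‖f‖ = 1 ∧ ‖g‖ = 1 ∧ ‖f + g‖ < 2 ∧ ‖f - g‖ < 2 := by
  have hnt : Nontrivial E := by
    rw [← rank_pos_iff_nontrivial (R := ℝ)]
    exact lt_trans zero_lt_one h
  obtain ⟨f, hf⟩ := exists_norm_eq E (zero_le_one (α := ℝ))
  have hc := isPreconnected_sphere h (0 : E) 1
  have hcont : ContinuousOn (fun g : E => ‖f + g‖ - ‖f - g‖) (Metric.sphere (0 : E) 1) := by
    fun_prop
  have h2 : ‖f + f‖ = 2 := by
    rw [← two_smul ℝ f, norm_smul, hf]; norm_num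
  have key := hc.intermediate_value (a := -f) (b := f) (by simp [hf]) (by simp [hf]) hcont
  have h0 : (0 : ℝ) ∈ Set.Icc (‖f + -f‖ - ‖f - -f‖) (‖f + f‖ - ‖f - f‖) := by
    simp [h2]
  obtain ⟨g, hg, hfg⟩ := key h0
  have hg1 : ‖g‖ = 1 := by simpa using hg
  have hfg' : ‖f + g‖ = ‖f - g‖ := by
    have : ‖f + g‖ - ‖f - g‖ = 0 := hfg
    linarith
  have hle : ‖f + g‖ ≤ 2 := by
    have := norm_add_le f g
    linarith
  rcases lt_or_eq_of_le hle with hlt | heq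
  · exact ⟨f, g, hf, hg1, hlt, hfg' ▸ hlt⟩
  · refine ⟨(1/2 : ℝ) • (f + g), (1/2 : ℝ) • (f - g), ?_, ?_, ?_, ?_⟩
    · rw [norm_smul, heq]; norm_num
    · rw [norm_smul, ← hfg', heq]; norm_num
    · have : (1/2 : ℝ) • (f + g) + (1/2 : ℝ) • (f - g) = f := by module
      rw [this, hf]; norm_num
    · have : (1/2 : ℝ) • (f + g) - (1/2 : ℝ) • (f - g) = g := by module
      rw [this, hg1]; norm_num

lemma aux_real {a b : ℝ} (ha : a = 1) (hb0 : 0 ≤ b) (hb : b < 1)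
    (h : ∀ t : ℝ, max a b ≤ max (|1 + t| * a) (|1 - t| * b)) : False := by
  have h1 := h (-(1 - b) / 2)
  rw [ha, abs_of_nonneg (by linarith), abs_of_nonneg (by linarith), max_eq_left hb.le] at h1
  rcases le_max_iff.1 h1 with h1 | h1 <;> nlinarith

lemma aux_fail {X : Type} [NormedAddCommGroup X] [NormedSpace ℝ X] (f g : X →L[ℝ] ℝ)
    (hf : ‖f‖ = 1) (hg : ‖g‖ = 1) (h1 : ‖f + g‖ < 2) (h2 : ‖f - g‖ < 2) :
    ¬ HasBSa (f.prod g) := by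
  rintro ⟨-, H⟩
  have hT : ‖f.prod g‖ = 1 := by
    rw [ContinuousLinearMap.opNorm_prod, Prod.norm_mk, hf, hg, max_self]
  obtain ⟨x, hx, hTx, hB⟩ := H (f.prod (-g)) (by
    intro t ht
    have : f.prod g + t • f.prod (-g) = ((1 + t) • f).prod ((1 - t) • g) := by
      ext x <;> simp <;> ring
    rw [hT, this, ContinuousLinearMap.opNorm_prod, Prod.norm_mk, norm_smul, norm_smul, hf, hg,
      mul_one, mul_one, Real.norm_eq_abs, Real.norm_eq_abs]
    rcases lt_or_gt_of_ne ht with ht | ht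
    · exact lt_max_of_lt_right (lt_of_lt_of_le (by linarith) (le_abs_self _))
    · exact lt_max_of_lt_left (lt_of_lt_of_le (by linarith) (le_abs_self _)))
  have hmax : max |f x| |g x| = 1 := by
    rw [hT] at hTx
    simpa [Prod.norm_def] using hTx
  have hB' : ∀ t : ℝ, max |f x| |g x| ≤ max (|1 + t| * |f x|) (|1 - t| * |g x|) := by
    intro t
    have := hB t
    have e : (f.prod g) x + t • (f.prod (-g)) x = ((1 + t) * f x, (1 - t) * g x) := by
      ext <;> simp <;> ring
    rw [e] at this
    simpa [Prod.norm_def, abs_mul] using this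
  have hp : |f x + g x| < 2 := by
    have := (f + g).le_opNorm x
    rw [hx, mul_one] at this
    exact lt_of_le_of_lt (by simpa using this) h1
  have hm : |f x - g x| < 2 := by
    have := (f - g).le_opNorm x
    rw [hx, mul_one] at this
    exact lt_of_le_of_lt (by simpa using this) h2
  have hfx : |f x| ≤ 1 := hmax ▸ le_max_left _ _
  have hgx : |g x| ≤ 1 := hmax ▸ le_max_right _ _
  have hne : ¬ (|f x| = 1 ∧ |g x| = 1) := by
    rintro ⟨ha, hb⟩
    rw [abs_lt] at hp hm
    rcases eq_or_eq_neg_of_abs_eq ha with ha | ha <;>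
    rcases eq_or_eq_neg_of_abs_eq hb with hb | hb <;>
    rw [ha, hb] at hp hm <;> linarith [hp.1, hp.2, hm.1, hm.2]
  rcases lt_or_eq_of_le hgx with hb | hb
  · have ha : |f x| = 1 := by
      rcases max_choice |f x| |g x| with h | h <;> rw [h] at hmax
      · exact hmax
      · linarith
    exact aux_real ha (abs_nonneg _) hb hB'
  · have ha : |f x| < 1 := lt_of_le_of_ne hfx (fun h => hne ⟨h, hb⟩)
    refine aux_real hb (abs_nonneg _) ha (fun t => ?_)
    have := hB' (-t)
    rw [max_comm, max_comm (|1 + t| * _)]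
    simpa [sub_eq_add_neg] using this

lemma aux_rank {X : Type} [NormedAddCommGroup X] [NormedSpace ℝ X] [Nontrivial X]
    (h : Module.finrank ℝ X ≠ 1) : 1 < Module.rank ℝ (X →L[ℝ] ℝ) := by
  by_contra hle
  rw [not_lt, rank_le_one_iff] at hle
  obtain ⟨f, hf⟩ := hle
  apply h
  have hinj : Function.Injective (f : X →ₗ[ℝ] ℝ) := by
    rw [injective_iff_map_eq_zero]
    intro x hx
    by_contra hx0
    obtain ⟨g, hg⟩ := SeparatingDual.exists_ne_zero (R := ℝ) hx0
    obtain ⟨r, rfl⟩ := hf g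
    apply hg
    have : f x = 0 := hx
    simp [this]
  have : FiniteDimensional ℝ X := FiniteDimensional.of_injective _ hinj
  have h1 := LinearMap.finrank_le_finrank_of_injective hinj
  have h2 : 0 < Module.finrank ℝ X := Module.finrank_pos
  rw [Module.finrank_self] at h1
  omega

lemma aux_one {X Y : Type} [NormedAddCommGroup X] [NormedSpace ℝ X] [NormedAddCommGroup Y]
    [NormedSpace ℝ Y] (h : Module.finrank ℝ X = 1) (T : X →L[ℝ] Y) : HasBSa T := by
  have hnt : Nontrivial X := Module.nontrivial_of_finrank_pos (R := ℝ) (by omega)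
  obtain ⟨x, hx⟩ := exists_norm_eq X (zero_le_one (α := ℝ))
  have hx0 : x ≠ 0 := by
    rintro rfl
    simp at hx
  have hN : ∀ A : X →L[ℝ] Y, ‖A x‖ = ‖A‖ := by
    intro A
    apply le_antisymm
    · simpa [hx] using A.le_opNorm x
    · refine A.opNorm_le_bound (norm_nonneg _) (fun y => ?_)
      obtain ⟨c, rfl⟩ := (finrank_eq_one_iff_of_nonzero' x hx0).1 h y
      rw [map_smul, norm_smul, norm_smul, hx, mul_one, mul_comm]
  refine ⟨⟨x, hx, hN T⟩, fun S hS => ⟨x, hx, hN T, fun t => ?_⟩⟩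
  by_cases ht : t = 0
  · simp [ht]
  · have := (hS t ht).le
    rw [← hN T, ← hN (T + t • S)] at this
    simpa using this

/-- Every bounded linear operator from `X` into every real Banach space `Y` has the adjusted
Bhatia-Semrl property iff `X` is one-dimensional. -/
theorem forall_hasBSa_iff_finrank_eq_one (X : Type) [NormedAddCommGroup X] [NormedSpace ℝ X]
    [CompleteSpace X] :
    (∀ (Y : Type) [NormedAddCommGroup Y] [NormedSpace ℝ Y] [CompleteSpace Y],
        ∀ T : X →L[ℝ] Y, HasBSa T) ↔
      Module.finrank ℝ X = 1 := by
  constructor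
  · intro H
    have hnt : Nontrivial X := by
      obtain ⟨⟨x, hx, -⟩, -⟩ := H ℝ 0
      refine ⟨x, 0, ?_⟩
      rintro rfl
      simp at hx
    by_contra h
    obtain ⟨f, g, hf, hg, h1, h2⟩ := aux_pair (aux_rank h)
    exact aux_fail f g hf hg h1 h2 (H (ℝ × ℝ) (f.prod g))
  · intro h Y _ _ _ T
    exact aux_one h T
end

section
/- Let X and Y be real Banach spaces. If the space L(X,Y) of bounded linear operators from X to Y, equipped with the operator norm, is strictly convex, then BS(X,Y) = BSa(X,Y): a bounded linear operator from X to Y has the Bhatia-Šemrl property if and only if it has the adjusted Bhatia-Šemrl property. -/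
open scoped BigOperators

/-- If the operator space `L(X,Y)` is strictly convex, then the Bhatia-Semrl property and the
adjusted Bhatia-Semrl property coincide. -/
theorem hasBS_iff_hasBSa_of_strictConvex (X Y : Type*) [NormedAddCommGroup X] [NormedSpace ℝ X]
    [CompleteSpace X] [NormedAddCommGroup Y] [NormedSpace ℝ Y] [CompleteSpace Y]
    [StrictConvexSpace ℝ (X →L[ℝ] Y)] :
    ∀ T : X →L[ℝ] Y, HasBS T ↔ HasBSa T := by
  intro T
  constructor
  · rintro ⟨h1, h2⟩
    refine ⟨h1, fun S hS => h2 S fun t => ?_⟩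
    by_cases ht : t = 0
    · simp [ht]
    · exact (hS t ht).le
  · rintro ⟨h1, h2⟩
    refine ⟨h1, fun S hS => ?_⟩
    by_cases hS0 : S = 0
    · obtain ⟨x, hx, hTx⟩ := h1
      exact ⟨x, hx, hTx, fun t => by simp [hS0]⟩
    · refine h2 S fun t ht => lt_of_le_of_ne (hS t) fun heq => ?_
      have hne : T ≠ T + t • S := by
        intro h
        have h' : t • S = 0 := left_eq_add.mp h
        rcases smul_eq_zero.mp h' with h | h
        · exact ht h
        · exact hS0 h
      have hlt := (norm_midpoint_lt_iff heq).mpr hne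
      have hm : (1 / 2 : ℝ) • (T + (T + t • S)) = T + (t / 2) • S := by
        module
      rw [hm] at hlt
      exact absurd (hS (t / 2)) (not_le.mpr hlt)
end

section
/- Let X be a non-reflexive real Banach space whose dual X* is strictly convex. Then BS(X,ℝ) = BSa(X,ℝ), and BSa(X,ℝ) is a proper subset of X*; that is, every functional with the adjusted Bhatia-Šemrl property has the Bhatia-Šemrl property, and there exists a bounded linear functional on X without the adjusted Bhatia-Šemrl property. -/
open scoped BigOperators

open Filter Topology

lemma james_aux {X : Type*} [NormedAddCommGroup X] [NormedSpace ℝ X]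
    (C : ℕ → Set (X →L[ℝ] ℝ)) (hconv : ∀ n, Convex ℝ (C n)) (hanti : Antitone C)
    (hne : ∀ n, (C n).Nonempty) (M : ℝ) (hM : ∀ y ∈ C 0, ‖y‖ ≤ M)
    (θ : ℝ) (hθ : 0 < θ) (hθC : ∀ y ∈ C 0, θ ≤ ‖y‖)
    (hlim : ∀ x : X, ∀ δ : ℝ, 0 < δ → ∃ n, ∀ y ∈ C n, y x ≤ δ) :
    ∃ s : X →L[ℝ] ℝ, ¬ NormAttaining s := by
  have hsel : ∀ (n : ℕ) (s : X →L[ℝ] ℝ), ∃ y ∈ C n, ∀ z ∈ C n,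
      ‖s + ((1/2:ℝ)^n) • y‖ ≤ ‖s + ((1/2:ℝ)^n) • z‖ + θ / 4 * ((1/2:ℝ)^n)^2 := by
    intro n s
    have hbdd : BddBelow ((fun y => ‖s + ((1/2:ℝ)^n) • y‖) '' C n) :=
      ⟨0, by rintro _ ⟨y, -, rfl⟩; exact norm_nonneg _⟩
    have hpos : 0 < θ / 4 * ((1/2:ℝ)^n)^2 := by positivity
    obtain ⟨_, ⟨y, hy, rfl⟩, hlt⟩ := exists_lt_of_csInf_lt ((hne n).image _)
      (lt_add_of_pos_right (sInf ((fun y => ‖s + ((1/2:ℝ)^n) • y‖) '' C n)) hpos)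
    refine ⟨y, hy, fun z hz => ?_⟩
    have := csInf_le hbdd ⟨z, hz, rfl⟩
    simp only at hlt this
    linarith
  choose Y hYC hY using hsel
  let s : ℕ → (X →L[ℝ] ℝ) := fun n => Nat.rec 0 (fun n s => s + ((1/2:ℝ)^(n+1)) • Y n s) n
  have hs0 : s 0 = 0 := rfl
  let y : ℕ → (X →L[ℝ] ℝ) := fun n => Y n (s n)
  have hs : ∀ n, s (n+1) = s n + ((1/2:ℝ)^(n+1)) • y n := fun n => rfl
  have hyC : ∀ n, y n ∈ C n := fun n => hYC n _
  have hy0 : ∀ n, y n ∈ C 0 := fun n => hanti (Nat.zero_le n) (hyC n)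
  have hy : ∀ n, ∀ z ∈ C n,
      ‖s n + ((1/2:ℝ)^n) • y n‖ ≤ ‖s n + ((1/2:ℝ)^n) • z‖ + θ / 4 * ((1/2:ℝ)^n)^2 :=
    fun n z hz => hY n (s n) z hz
  have hkey : ∀ n k, ∀ z ∈ C (n + k), ∃ w ∈ C n,
      s (n+k) + ((1/2:ℝ)^(n+k)) • z = s n + ((1/2:ℝ)^n) • w := by
    intro n k
    induction k with
    | zero => intro z hz; exact ⟨z, hz, rfl⟩
    | succ k ih =>
      intro z hz
      have hz' : z ∈ C (n+k) := hanti (by omega) hz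
      obtain ⟨w, hw, e⟩ := ih ((1/2:ℝ) • y (n+k) + (1/2:ℝ) • z)
        (hconv _ (hyC _) hz' (by norm_num) (by norm_num) (by norm_num))
      refine ⟨w, hw, ?_⟩
      rw [← e, ← add_assoc, hs, smul_add, smul_smul, smul_smul, ← pow_succ, add_assoc]
  have hcau : CauchySeq s := by
    refine cauchySeq_of_le_geometric (1/2) (M/2) (by norm_num) fun n => ?_
    rw [dist_eq_norm, hs, sub_add_cancel_left, norm_neg, norm_smul, Real.norm_of_nonneg (by positivity),
      pow_succ]
    have := mul_le_mul_of_nonneg_left (hM _ (hy0 n)) (show (0:ℝ) ≤ (1/2)^n by positivity)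
    linarith
  obtain ⟨S, hS⟩ := cauchySeq_tendsto_of_complete hcau
  have hp : Tendsto (fun n : ℕ => (1/2:ℝ)^n) atTop (𝓝 0) :=
    tendsto_pow_atTop_nhds_zero_of_lt_one (by norm_num) (by norm_num)
  have ht : Tendsto (fun n => s n + ((1/2:ℝ)^n) • y n) atTop (𝓝 S) := by
    have h2 : Tendsto (fun n => ((1/2:ℝ)^n) • y n) atTop (𝓝 0) := by
      refine squeeze_zero_norm (a := fun n => (1/2:ℝ)^n * M) (fun n => ?_) ?_
      · rw [norm_smul, Real.norm_of_nonneg (by positivity)]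
        exact mul_le_mul_of_nonneg_left (hM _ (hy0 n)) (by positivity)
      · simpa using hp.mul_const M
    simpa using hS.add h2
  have htn := ht.norm
  have hα : θ ≤ ‖S‖ := by
    refine ge_of_tendsto' htn fun n => ?_
    obtain ⟨w, hw, e⟩ := hkey 0 n (y n) (by rw [zero_add]; exact hyC n)
    rw [zero_add] at e
    rw [e, hs0]
    simpa using hθC w hw
  have htS : ∀ n, ‖s n + ((1/2:ℝ)^n) • y n‖ ≤ ‖S‖ + θ / 4 * ((1/2:ℝ)^n)^2 := by
    intro n
    refine ge_of_tendsto (htn.add_const _) ?_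
    filter_upwards [eventually_ge_atTop n] with m hm
    obtain ⟨k, rfl⟩ := Nat.exists_eq_add_of_le hm
    obtain ⟨w, hw, e⟩ := hkey n k (y (n+k)) (hyC _)
    rw [e]
    exact hy n w hw
  have hsn : ∀ n, (1/2:ℝ)^n * (θ/2 + θ/2 * (1/2:ℝ)^n) ≤ ‖S‖ - ‖s n‖ := by
    intro n
    induction n with
    | zero => rw [hs0]; simp; linarith
    | succ n ih =>
      have e : s (n+1) = (1/2:ℝ) • s n + (1/2:ℝ) • (s n + ((1/2:ℝ)^n) • y n) := by
        rw [hs, pow_succ]; module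
      have h1 : ‖s (n+1)‖ ≤ 1/2 * ‖s n‖ + 1/2 * ‖s n + ((1/2:ℝ)^n) • y n‖ := by
        rw [e]
        refine (norm_add_le _ _).trans ?_
        rw [norm_smul, norm_smul]; norm_num
      have h2 := htS n
      rw [pow_succ]
      nlinarith
  refine ⟨S, ?_⟩
  have main : ∀ x : X, ‖x‖ = 1 → S x < ‖S‖ := by
    intro x hx
    obtain ⟨n, hn⟩ := hlim x (θ/4) (by positivity)
    have h1 : ∀ k, s (n+k) x ≤ s n x + ((1/2:ℝ)^n - (1/2:ℝ)^(n+k)) * (θ/4) := by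
      intro k
      induction k with
      | zero => simp
      | succ k ih =>
        have := hn (y (n+k)) (hanti (by omega) (hyC _))
        have e : s (n+(k+1)) x = s (n+k) x + (1/2:ℝ)^(n+k+1) * y (n+k) x := by
          rw [← add_assoc, hs]; simp
        have h3 := mul_le_mul_of_nonneg_left this (show (0:ℝ) ≤ (1/2)^(n+k+1) by positivity)
        rw [e, ← add_assoc]
        rw [pow_succ] at h3 ⊢
        nlinarith
    have h2 : Tendsto (fun m => s m x) atTop (𝓝 (S x)) :=
      ((ContinuousLinearMap.apply ℝ ℝ x).continuous.tendsto S).comp hS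
    have h3 : S x ≤ s n x + (1/2:ℝ)^n * (θ/4) := by
      refine le_of_tendsto h2 ?_
      filter_upwards [eventually_ge_atTop n] with m hm
      obtain ⟨k, rfl⟩ := Nat.exists_eq_add_of_le hm
      have := h1 k
      have hpp : 0 < (1/2:ℝ)^(n+k) * (θ/4) := by positivity
      nlinarith
    have h4 : s n x ≤ ‖s n‖ := by
      have := (s n).le_opNorm x
      rw [hx, mul_one] at this
      exact (le_abs_self _).trans this
    have h5 := hsn n
    have hpp : 0 < (1/2:ℝ)^n * (θ/4) := by positivity
    have hpq : 0 < (1/2:ℝ)^n * (θ/2 * (1/2:ℝ)^n) := by positivity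
    nlinarith
  rintro ⟨x, hx, hSx⟩
  have h1 := main x hx
  have h2 := main (-x) (by rwa [norm_neg])
  rw [map_neg] at h2
  rw [Real.norm_eq_abs] at hSx
  rcases abs_cases (S x) with h | h <;> linarith

lemma ultra_lim {X ι : Type*} [NormedAddCommGroup X] [NormedSpace ℝ X]
    (U : Ultrafilter ι) (h : ι → (X →L[ℝ] ℝ)) (M : ℝ) (hM : ∀ᶠ i in (U : Filter ι), ‖h i‖ ≤ M) :
    ∃ g : X →L[ℝ] ℝ, ∀ x, Tendsto (fun i => h i x) U (𝓝 (g x)) := by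
  obtain ⟨g, -, hg⟩ := (WeakDual.isCompact_closedBall (𝕜 := ℝ) (E := X) 0 M).ultrafilter_le_nhds
    (U.map (fun i => StrongDual.toWeakDual (h i))) (by
      rw [le_principal_iff, Ultrafilter.mem_coe, Ultrafilter.mem_map]
      have : {i | ‖h i‖ ≤ M} ⊆ (fun i => StrongDual.toWeakDual (h i)) ⁻¹'
          (WeakDual.toStrongDual ⁻¹' Metric.closedBall 0 M) := by
        intro i hi
        have hi' : ‖h i‖ ≤ M := hi
        simpa using hi'
      exact mem_of_superset hM this)
  refine ⟨WeakDual.toStrongDual g, fun x => ?_⟩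
  exact ((WeakDual.eval_continuous (𝕜 := ℝ) x).tendsto g).comp hg

/-- functionals dominated by the upper limit along the filter -/
def KSet {X : Type*} [NormedAddCommGroup X] [NormedSpace ℝ X]
    (f : ℕ → (X →L[ℝ] ℝ)) (l : Filter ℕ) : Set (X →L[ℝ] ℝ) :=
  {g | ∀ x : X, ∀ c : ℝ, (∀ᶠ n in l, f n x ≤ c) → g x ≤ c}

lemma KSet_mono {X : Type*} [NormedAddCommGroup X] [NormedSpace ℝ X]
    (f : ℕ → (X →L[ℝ] ℝ)) {l l' : Filter ℕ} (h : l ≤ l') : KSet f l ⊆ KSet f l' :=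
  fun _ hg x c hc => hg x c (h hc)

lemma norm_le_of_lim {X ι : Type*} [NormedAddCommGroup X] [NormedSpace ℝ X]
    (U : Ultrafilter ι) (h : ι → (X →L[ℝ] ℝ)) (M : ℝ) (hM0 : 0 ≤ M)
    (hM : ∀ᶠ i in (U : Filter ι), ‖h i‖ ≤ M)
    (g : X →L[ℝ] ℝ) (hg : ∀ x, Tendsto (fun i => h i x) U (𝓝 (g x))) : ‖g‖ ≤ M := by
  refine g.opNorm_le_bound hM0 fun x => ?_
  refine le_of_tendsto (hg x).norm ?_
  filter_upwards [hM] with i hi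
  exact (h i).le_of_opNorm_le hi x

lemma KSet_min {X : Type*} [NormedAddCommGroup X] [NormedSpace ℝ X]
    (f : ℕ → (X →L[ℝ] ℝ)) (M : ℝ) (hM : ∀ n, ‖f n‖ ≤ M) (l : Filter ℕ) [l.NeBot] :
    ∃ g ∈ KSet f l, ‖g‖ ≤ M ∧ ∀ g' ∈ KSet f l, ‖g‖ ≤ ‖g'‖ := by
  have hM0 : 0 ≤ M := (norm_nonneg _).trans (hM 0)
  obtain ⟨g0, hg0⟩ := ultra_lim (Ultrafilter.of l) f M (Eventually.of_forall hM)
  have hg0K : g0 ∈ KSet f l := fun x c hc => le_of_tendsto (hg0 x) (Ultrafilter.of_le l hc)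
  have hg0M : ‖g0‖ ≤ M := norm_le_of_lim _ f M hM0 (Eventually.of_forall hM) g0 hg0
  set m := sInf (norm '' KSet f l) with hm
  have hbdd : BddBelow (norm '' KSet f l) := ⟨0, by rintro _ ⟨y, -, rfl⟩; exact norm_nonneg _⟩
  have hm0 : 0 ≤ m := Real.sInf_nonneg (by rintro _ ⟨y, -, rfl⟩; exact norm_nonneg _)
  have hex : ∀ n : ℕ, ∃ g ∈ KSet f l, ‖g‖ < m + 1 / ((n:ℝ)+1) := by
    intro n
    obtain ⟨_, ⟨g, hg, rfl⟩, hlt⟩ := exists_lt_of_csInf_lt (⟨_, g0, hg0K, rfl⟩ : (norm '' KSet f l).Nonempty)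
      (lt_add_of_pos_right m (show (0:ℝ) < 1 / ((n:ℝ)+1) by positivity))
    exact ⟨g, hg, hlt⟩
  choose h hK hlt using hex
  have hev : ∀ ε : ℝ, 0 < ε → ∀ᶠ n in ((Ultrafilter.of (atTop : Filter ℕ)) : Filter ℕ), ‖h n‖ ≤ m + ε := by
    intro ε hε
    have := (tendsto_one_div_add_atTop_nhds_zero_nat (𝕜 := ℝ)).eventually (gt_mem_nhds hε)
    filter_upwards [Ultrafilter.of_le _ this] with n hn
    linarith [hlt n]
  obtain ⟨g, hg⟩ := ultra_lim (Ultrafilter.of (atTop : Filter ℕ)) h (m+1) (hev 1 one_pos)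
  have hgm : ‖g‖ ≤ m := le_of_forall_pos_le_add fun ε hε =>
    norm_le_of_lim _ h (m+ε) (by linarith) (hev ε hε) g hg
  have hmin : ∀ g' ∈ KSet f l, ‖g‖ ≤ ‖g'‖ := fun g' hg' => hgm.trans (csInf_le hbdd ⟨g', hg', rfl⟩)
  refine ⟨g, fun x c hc => ?_, (hmin _ hg0K).trans hg0M, hmin⟩
  exact le_of_tendsto' (hg x) fun n => hK n x c hc

lemma exists_conv {X : Type*} [NormedAddCommGroup X] [NormedSpace ℝ X]
    [StrictConvexSpace ℝ (X →L[ℝ] ℝ)]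
    (f : ℕ → (X →L[ℝ] ℝ)) (M : ℝ) (hM : ∀ n, ‖f n‖ ≤ M) :
    ∃ (l : Filter ℕ) (g : X →L[ℝ] ℝ), l.NeBot ∧ l.IsCountablyGenerated ∧ l ≤ atTop ∧
      ∀ x, Tendsto (fun n => f n x) l (𝓝 (g x)) := by
  let T := {l : Filter ℕ // l.NeBot ∧ l.IsCountablyGenerated ∧ l ≤ atTop}
  have hmin : ∀ l : T, ∃ g ∈ KSet f l.1, ‖g‖ ≤ M ∧ ∀ g' ∈ KSet f l.1, ‖g‖ ≤ ‖g'‖ := by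
    intro l
    have := l.2.1
    exact KSet_min f M hM l.1
  choose G hGK hGM hGmin using hmin
  have hmono : ∀ l l' : T, l.1 ≤ l'.1 → ‖G l'‖ ≤ ‖G l‖ := fun l l' h =>
    hGmin l' _ (KSet_mono f h (hGK l))
  have hstep : ∀ (n : ℕ) (l : T), ∃ l' : T, l'.1 ≤ l.1 ∧
      ∀ l'' : T, l''.1 ≤ l.1 → ‖G l''‖ ≤ ‖G l'‖ + 1 / ((n:ℝ)+1) := by
    intro n l
    let A := (fun l' : T => ‖G l'‖) '' {l' | l'.1 ≤ l.1}
    have hbdd : BddAbove A := ⟨M, by rintro _ ⟨y, -, rfl⟩; exact hGM y⟩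
    obtain ⟨_, ⟨l', hl', rfl⟩, hlt⟩ := exists_lt_of_lt_csSup (⟨_, l, le_refl l.1, rfl⟩ : A.Nonempty)
      (sub_lt_self (sSup A) (show (0:ℝ) < 1 / ((n:ℝ)+1) by positivity))
    refine ⟨l', hl', fun l'' hl'' => ?_⟩
    have := le_csSup hbdd ⟨l'', hl'', rfl⟩
    simp only at hlt this
    linarith
  choose N hN1 hN2 using hstep
  let L : ℕ → T := fun n => Nat.rec ⟨atTop, inferInstance, inferInstance, le_rfl⟩ (fun n l => N n l) n
  have hL : ∀ n, L (n+1) = N n (L n) := fun n => rfl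
  have hanti : Antitone (fun n => (L n).1) := antitone_nat_of_succ_le fun n => by
    rw [hL]; exact hN1 _ _
  let l0 : T := ⟨⨅ n, (L n).1, iInf_neBot_of_directed hanti.directed_ge (fun n => (L n).2.1), by
    have := fun n => (L n).2.2.1
    infer_instance, (iInf_le _ 0).trans (L 0).2.2.2⟩
  have hl0 : ∀ n, l0.1 ≤ (L n).1 := fun n => iInf_le _ n
  have hstab : ∀ l : T, l.1 ≤ l0.1 → ‖G l‖ = ‖G l0‖ := by
    intro l hl
    refine le_antisymm ?_ (hmono _ _ hl)
    have : Tendsto (fun n : ℕ => ‖G l0‖ + 1 / ((n:ℝ)+1)) atTop (𝓝 (‖G l0‖ + 0)) :=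
      (tendsto_one_div_add_atTop_nhds_zero_nat (𝕜 := ℝ)).const_add _
    rw [add_zero] at this
    refine ge_of_tendsto' this fun n => ?_
    have h1 := hN2 n (L n) l (hl.trans (hl0 n))
    have h2 := hmono l0 (N n (L n)) (hl0 (n+1))
    linarith
  have huniq : ∀ l : T, l.1 ≤ l0.1 → G l = G l0 := by
    intro l hl
    by_contra hne
    have e := hstab l hl
    have h1 := (norm_midpoint_lt_iff e).2 hne
    have h2 : (1/2:ℝ) • (G l + G l0) ∈ KSet f l0.1 := by
      intro x c hc
      have a := KSet_mono f hl (hGK l) x c hc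
      have b := hGK l0 x c hc
      simp only [smul_apply, add_apply, smul_eq_mul]
      linarith
    have h3 := hGmin l0 _ h2
    linarith
  have hupper : ∀ x : X, ∀ a : ℝ, G l0 x < a → ∀ᶠ n in l0.1, f n x < a := by
    intro x a ha
    by_contra hcon
    have hfr : ∃ᶠ n in l0.1, n ∈ {n | a ≤ f n x} := by
      rw [not_eventually] at hcon
      exact hcon.mono fun n hn => not_lt.1 hn
    let l1 : T := ⟨l0.1 ⊓ 𝓟 {n | a ≤ f n x}, frequently_mem_iff_neBot.1 hfr, by
      have := l0.2.2.1
      infer_instance, inf_le_left.trans l0.2.2.2⟩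
    have h1 := huniq l1 inf_le_left
    have h2 := hGK l1 (-x) (-a) (by
      have : {n | a ≤ f n x} ∈ l1.1 := mem_inf_of_right (mem_principal_self _)
      filter_upwards [this] with n hn
      rw [map_neg]; exact neg_le_neg hn)
    rw [h1, map_neg] at h2
    linarith
  refine ⟨l0.1, G l0, l0.2.1, l0.2.2.1, l0.2.2.2, fun x => ?_⟩
  refine tendsto_order.2 ⟨fun a ha => ?_, fun a ha => hupper x a ha⟩
  have := hupper (-x) (-a) (by rw [map_neg]; linarith)
  filter_upwards [this] with n hn
  rw [map_neg] at hn
  linarith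

lemma hb_ext {E : Type*} [NormedAddCommGroup E] [NormedSpace ℝ E] (V : Subspace ℝ E)
    (F : StrongDual ℝ E) (c : ℝ) (hc : 0 ≤ c) (hle : ∀ f ∈ V, F f ≤ c * ‖f‖) :
    ∃ K : StrongDual ℝ E, (∀ v ∈ V, K v = 0) ∧ ‖F - K‖ ≤ c := by
  let F0 : StrongDual ℝ V := F.comp V.subtypeL
  obtain ⟨H, hH, hHn⟩ := exists_extension_norm_eq V F0
  have hF0 : ‖F0‖ ≤ c := by
    refine F0.opNorm_le_bound hc fun v => ?_
    rw [Real.norm_eq_abs, abs_le]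
    have h1 := hle v v.2
    have h2 := hle (-v) (V.neg_mem v.2)
    rw [map_neg, norm_neg] at h2
    have e : F0 v = F v := rfl
    have e2 : ‖v‖ = ‖(v : E)‖ := rfl
    rw [e, e2]
    constructor <;> linarith
  refine ⟨F - H, fun v hv => ?_, ?_⟩
  · have : H v = F v := hH ⟨v, hv⟩
    show F v - H v = 0
    rw [this, sub_self]
  · rw [sub_sub_cancel, hHn]
    exact hF0

lemma step_f {X : Type*} [NormedAddCommGroup X] [NormedSpace ℝ X]
    (F : StrongDual ℝ (StrongDual ℝ X)) (c δ : ℝ) (hc : 0 < c) (hcδ : c < δ)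
    (hF : ∀ x, δ ≤ ‖F - NormedSpace.inclusionInDoubleDual ℝ X x‖) (s : Finset X) :
    ∃ f : X →L[ℝ] ℝ, ‖f‖ ≤ 1 ∧ c < F f ∧ ∀ x ∈ s, f x = 0 := by
  by_contra hcon
  push Not at hcon
  let V : Subspace ℝ (StrongDual ℝ X) :=
    ⨅ i : s, (NormedSpace.inclusionInDoubleDual ℝ X i.1).toLinearMap.ker
  have hV : ∀ f : StrongDual ℝ X, f ∈ V ↔ ∀ x ∈ s, f x = 0 := by
    intro f
    simp [V, Submodule.mem_iInf]
  have hle : ∀ f ∈ V, F f ≤ c * ‖f‖ := by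
    intro f hf
    rcases eq_or_ne f 0 with rfl | hf0
    · simp
    by_contra hlt
    push Not at hlt
    have hn : 0 < ‖f‖ := norm_pos_iff.2 hf0
    obtain ⟨x, hx, hne⟩ := hcon (‖f‖⁻¹ • f) (by
      rw [norm_smul, norm_inv, norm_norm, inv_mul_cancel₀ hn.ne']) (by
      rw [map_smul, smul_eq_mul, ← div_eq_inv_mul, lt_div_iff₀ hn]; exact hlt)
    exact hne (by rw [smul_apply, (hV f).1 hf x hx, smul_zero])
  obtain ⟨K, hK, hKn⟩ := hb_ext V F c hc.le hle
  have hspan : K.toLinearMap ∈ Submodule.span ℝ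
      (Set.range fun i : s => (NormedSpace.inclusionInDoubleDual ℝ X i.1).toLinearMap) := by
    apply mem_span_of_iInf_ker_le_ker
    intro f hf
    rw [LinearMap.mem_ker]
    exact hK f hf
  have hr : ∀ K ∈ Submodule.span ℝ
      (Set.range fun i : s => (NormedSpace.inclusionInDoubleDual ℝ X i.1).toLinearMap),
      ∃ x, K = (NormedSpace.inclusionInDoubleDual ℝ X x).toLinearMap := by
    intro K hK
    induction hK using Submodule.span_induction with
    | mem K h => obtain ⟨i, rfl⟩ := h; exact ⟨i.1, rfl⟩
    | zero => exact ⟨0, by ext; simp⟩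
    | add a b _ _ ha hb =>
      obtain ⟨x, rfl⟩ := ha
      obtain ⟨y, rfl⟩ := hb
      exact ⟨x + y, by ext; simp⟩
    | smul r a _ ha =>
      obtain ⟨x, rfl⟩ := ha
      exact ⟨r • x, by ext; simp⟩
  obtain ⟨x, hx⟩ := hr _ hspan
  have hx' : K = NormedSpace.inclusionInDoubleDual ℝ X x :=
    ContinuousLinearMap.coe_injective hx
  have := hF x
  rw [← hx'] at this
  linarith

lemma step_x {X : Type*} [NormedAddCommGroup X] [NormedSpace ℝ X]
    (F : StrongDual ℝ (StrongDual ℝ X)) (c : ℝ) (s : Finset (X →L[ℝ] ℝ))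
    (hs : ∀ f ∈ s, c < F f) :
    ∃ x : X, ‖x‖ ≤ ‖F‖ ∧ ∀ f ∈ s, c < f x := by
  classical
  let T : X →L[ℝ] (s → ℝ) := ContinuousLinearMap.pi fun i => i.1
  let v : s → ℝ := fun i => F i.1
  have hv : v ∈ closure (T '' Metric.closedBall 0 ‖F‖) := by
    by_contra hcon
    obtain ⟨u, r, h1, h2⟩ := geometric_hahn_banach_closed_point
      (((convex_closedBall (0:X) ‖F‖).is_linear_image T.toLinearMap.isLinear).closure)
      isClosed_closure hcon
    let h : X →L[ℝ] ℝ := u.comp T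
    have hu : ∀ w : s → ℝ, u w = ∑ i, w i * u (Pi.single i 1) := by
      intro w
      conv_lhs => rw [pi_eq_sum_univ' w]
      simp [map_sum]
    have hh : h = ∑ i : s, u (Pi.single i 1) • i.1 := by
      ext x
      show u (T x) = _
      rw [hu]
      simp [T, mul_comm]
    have hFh : F h = u v := by
      rw [hh, hu, map_sum]
      simp [v, mul_comm]
    have hb : ∀ x : X, ‖x‖ ≤ ‖F‖ → h x < r := fun x hx =>
      h1 _ (subset_closure ⟨x, by simpa using hx, rfl⟩)
    have hr : 0 < r := by simpa using hb 0 (by rw [norm_zero]; exact norm_nonneg F)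
    have hle : ‖F‖ * ‖h‖ ≤ r := by
      rcases eq_or_ne ‖F‖ 0 with h0 | h0
      · rw [h0, zero_mul]; exact hr.le
      have hp : 0 < ‖F‖ := lt_of_le_of_ne (norm_nonneg F) h0.symm
      rw [mul_comm, ← le_div_iff₀ hp]
      refine h.opNorm_le_bound (div_nonneg hr.le hp.le) fun x => ?_
      rcases eq_or_ne x 0 with rfl | hx0
      · simp
      have hxp : 0 < ‖x‖ := norm_pos_iff.2 hx0
      have hz : ‖(‖F‖ / ‖x‖) • x‖ ≤ ‖F‖ := by
        rw [norm_smul, Real.norm_of_nonneg (div_nonneg hp.le hxp.le), div_mul_cancel₀ _ hxp.ne']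
      have a := hb _ hz
      have b := hb (-((‖F‖ / ‖x‖) • x)) (by rwa [norm_neg])
      rw [map_neg] at b
      rw [map_smul, smul_eq_mul] at a b
      have key : |‖F‖ / ‖x‖ * h x| ≤ r := abs_le.2 ⟨by linarith, a.le⟩
      rw [abs_mul, abs_of_pos (div_pos hp hxp), div_mul_eq_mul_div, div_le_iff₀ hxp] at key
      rw [Real.norm_eq_abs, div_mul_eq_mul_div, le_div_iff₀ hp]
      linarith
    have := (le_abs_self _).trans (F.le_opNorm h)
    linarith
  have hopen : IsOpen {w : s → ℝ | ∀ i, c < w i} := by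
    simp only [Set.ofPred_forall]
    exact isOpen_iInter_of_finite fun i => isOpen_lt continuous_const (continuous_apply i)
  obtain ⟨_, hw, x, hx, rfl⟩ := mem_closure_iff.1 hv _ hopen (fun i => hs i.1 i.2)
  exact ⟨x, by simpa using hx, fun f hf => hw ⟨f, hf⟩⟩

lemma dist_aux {X E : Type*} [NormedAddCommGroup X] [NormedSpace ℝ X] [CompleteSpace X]
    [NormedAddCommGroup E] [NormedSpace ℝ E] (T : X →L[ℝ] E) (hT : ∀ x, ‖T x‖ = ‖x‖)
    (F : E) (hF : F ∉ Set.range T) :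
    ∃ δ : ℝ, 0 < δ ∧ ∀ x, δ ≤ ‖F - T x‖ := by
  have hcl : IsClosed (Set.range T) := (AddMonoidHomClass.isometry_of_norm T hT).isClosedEmbedding.isClosed_range
  refine ⟨_, (hcl.notMem_iff_infDist_pos (Set.range_nonempty _)).1 hF, fun x => ?_⟩
  rw [← dist_eq_norm]
  exact Metric.infDist_le_dist_of_mem ⟨x, rfl⟩

lemma exists_seq_aux {X : Type*} [NormedAddCommGroup X] [NormedSpace ℝ X]
    (F : StrongDual ℝ (StrongDual ℝ X)) (c δ : ℝ) (hc : 0 < c) (hcδ : c < δ)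
    (hdist : ∀ x, δ ≤ ‖F - NormedSpace.inclusionInDoubleDual ℝ X x‖) :
    ∃ p : ℕ → (X →L[ℝ] ℝ) × X, (∀ n, ‖(p n).1‖ ≤ 1 ∧ ‖(p n).2‖ ≤ ‖F‖ ∧ c < F (p n).1) ∧
      ∀ m n, m < n → (p n).1 (p m).2 = 0 ∧ c < (p m).1 (p n).2 := by
  classical
  have key := exists_seq_of_forall_finset_exists
    (fun q : (X →L[ℝ] ℝ) × X => ‖q.1‖ ≤ 1 ∧ ‖q.2‖ ≤ ‖F‖ ∧ c < F q.1)
    (fun q q' => q'.1 q.2 = 0 ∧ c < q.1 q'.2) (by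
      intro s hs
      obtain ⟨f, hf1, hf2, hf3⟩ := step_f F c δ hc hcδ hdist (s.image Prod.snd)
      obtain ⟨x, hx1, hx2⟩ := step_x F c (s.image Prod.fst) (by
        intro f hf
        obtain ⟨q, hq, rfl⟩ := Finset.mem_image.1 hf
        exact (hs q hq).2.2)
      exact ⟨(f, x), ⟨hf1, hx1, hf2⟩, fun q hq =>
        ⟨hf3 _ (Finset.mem_image_of_mem _ hq), hx2 _ (Finset.mem_image_of_mem _ hq)⟩⟩)
  exact key

lemma exists_pair {X : Type*} [NormedAddCommGroup X] [NormedSpace ℝ X] [CompleteSpace X]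
    (hnr : ¬ Function.Surjective (NormedSpace.inclusionInDoubleDual ℝ X)) :
    ∃ (R c : ℝ) (p : ℕ → (X →L[ℝ] ℝ) × X), 0 < R ∧ 0 < c ∧
      (∀ n, ‖(p n).1‖ ≤ 1 ∧ ‖(p n).2‖ ≤ R) ∧
      ∀ m n, m < n → (p n).1 (p m).2 = 0 ∧ c < (p m).1 (p n).2 := by
  obtain ⟨F, hF⟩ : ∃ F, F ∉ Set.range (NormedSpace.inclusionInDoubleDual ℝ X) := by
    by_contra h
    push Not at h
    exact hnr h
  have hn : ∀ x, ‖NormedSpace.inclusionInDoubleDual ℝ X x‖ = ‖x‖ := fun x =>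
    (NormedSpace.inclusionInDoubleDualLi ℝ (E := X)).norm_map x
  obtain ⟨δ, hδ, hdist⟩ := dist_aux (NormedSpace.inclusionInDoubleDual ℝ X) hn F hF
  have hF0 : 0 < ‖F‖ := by
    have h0 := hdist 0
    rw [map_zero, sub_zero] at h0
    exact lt_of_lt_of_le hδ h0
  obtain ⟨p, hp, hr⟩ := exists_seq_aux F (δ/2) δ (half_pos hδ) (half_lt_self hδ) hdist
  exact ⟨‖F‖, δ/2, p, hF0, half_pos hδ, fun n => ⟨(hp n).1, (hp n).2.1⟩, hr⟩

lemma exists_not_na {X : Type*} [NormedAddCommGroup X] [NormedSpace ℝ X] [CompleteSpace X]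
    (hnr : ¬ Function.Surjective (NormedSpace.inclusionInDoubleDual ℝ X))
    [StrictConvexSpace ℝ (X →L[ℝ] ℝ)] : ∃ s : X →L[ℝ] ℝ, ¬ NormAttaining s := by
  obtain ⟨R, c, p, hR, hc, hp, hr⟩ := exists_pair hnr
  obtain ⟨l, g, hl1, hl2, hl3, hg⟩ := exists_conv (fun n => (p n).1) 1 (fun n => (hp n).1)
  have hgx : ∀ k, g (p k).2 = 0 := by
    intro k
    refine tendsto_nhds_unique (hg (p k).2) ?_
    refine tendsto_const_nhds.congr' ?_
    filter_upwards [hl3 (eventually_gt_atTop k)] with n hn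
    exact (hr k n hn).1.symm
  obtain ⟨B, hB⟩ := l.exists_antitone_basis
  let C : ℕ → Set (X →L[ℝ] ℝ) := fun n => convexHull ℝ ((fun j => (p j).1 - g) '' B n)
  refine james_aux C (fun n => convex_convexHull ℝ _) (fun m n h => convexHull_mono
    (Set.image_mono (hB.antitone h))) (fun n => ?_) (1 + ‖g‖) ?_ (c / R) (by positivity) ?_ ?_
  · exact ((hB.1.mem_of_mem trivial |> nonempty_of_mem : (B n).Nonempty).image _).convexHull
  · intro y hy
    have : C 0 ⊆ Metric.closedBall 0 (1 + ‖g‖) := by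
      refine convexHull_min ?_ (convex_closedBall _ _)
      rintro _ ⟨j, -, rfl⟩
      rw [mem_closedBall_zero_iff]
      exact (norm_sub_le _ _).trans (add_le_add_left (hp j).1 _)
    simpa using this hy
  · intro y hy
    have : C 0 ⊆ {y | ∀ᶠ k in atTop, c ≤ y (p k).2} := by
      refine convexHull_min ?_ ?_
      · rintro _ ⟨j, -, rfl⟩
        filter_upwards [eventually_gt_atTop j] with k hk
        show c ≤ (p j).1 (p k).2 - g (p k).2
        rw [hgx, sub_zero]
        exact (hr j k hk).2.le
      · intro a ha b hb s t hs ht hst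
        filter_upwards [ha, hb] with k h1 h2
        show c ≤ s * a (p k).2 + t * b (p k).2
        have : c = s * c + t * c := by rw [← add_mul, hst, one_mul]
        rw [this]
        gcongr
    obtain ⟨k, hk⟩ := (this hy).exists
    rw [div_le_iff₀ hR]
    calc c ≤ y (p k).2 := hk
      _ ≤ ‖y (p k).2‖ := le_abs_self _
      _ ≤ ‖y‖ * ‖(p k).2‖ := y.le_opNorm _
      _ ≤ ‖y‖ * R := by gcongr; exact (hp k).2
  · intro x ε hε
    have h1 : ∀ᶠ n in l, (p n).1 x ≤ g x + ε := by
      filter_upwards [(hg x).eventually (gt_mem_nhds (show g x < g x + ε by linarith))] with n hn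
      exact hn.le
    obtain ⟨n, -, hn⟩ := hB.1.mem_iff.1 h1
    refine ⟨n, fun y hy => ?_⟩
    have : C n ⊆ {y | y x ≤ ε} := by
      refine convexHull_min ?_ ?_
      · rintro _ ⟨j, hj, rfl⟩
        have := hn hj
        show (p j).1 x - g x ≤ ε
        simp only [Set.mem_ofPred_eq] at this
        linarith
      · intro a ha b hb s t hs ht hst
        show s * a x + t * b x ≤ ε
        have e : ε = s * ε + t * ε := by rw [← add_mul, hst, one_mul]
        rw [e]
        exact add_le_add (mul_le_mul_of_nonneg_left ha hs) (mul_le_mul_of_nonneg_left hb ht)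
    exact this hy

/-- For a non-reflexive real Banach space `X` with strictly convex dual, the Bhatia-Semrl
property and the adjusted Bhatia-Semrl property coincide for functionals, and some bounded
linear functional on `X` fails the adjusted Bhatia-Semrl property. -/
theorem hasBS_iff_hasBSa_and_exists_not_hasBSa (X : Type*) [NormedAddCommGroup X]
    [NormedSpace ℝ X] [CompleteSpace X]
    (hnr : ¬ Function.Surjective (NormedSpace.inclusionInDoubleDual ℝ X))
    [StrictConvexSpace ℝ (X →L[ℝ] ℝ)] :
    (∀ f : X →L[ℝ] ℝ, HasBS f ↔ HasBSa f) ∧ ∃ f : X →L[ℝ] ℝ, ¬ HasBSa f := by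
  refine ⟨fun f => ⟨fun h => ⟨h.1, fun S hS => h.2 S fun t => ?_⟩,
    fun h => ⟨h.1, fun S hS => ?_⟩⟩, ?_⟩
  · rcases eq_or_ne t 0 with rfl | ht
    · simp
    · exact (hS t ht).le
  · rcases eq_or_ne S 0 with rfl | hS0
    · obtain ⟨x, hx, hfx⟩ := h.1
      exact ⟨x, hx, hfx, fun t => by simp⟩
    · refine h.2 S fun t ht => lt_of_le_of_ne (hS t) fun e => ?_
      have hne : f ≠ f + t • S := fun e' => (smul_ne_zero ht hS0) (by simpa using e')
      have h1 := (norm_midpoint_lt_iff e).2 hne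
      have h2 := hS (t/2)
      have e2 : (1/2:ℝ) • (f + (f + t • S)) = f + (t/2) • S := by module
      rw [e2] at h1
      linarith
  · obtain ⟨s, hs⟩ := exists_not_na hnr
    exact ⟨s, fun h => hs h.1⟩
end

section
/- Let X be a nontrivial reflexive real Banach space and Y a strictly convex real Banach space. If T, S : X → Y are compact (bounded linear) operators with T ⊥_B S (Birkhoff-James orthogonality in the operator norm), then either T ⊥_S S (strong Birkhoff-James orthogonality in the operator norm), or there exists x ∈ M_T with S x = 0. -/
open scoped BigOperators

theorem compact_attains_aux (X Y : Type*) [NormedAddCommGroup X] [NormedSpace ℝ X]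
    [Nontrivial X]
    (hrefl : Function.Surjective (NormedSpace.inclusionInDoubleDual ℝ X))
    [NormedAddCommGroup Y] [NormedSpace ℝ Y]
    (A : X →L[ℝ] Y) (hA : IsCompactOperator A) :
    ∃ x : X, ‖x‖ = 1 ∧ ‖A x‖ = ‖A‖ := by
  by_cases h0 : A = 0
  · obtain ⟨x, hx⟩ := exists_norm_eq X (zero_le_one (α := ℝ))
    exact ⟨x, hx, by simp [h0]⟩
  have hpos : 0 < ‖A‖ := norm_pos_iff.2 h0
  have hK : IsCompact (closure (A '' Metric.closedBall 0 1)) :=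
    IsCompactOperator.isCompact_closure_image_closedBall (𝕜₁ := ℝ) (f := (A : X →ₗ[ℝ] Y)) hA 1
  have hne : (closure (A '' Metric.closedBall (0 : X) 1)).Nonempty :=
    ⟨A 0, subset_closure ⟨0, by simp, rfl⟩⟩
  obtain ⟨y, hyK, hy⟩ := hK.exists_isMaxOn hne continuous_norm.continuousOn
  have hAy : ‖A‖ ≤ ‖y‖ := by
    refine ContinuousLinearMap.opNorm_le_of_unit_norm (norm_nonneg y) fun z hz => ?_
    exact hy (subset_closure ⟨z, by simp [hz], rfl⟩)
  obtain ⟨u, hu, hlim⟩ := mem_closure_iff_seq_limit.1 hyK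
  choose x hx hxu using hu
  let U : Ultrafilter ℕ := Filter.hyperfilter ℕ
  have hUle : (U : Filter ℕ) ≤ Filter.atTop := Nat.hyperfilter_le_atTop
  let J : ℕ → WeakDual ℝ (StrongDual ℝ X) := fun n =>
    StrongDual.toWeakDual (NormedSpace.inclusionInDoubleDual ℝ X (x n))
  have hcomp := WeakDual.isCompact_closedBall (𝕜 := ℝ) (0 : StrongDual ℝ (StrongDual ℝ X)) 1
  have hmem : ∀ n, J n ∈ WeakDual.toStrongDual ⁻¹'
      Metric.closedBall (0 : StrongDual ℝ (StrongDual ℝ X)) 1 := by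
    intro n
    have h1 : ‖x n‖ ≤ 1 := by simpa using hx n
    have h2 : ‖NormedSpace.inclusionInDoubleDual ℝ X (x n)‖ ≤ 1 :=
      (NormedSpace.double_dual_bound ℝ X (x n)).trans h1
    change NormedSpace.inclusionInDoubleDual ℝ X (x n) ∈ Metric.closedBall (0 : StrongDual ℝ (StrongDual ℝ X)) 1
    exact (mem_closedBall_zero_iff (E := StrongDual ℝ (StrongDual ℝ X))).2 h2
  obtain ⟨F, hF, hFlim⟩ := hcomp.ultrafilter_le_nhds (U.map J)
    (Filter.le_principal_iff.2 (Filter.mem_map.2 (Filter.univ_mem' hmem)))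
  have hFt : Filter.Tendsto J U (nhds F) := hFlim
  obtain ⟨z, hz⟩ := hrefl (WeakDual.toStrongDual F)
  have hzn : ‖z‖ ≤ 1 := by
    have : ‖NormedSpace.inclusionInDoubleDual ℝ X z‖ ≤ 1 := by
      rw [hz]; simpa using hF
    have h3 : ‖NormedSpace.inclusionInDoubleDualLi (𝕜 := ℝ) (E := X) z‖ = ‖z‖ :=
      LinearIsometry.norm_map _ _
    rw [← h3]; exact this
  have hAz : A z = y := by
    refine (SeparatingDual.eq_iff_forall_dual_eq (R := ℝ)).2 fun g => ?_
    have t1 : Filter.Tendsto (fun n => (J n) (g.comp A)) U (nhds (F (g.comp A))) :=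
      ((WeakDual.eval_continuous (g.comp A)).tendsto F).comp hFt
    have e1 : F (g.comp A) = g (A z) := by
      change (WeakDual.toStrongDual F) (g.comp A) = _
      rw [← hz]; rfl
    have t2 : Filter.Tendsto (fun n => g (u n)) U (nhds (g y)) :=
      ((g.continuous.tendsto y).comp hlim).mono_left hUle
    have e2 : (fun n => (J n) (g.comp A)) = fun n => g (u n) := by
      funext n
      rw [← hxu n]; rfl
    rw [e2, e1] at t1
    exact tendsto_nhds_unique t1 t2
  rw [← hAz] at hAy
  have hle := A.le_opNorm z
  have hz1 : ‖z‖ = 1 := by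
    apply le_antisymm hzn
    by_contra hlt
    push Not at hlt
    nlinarith
  refine ⟨z, hz1, le_antisymm ?_ hAy⟩
  simpa [hz1] using hle

/-- Let `X` be a nontrivial reflexive real Banach space and `Y` a strictly convex real Banach
space. If `T, S : X → Y` are compact operators with `T ⊥_B S`, then `T ⊥_S S` or `S x = 0`
for some `x ∈ M_T`. -/
theorem sbjOrth_or_exists_of_compact (X Y : Type*) [NormedAddCommGroup X] [NormedSpace ℝ X]
    [CompleteSpace X] [Nontrivial X]
    (hrefl : Function.Surjective (NormedSpace.inclusionInDoubleDual ℝ X))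
    [NormedAddCommGroup Y] [NormedSpace ℝ Y] [CompleteSpace Y] [StrictConvexSpace ℝ Y]
    (T S : X →L[ℝ] Y) (hT : IsCompactOperator T) (hS : IsCompactOperator S)
    (horth : BJOrth T S) :
    SBJOrth T S ∨ ∃ x : X, ‖x‖ = 1 ∧ ‖T x‖ = ‖T‖ ∧ S x = 0 := by
  by_cases h : SBJOrth T S
  · exact Or.inl h
  right
  unfold SBJOrth at h
  push Not at h
  obtain ⟨t, ht, hle⟩ := h
  have hc : IsCompactOperator (T + (t / 2) • S) := hT.add (hS.smul (t / 2))
  obtain ⟨x, hx, hAx⟩ := compact_attains_aux X Y hrefl (T + (t / 2) • S) hc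
  have h1 : ‖T‖ ≤ ‖(T + (t / 2) • S) x‖ := by rw [hAx]; exact horth _
  have h2 : ‖T x‖ ≤ ‖T‖ := by simpa [hx] using T.le_opNorm x
  have h3 : ‖(T + t • S) x‖ ≤ ‖T‖ := by
    have := (T + t • S).le_opNorm x
    rw [hx, mul_one] at this
    exact this.trans hle
  have e : T x + (T + t • S) x = (2 : ℝ) • (T + (t / 2) • S) x := by
    simp only [add_apply, smul_apply]
    module
  have h4 : ‖T x + (T + t • S) x‖ = 2 * ‖(T + (t / 2) • S) x‖ := by
    rw [e, norm_smul]; norm_num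
  have h5 := norm_add_le (T x) ((T + t • S) x)
  have h6 : ‖T x‖ = ‖T‖ := by linarith
  have h7 : ‖T x‖ = ‖(T + t • S) x‖ := by linarith
  have h8 : T x = (T + t • S) x :=
    (sameRay_iff_norm_add.2 (by linarith)).eq_of_norm_eq h7
  refine ⟨x, hx, h6, ?_⟩
  have h9 : t • S x = 0 := by simpa using h8
  exact (smul_eq_zero.1 h9).resolve_left ht
end

section
/- Let X be a reflexive real Banach space and Y a strictly convex real Banach space such that every bounded linear operator from X to Y is compact. Then BS(X,Y) = BSa(X,Y): a bounded linear operator from X to Y has the Bhatia-Šemrl property if and only if it has the adjusted Bhatia-Šemrl property. -/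
open scoped BigOperators

open Filter Topology in
lemma weak_lim_aux {X Y : Type*} [NormedAddCommGroup X] [NormedSpace ℝ X]
    (hrefl : Function.Surjective (NormedSpace.inclusionInDoubleDual ℝ X))
    [NormedAddCommGroup Y] [NormedSpace ℝ Y] (x : ℕ → X) (hx : ∀ n, ‖x n‖ ≤ 1)
    (U : Ultrafilter ℕ) :
    ∃ a : X, ‖a‖ ≤ 1 ∧ ∀ T : X →L[ℝ] Y, IsCompactOperator T →
      Tendsto (fun n => T (x n)) U (𝓝 (T a)) := by
  have hnorm : ∀ z : X, ‖NormedSpace.inclusionInDoubleDual ℝ X z‖ = ‖z‖ :=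
    fun z => (NormedSpace.inclusionInDoubleDualLi (E := X) ℝ).norm_map z
  let j : ℕ → WeakDual ℝ (StrongDual ℝ X) := fun n =>
    StrongDual.toWeakDual (NormedSpace.inclusionInDoubleDual ℝ X (x n))
  have hK := WeakDual.isCompact_closedBall (𝕜 := ℝ) (0 : StrongDual ℝ (StrongDual ℝ X)) 1
  obtain ⟨φ, hφ, hlim⟩ := hK.ultrafilter_le_nhds (U.map j) (by
    rw [le_principal_iff]
    refine Ultrafilter.mem_map.2 (Filter.univ_mem' fun n => ?_)
    have hmem : NormedSpace.inclusionInDoubleDual ℝ X (x n) ∈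
        Metric.closedBall (0 : StrongDual ℝ (StrongDual ℝ X)) 1 := by
      have := (hnorm (x n)).trans_le (hx n)
      exact (mem_closedBall_zero_iff (E := StrongDual ℝ (StrongDual ℝ X))).2 this
    exact hmem)
  obtain ⟨a, ha⟩ := hrefl (WeakDual.toStrongDual φ)
  have hφ' : WeakDual.toStrongDual φ ∈ Metric.closedBall 0 1 := hφ
  refine ⟨a, ?_, ?_⟩
  · rw [← hnorm, ha]
    simpa using hφ'
  have hw : ∀ f : StrongDual ℝ X, Tendsto (fun n => f (x n)) U (𝓝 (f a)) := by
    intro f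
    have h1 : Tendsto (fun ψ : WeakDual ℝ (StrongDual ℝ X) => ψ f) (𝓝 φ) (𝓝 (φ f)) :=
      (WeakDual.eval_continuous f).tendsto φ
    have h2 : φ f = f a := by
      have := congrArg (fun ψ : StrongDual ℝ (StrongDual ℝ X) => ψ f) ha
      exact this.symm
    rw [h2] at h1
    have h3 : Tendsto j U (𝓝 φ) := hlim
    exact h1.comp h3
  intro T hT
  obtain ⟨K, hK, hTK⟩ := IsCompactOperator.image_closedBall_subset_compact
    (f := (T : X →ₗ[ℝ] Y)) hT 1
  obtain ⟨y, -, hy⟩ := hK.ultrafilter_le_nhds (U.map fun n => T (x n)) (by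
    rw [le_principal_iff]
    refine Ultrafilter.mem_map.2 (Filter.univ_mem' fun n => ?_)
    exact hTK ⟨x n, by simpa using hx n, rfl⟩)
  have hy' : Tendsto (fun n => T (x n)) U (𝓝 y) := hy
  have : y = T a := by
    refine (SeparatingDual.eq_iff_forall_dual_eq (R := ℝ)).2 fun g => ?_
    exact tendsto_nhds_unique ((g.continuous.tendsto y).comp hy') (hw (g.comp T))
  rwa [← this]

open Filter Topology in
lemma core_aux {X Y : Type*} [NormedAddCommGroup X] [NormedSpace ℝ X]
    (hrefl : Function.Surjective (NormedSpace.inclusionInDoubleDual ℝ X))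
    [NormedAddCommGroup Y] [NormedSpace ℝ Y]
    (hcomp : ∀ T : X →L[ℝ] Y, IsCompactOperator T) (T S : X →L[ℝ] Y) (hT : 0 < ‖T‖)
    (hTS : BJOrth T S) (r : ℝ) (hr : 0 < r) (hrle : ‖T + r • S‖ ≤ ‖T‖) :
    ∃ x : X, ‖x‖ = 1 ∧ ‖T x‖ = ‖T‖ ∧ BJOrth (T x) (S x) := by
  let s : ℕ → ℝ := fun n => 1 / ((n : ℝ) + 1)
  have hs : ∀ n, 0 < s n := fun n => by positivity
  have hs0 : Tendsto s atTop (𝓝 0) := tendsto_one_div_add_atTop_nhds_zero_nat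
  have hex : ∀ n, ∃ x : X, ‖x‖ < 1 ∧ ‖T‖ - s n ^ 2 < ‖(T + s n • S) x‖ := fun n =>
    (T + s n • S).exists_lt_apply_of_lt_opNorm
      (by have := hTS (s n); have := pow_pos (hs n) 2; linarith)
  choose x hx1 hx2 using hex
  let U : Ultrafilter ℕ := hyperfilter ℕ
  have hU : (U : Filter ℕ) ≤ atTop := by
    rw [← Nat.cofinite_eq_atTop]; exact hyperfilter_le_cofinite
  obtain ⟨a, ha1, ha⟩ := weak_lim_aux (Y := Y) hrefl x (fun n => (hx1 n).le) U
  have hTa := ha T (hcomp T)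
  have hSa := ha S (hcomp S)
  have hsU : Tendsto s U (𝓝 0) := hs0.mono_left hU
  have hle : ∀ (A : X →L[ℝ] Y) (z : X), ‖z‖ ≤ 1 → ‖A z‖ ≤ ‖A‖ := fun A z hz =>
    A.unit_le_opNorm z hz
  have hge : ‖T‖ ≤ ‖T a‖ := by
    have h1 : Tendsto (fun n => ‖T (x n) + s n • S (x n)‖) U (𝓝 ‖T a + (0:ℝ) • S a‖) :=
      (hTa.add (hsU.smul hSa)).norm
    have h2 : Tendsto (fun n => ‖T‖ - s n ^ 2) U (𝓝 (‖T‖ - 0 ^ 2)) :=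
      tendsto_const_nhds.sub (hsU.pow 2)
    have := le_of_tendsto_of_tendsto' h2 h1 (fun n => (hx2 n).le)
    simpa using this
  have hTeq : ‖T a‖ = ‖T‖ := le_antisymm (hle T a ha1) hge
  refine ⟨a, le_antisymm ha1 ?_, hTeq, ?_⟩
  · have := T.le_opNorm a
    by_contra hlt
    push Not at hlt
    nlinarith
  intro t
  by_contra hlt
  push Not at hlt
  rw [hTeq] at hlt
  rcases lt_trichotomy t 0 with ht | ht | ht
  · have h1 : (r - t) • T a = r • (T a + t • S a) + (-t) • (T a + r • S a) := by module
    have h2 := norm_add_le (r • (T a + t • S a)) ((-t) • (T a + r • S a))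
    rw [← h1, norm_smul, norm_smul, norm_smul, Real.norm_of_nonneg (by linarith),
      Real.norm_of_nonneg hr.le, Real.norm_of_nonneg (by linarith), hTeq] at h2
    have h3 : ‖T a + r • S a‖ ≤ ‖T‖ := (hle (T + r • S) a ha1).trans hrle
    nlinarith
  · simp [ht, hTeq] at hlt
  · obtain ⟨c, hc1, hc2⟩ := exists_between hlt
    have h1 : Tendsto (fun n => ‖T (x n) + t • S (x n)‖) U (𝓝 ‖T a + t • S a‖) :=
      (hTa.add (hSa.const_smul t)).norm
    have e1 := h1.eventually (gt_mem_nhds hc1)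
    have e2 := hsU.eventually (gt_mem_nhds ht)
    have e3 := hsU.eventually (gt_mem_nhds (show 0 < (‖T‖ - c) / t by
      apply div_pos <;> linarith))
    obtain ⟨n, h4, h5, h6⟩ := (e1.and (e2.and e3)).exists
    rw [lt_div_iff₀ ht] at h6
    have h7 : t • (T (x n) + s n • S (x n))
        = s n • (T (x n) + t • S (x n)) + (t - s n) • T (x n) := by module
    have h8 := norm_add_le (s n • (T (x n) + t • S (x n))) ((t - s n) • T (x n))
    rw [← h7, norm_smul, norm_smul, norm_smul, Real.norm_of_nonneg ht.le,
      Real.norm_of_nonneg (hs n).le, Real.norm_of_nonneg (by linarith)] at h8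
    have h9 := hle T (x n) (hx1 n).le
    have h10 : ‖T‖ - s n ^ 2 < ‖T (x n) + s n • S (x n)‖ := hx2 n
    have h11 := hs n
    have k1 := mul_lt_mul_of_pos_left h10 ht
    have k2 := mul_lt_mul_of_pos_left h4 h11
    have k3 := mul_le_mul_of_nonneg_left h9 (sub_nonneg.2 h5.le)
    have k4 := mul_lt_mul_of_pos_left h6 h11
    nlinarith


/-- Let `X` be a reflexive real Banach space and `Y` a strictly convex real Banach space such
that every bounded linear operator from `X` to `Y` is compact. Then the Bhatia-Semrl property
and the adjusted Bhatia-Semrl property coincide. -/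
theorem hasBS_iff_hasBSa_of_reflexive_of_compact (X Y : Type*) [NormedAddCommGroup X]
    [NormedSpace ℝ X] [CompleteSpace X]
    (hrefl : Function.Surjective (NormedSpace.inclusionInDoubleDual ℝ X))
    [NormedAddCommGroup Y] [NormedSpace ℝ Y] [CompleteSpace Y] [StrictConvexSpace ℝ Y]
    (hcomp : ∀ T : X →L[ℝ] Y, IsCompactOperator T) :
    ∀ T : X →L[ℝ] Y, HasBS T ↔ HasBSa T := by
  intro T
  refine ⟨fun h => ⟨h.1, fun S hS => h.2 S fun t => ?_⟩, fun h => ⟨h.1, fun S hS => ?_⟩⟩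
  · by_cases ht : t = 0
    · simp [ht]
    · exact (hS t ht).le
  by_cases hT : T = 0
  · obtain ⟨x, hx, hx'⟩ := h.1
    exact ⟨x, hx, hx', fun t => by simp [hT]⟩
  have hT' : 0 < ‖T‖ := norm_pos_iff.2 hT
  by_cases hSS : SBJOrth T S
  · exact h.2 S hSS
  unfold SBJOrth at hSS
  push Not at hSS
  obtain ⟨r, hr, hrle⟩ := hSS
  rcases lt_or_gt_of_ne hr with hr | hr
  · obtain ⟨x, h1, h2, h3⟩ := core_aux hrefl hcomp T (-S) hT'
      (fun t => by simpa using hS (-t)) (-r) (by linarith) (by simpa using hrle)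
    exact ⟨x, h1, h2, fun t => by simpa using h3 (-t)⟩
  · exact core_aux hrefl hcomp T S hT' hS r hr hrle
end

section
/- The set of bounded linear functionals on C([0,1],ℝ) which attain their norm but do not have the adjusted Bhatia-Šemrl property is norm-dense in the dual space C([0,1],ℝ)*. -/
open scoped BigOperators

open scoped NNReal CompactlySupported
open MeasureTheory

section TV
variable {K : Type*} [TopologicalSpace K] [CompactSpace K]

def tvSet (φ : C(K, ℝ) →L[ℝ] ℝ) (h : K → ℝ≥0) : Set ℝ :=
  {r | ∃ u : C(K, ℝ), (∀ k, |u k| ≤ h k) ∧ φ u = r}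

set_option linter.unusedSectionVars false in
lemma tvSet_zero_mem (φ : C(K, ℝ) →L[ℝ] ℝ) (h : K → ℝ≥0) : (0:ℝ) ∈ tvSet φ h :=
  ⟨0, by simp, by simp⟩

lemma tvSet_le (φ : C(K, ℝ) →L[ℝ] ℝ) (h : K → ℝ≥0) (C : ℝ) (hC : 0 ≤ C) (hh : ∀ k, (h k : ℝ) ≤ C)
    (r : ℝ) (hr : r ∈ tvSet φ h) : r ≤ ‖φ‖ * C := by
  obtain ⟨u, hu, rfl⟩ := hr
  calc φ u ≤ ‖φ u‖ := le_abs_self _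
    _ ≤ ‖φ‖ * ‖u‖ := φ.le_opNorm u
    _ ≤ _ := by
      gcongr
      exact (ContinuousMap.norm_le _ hC).2 fun k => (hu k).trans (hh k)

lemma tvSet_bdd (φ : C(K, ℝ) →L[ℝ] ℝ) (h : C_c(K, ℝ≥0)) : BddAbove (tvSet φ h) := by
  let h' : C(K, ℝ) := ⟨fun k => (h k : ℝ), by fun_prop⟩
  refine ⟨‖φ‖ * ‖h'‖, fun r hr => tvSet_le φ h _ (norm_nonneg _) (fun k => ?_) r hr⟩
  exact (le_abs_self _).trans (h'.norm_coe_le_norm k)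

noncomputable def tvN (φ : C(K, ℝ) →L[ℝ] ℝ) (h : C_c(K, ℝ≥0)) : ℝ := sSup (tvSet φ h)

lemma tvN_nonneg (φ : C(K, ℝ) →L[ℝ] ℝ) (h : C_c(K, ℝ≥0)) : 0 ≤ tvN φ h :=
  le_csSup (tvSet_bdd φ h) (tvSet_zero_mem φ h)

lemma le_tvN (φ : C(K, ℝ) →L[ℝ] ℝ) (h : C_c(K, ℝ≥0)) (u : C(K, ℝ)) (hu : ∀ k, |u k| ≤ h k) :
    φ u ≤ tvN φ h := le_csSup (tvSet_bdd φ h) ⟨u, hu, rfl⟩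

lemma tvN_le (φ : C(K, ℝ) →L[ℝ] ℝ) (h : C_c(K, ℝ≥0)) (B : ℝ)
    (H : ∀ u : C(K, ℝ), (∀ k, |u k| ≤ h k) → φ u ≤ B) : tvN φ h ≤ B := by
  refine csSup_le ⟨0, tvSet_zero_mem φ h⟩ ?_
  rintro r ⟨u, hu, rfl⟩
  exact H u hu

lemma tvN_add (φ : C(K, ℝ) →L[ℝ] ℝ) (h₁ h₂ : C_c(K, ℝ≥0)) :
    tvN φ (h₁ + h₂) = tvN φ h₁ + tvN φ h₂ := by
  apply le_antisymm
  · apply tvN_le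
    intro u hu
    let u₁ : C(K, ℝ) := ⟨fun k => max (-(h₁ k : ℝ)) (min (h₁ k : ℝ) (u k)), by fun_prop⟩
    have e : u = u₁ + (u - u₁) := by abel
    rw [e, map_add]
    apply add_le_add
    · apply le_tvN
      intro k
      have := (h₁ k).2
      change |max (-(h₁ k : ℝ)) (min (h₁ k : ℝ) (u k))| ≤ _
      rw [abs_le]
      exact ⟨le_max_left _ _, max_le (by linarith [NNReal.coe_nonneg (h₁ k)]) (min_le_left _ _)⟩
    · apply le_tvN
      intro k
      have h1 := NNReal.coe_nonneg (h₁ k)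
      have h2 := NNReal.coe_nonneg (h₂ k)
      have h3 := hu k
      change |u k - max (-(h₁ k : ℝ)) (min (h₁ k : ℝ) (u k))| ≤ _
      simp only [CompactlySupportedContinuousMap.coe_add, Pi.add_apply, NNReal.coe_add] at h3
      rw [abs_le] at *
      rcases max_cases (-(h₁ k : ℝ)) (min (h₁ k : ℝ) (u k)) with h | h <;>
      rcases min_cases (h₁ k : ℝ) (u k) with h' | h' <;> constructor <;> linarith [h.1, h'.1, h.2, h'.2]
  · have key : ∀ u : C(K, ℝ), (∀ k, |u k| ≤ h₁ k) → φ u ≤ tvN φ (h₁ + h₂) - tvN φ h₂ := by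
      intro u hu
      have : tvN φ h₂ ≤ tvN φ (h₁ + h₂) - φ u := by
        apply tvN_le
        intro v hv
        have : φ (u + v) ≤ tvN φ (h₁ + h₂) := by
          apply le_tvN
          intro k
          simpa using (abs_add_le (u k) (v k)).trans (add_le_add (hu k) (hv k))
        rw [map_add] at this
        linarith
      linarith
    linarith [tvN_le φ h₁ _ key]

lemma tvN_smul_le (φ : C(K, ℝ) →L[ℝ] ℝ) (c : ℝ≥0) (hc : c ≠ 0) (h : C_c(K, ℝ≥0)) :
    tvN φ (c • h) ≤ c * tvN φ h := by
  apply tvN_le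
  intro u hu
  have hc' : (0:ℝ) < c := by positivity
  have e : u = (c:ℝ) • ((c:ℝ)⁻¹ • u) := by rw [smul_inv_smul₀ hc'.ne']
  rw [e, map_smul, smul_eq_mul]
  gcongr
  apply le_tvN
  intro k
  have := hu k
  simp only [CompactlySupportedContinuousMap.coe_smul, Pi.smul_apply, smul_eq_mul, NNReal.coe_mul] at this
  rw [ContinuousMap.smul_apply, smul_eq_mul, abs_mul, abs_inv, abs_of_pos hc', inv_mul_le_iff₀ hc']
  exact this

lemma tvN_smul (φ : C(K, ℝ) →L[ℝ] ℝ) (c : ℝ≥0) (h : C_c(K, ℝ≥0)) :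
    tvN φ (c • h) = c * tvN φ h := by
  by_cases hc : c = 0
  · subst hc
    have := tvN_add φ 0 0
    simp at this
    simp [this]
  · apply le_antisymm (tvN_smul_le φ c hc h)
    have := tvN_smul_le φ c⁻¹ (inv_ne_zero hc) (c • h)
    rw [inv_smul_smul₀ hc] at this
    have hc' : (0:ℝ) < c := by positivity
    rwa [NNReal.coe_inv, le_inv_mul_iff₀ hc'] at this

noncomputable def tvL (φ : C(K, ℝ) →L[ℝ] ℝ) : C_c(K, ℝ≥0) →ₗ[ℝ≥0] ℝ≥0 where
  toFun h := ⟨tvN φ h, tvN_nonneg φ h⟩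
  map_add' a b := NNReal.eq (tvN_add φ a b)
  map_smul' c a := NNReal.eq (tvN_smul φ c a)

lemma exists_tv [T2Space K] [MeasurableSpace K] [BorelSpace K] (φ : C(K, ℝ) →L[ℝ] ℝ) :
    ∃ μ : Measure K, IsFiniteMeasure μ ∧ (∀ y : C(K, ℝ), φ y ≤ ∫ k, |y k| ∂μ) ∧
      ∫ _, (1:ℝ) ∂μ ≤ ‖φ‖ := by
  have R (h : C(K, ℝ≥0)) := NNRealRMK.integral_rieszMeasure (tvL φ)
    (CompactlySupportedContinuousMap.continuousMapEquiv h)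
  refine ⟨NNRealRMK.rieszMeasure (tvL φ), ⟨isCompact_univ.measure_lt_top⟩, fun y => ?_, ?_⟩
  · have := R ⟨fun k => ⟨|y k|, abs_nonneg _⟩, by fun_prop⟩
    refine le_trans ?_ this.symm.le
    apply le_tvN
    intro k
    exact le_rfl
  · have := R 1
    have h2 : ∫ _, (1:ℝ) ∂(NNRealRMK.rieszMeasure (tvL φ)) = tvN φ (CompactlySupportedContinuousMap.continuousMapEquiv 1) := this
    rw [h2]
    apply tvN_le
    intro u hu
    have := tvSet_le φ (fun _ => 1) 1 zero_le_one (fun _ => le_rfl) (φ u) ⟨u, hu, rfl⟩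
    simpa using this
end TV

section Main

local notation "KK" => Set.Icc (0:ℝ) 1

lemma isOpenPos_vol : (volume : Measure unitInterval).IsOpenPosMeasure := by
  constructor
  intro U hU hne h0
  obtain ⟨V, hV, rfl⟩ := isOpen_induced_iff.1 hU
  obtain ⟨x, hx⟩ := hne
  have hx1 : (x:ℝ) ∈ closure (Set.Ioo (0:ℝ) 1) := by
    rw [closure_Ioo (by norm_num)]; exact x.2
  have hne2 : (V ∩ Set.Ioo (0:ℝ) 1).Nonempty := mem_closure_iff.1 hx1 V hV hx
  have hpos := (hV.inter isOpen_Ioo).measure_pos volume hne2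
  rw [unitInterval.volume_apply] at h0
  refine hpos.ne' (measure_mono_null ?_ h0)
  rintro y ⟨hy, hy'⟩
  exact ⟨⟨y, hy'.1.le, hy'.2.le⟩, hy, rfl⟩

lemma intg (μ : Measure KK) [IsFiniteMeasure μ] (f : KK → ℝ) (hf : Continuous f) :
    Integrable f μ := by
  have := hf.continuousOn (s := Set.univ) |>.integrableOn_compact (μ := μ) isCompact_univ
  simpa using this

/-- integration functional `y ↦ ∫ w y dμ` -/
noncomputable def intF (μ : Measure KK) [IsFiniteMeasure μ] (w : C(KK, ℝ)) : C(KK, ℝ) →L[ℝ] ℝ :=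
  LinearMap.mkContinuous
    { toFun := fun y => ∫ k, w k * y k ∂μ
      map_add' := fun a b => by
        rw [← integral_add (intg μ _ (by fun_prop)) (intg μ _ (by fun_prop))]
        simp [mul_add]
      map_smul' := fun c a => by
        simp only [RingHom.id_apply, smul_eq_mul]
        rw [← integral_const_mul]
        congr 1; ext k; simp; ring }
    (∫ k, |w k| ∂μ) (fun y => by
      rw [← integral_mul_const]
      refine (norm_integral_le_integral_norm _).trans ?_
      refine integral_mono (intg μ _ (by fun_prop)) (intg μ _ (by fun_prop)) (fun k => ?_)
      simp only [norm_mul, Real.norm_eq_abs]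
      gcongr
      exact y.norm_coe_le_norm k)

lemma intF_apply (μ : Measure KK) [IsFiniteMeasure μ] (w y : C(KK, ℝ)) :
    intF μ w y = ∫ k, w k * y k ∂μ := rfl

noncomputable def mulF (φ : C(KK, ℝ) →L[ℝ] ℝ) (a : C(KK, ℝ)) : C(KK, ℝ) →L[ℝ] ℝ :=
  φ.comp (ContinuousLinearMap.mul ℝ C(KK, ℝ) a)

lemma mulF_apply (φ : C(KK, ℝ) →L[ℝ] ℝ) (a y : C(KK, ℝ)) : mulF φ a y = φ (a * y) := rfl

noncomputable def evF (p : KK) : C(KK, ℝ) →L[ℝ] ℝ := ContinuousMap.evalCLM ℝ p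

lemma evF_apply (p : KK) (y : C(KK, ℝ)) : evF p y = y p := rfl

lemma exists_good (μ : Measure KK) [IsFiniteMeasure μ] (w : C(KK, ℝ)) (q : KK) (hq : w q ≠ 0) :
    ∃ p, w p ≠ 0 ∧ (μ + (volume : Measure unitInterval) : Measure KK) {p} = 0 := by
  have := isOpenPos_vol
  have hc : Set.Countable {p : KK | 0 < μ {p}} :=
    Measure.countable_meas_pos_of_disjoint_iUnion (fun p => measurableSet_singleton p)
      (fun a b hab => by simpa using hab)
  have h0 : (volume : Measure unitInterval) {p : KK | 0 < μ {p}} = 0 := hc.measure_zero _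
  have hU : IsOpen {p : KK | w p ≠ 0} := isOpen_ne_fun w.continuous continuous_const
  have h1 := hU.measure_pos (volume : Measure unitInterval) ⟨q, hq⟩
  by_contra! H
  refine h1.ne' (measure_mono_null (fun p hp => ?_) h0)
  have h2 := H p hp
  have h3 : (volume : Measure unitInterval) {p} = 0 := measure_singleton p
  change (μ {p} + (volume : Measure unitInterval) {p} ≠ 0) at h2
  rw [h3, add_zero] at h2
  exact pos_iff_ne_zero.2 h2

lemma exists_bump (ν : Measure KK) [IsFiniteMeasure ν] (p : KK) (hp : ν {p} = 0) (δ : ℝ) (hδ : 0 < δ) :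
    ∃ b : C(KK, ℝ), b p = 1 ∧ (∀ k, 0 ≤ b k ∧ b k ≤ 1) ∧ ∫ k, b k ∂ν < δ := by
  obtain ⟨U, hpU, hU, hν⟩ := Set.exists_isOpen_lt_of_lt (μ := ν) {p} (ENNReal.ofReal δ)
    (by rw [hp]; simpa using hδ)
  obtain ⟨b, hb0, hb1, hb⟩ := exists_continuous_zero_one_of_isClosed (s := Uᶜ) (t := {p})
    hU.isClosed_compl isClosed_singleton (by
      rw [Set.disjoint_singleton_right]; simpa using hpU)
  refine ⟨b, hb1 rfl, fun k => hb k, ?_⟩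
  have h1 : ∫ k, b k ∂ν ≤ ∫ k, U.indicator (fun _ => (1:ℝ)) k ∂ν := by
    refine integral_mono (intg ν _ (by fun_prop)) ((integrable_const _).indicator hU.measurableSet) ?_
    intro k
    by_cases hk : k ∈ U
    · simpa [hk] using (hb k).2
    · have := hb0 (show k ∈ Uᶜ from hk)
      simp [hk, this]
  refine h1.trans_lt ?_
  rw [integral_indicator hU.measurableSet]
  simp only [integral_const, smul_eq_mul, mul_one, measureReal_restrict_apply_univ]
  exact (ENNReal.toReal_lt_of_lt_ofReal hν)

lemma main_step (φ : C(KK, ℝ) →L[ℝ] ℝ) (x : C(KK, ℝ)) (hx : ‖x‖ ≤ 1) (q : KK) (hq : 1/2 < |x q|)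
    (η ε : ℝ) (hη : ‖φ‖ - η ≤ φ x) (hη0 : 0 ≤ η) (hε : 0 < ε) :
    ∃ f : C(KK, ℝ) →L[ℝ] ℝ, (NormAttaining f ∧ ¬ HasBSa f) ∧ ‖φ - f‖ ≤ 2 * η + ε := by
  obtain ⟨μ, hμ, hφ, h1⟩ := exists_tv φ
  have hop := isOpenPos_vol
  have hxk : ∀ k, |x k| ≤ 1 := fun k => (x.norm_coe_le_norm k).trans hx
  let L : Measure KK := (volume : Measure unitInterval)
  have hL : IsProbabilityMeasure L := inferInstanceAs (IsProbabilityMeasure (volume : Measure unitInterval))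
  have hLop : L.IsOpenPosMeasure := hop
  let z : C(KK, ℝ) := ⟨fun k => max (-1) (min 1 (2 * x k)), by fun_prop⟩
  let w : C(KK, ℝ) := 2 * x - z
  let a : C(KK, ℝ) := ⟨fun k => |w k|, by fun_prop⟩
  have hz : ∀ k, z k = max (-1) (min 1 (2 * x k)) := fun k => rfl
  have hw : ∀ k, w k = 2 * x k - z k := fun k => rfl
  have ha : ∀ k, a k = |w k| := fun k => rfl
  have cases : ∀ k, (z k = 1 ∧ 0 ≤ w k ∧ a k = w k ∧ 1/2 ≤ x k ∧ w k = 2 * x k - 1) ∨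
      (z k = -1 ∧ w k ≤ 0 ∧ a k = - w k ∧ x k ≤ -1/2 ∧ w k = 2 * x k + 1) ∨
      (|z k| ≤ 1 ∧ w k = 0 ∧ a k = 0 ∧ -1/2 ≤ x k ∧ x k ≤ 1/2) := by
    intro k
    rcases le_total (1/2) (x k) with h | h
    · left
      have : z k = 1 := by
        rw [hz, min_eq_left (by linarith), max_eq_right (by norm_num)]
      have hw' : w k = 2 * x k - 1 := by rw [hw, this]
      exact ⟨this, by linarith, by rw [ha, abs_of_nonneg (by linarith)], h, hw'⟩
    · right
      rcases le_total (x k) (-1/2) with h' | h'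
      · left
        have : z k = -1 := by
          rw [hz, max_eq_left]
          exact (min_le_right _ _).trans (by linarith)
        have hw' : w k = 2 * x k + 1 := by rw [hw, this]; ring
        exact ⟨this, by linarith, by rw [ha, abs_of_nonpos (by linarith)], h', hw'⟩
      · right
        have : z k = 2 * x k := by
          rw [hz, min_eq_right (by linarith), max_eq_right (by linarith)]
        have hw' : w k = 0 := by rw [hw, this]; ring
        exact ⟨by rw [this, abs_le]; constructor <;> linarith, hw', by rw [ha, hw', abs_zero], h', h⟩
  have hz1 : ∀ k, |z k| ≤ 1 := by
    intro k
    rcases cases k with h | h | h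
    · simp [h.1]
    · simp [h.1]
    · exact h.1
  have ha1 : ∀ k, 0 ≤ a k ∧ a k ≤ 1 := by
    intro k
    have := abs_le.1 (hxk k)
    rcases cases k with h | h | h <;> constructor <;> linarith [h.2.1, h.2.2.1, h.2.2.2]
  let f : C(KK, ℝ) →L[ℝ] ℝ := (1/2 : ℝ) • (intF μ w + mulF φ a) + ε • intF L w
  have hf : ∀ y, f y = (1/2) * (∫ k, w k * y k ∂μ + φ (a * y)) + ε * ∫ k, w k * y k ∂L := fun y => rfl
  -- key inequality
  have key : ∀ y : C(KK, ℝ), (∀ k, |y k| ≤ 1) → ε * ∫ k, |w k - a k * y k| ∂L ≤ f z - f y := by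
    intro y hy
    have e0 : ∀ k, w k * z k - w k * y k = |w k - a k * y k| := by
      intro k
      have := abs_le.1 (hy k)
      rcases cases k with ⟨h1, h2, h3, -⟩ | ⟨h1, h2, h3, -⟩ | ⟨h1, h2, h3, -⟩
      · rw [h1, h3, abs_of_nonneg] <;> nlinarith
      · rw [h1, h3, abs_of_nonpos] <;> nlinarith
      · simp [h2, h3]
    have e1 (ν : Measure KK) [IsFiniteMeasure ν] :
        ∫ k, w k * z k ∂ν - ∫ k, w k * y k ∂ν = ∫ k, |w k - a k * y k| ∂ν := by
      rw [← integral_sub (intg ν _ (by fun_prop)) (intg ν _ (by fun_prop))]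
      simp only [e0]
    have e2 : a * z = w := by
      ext k
      rw [ContinuousMap.mul_apply]
      rcases cases k with ⟨h1, h2, h3, -⟩ | ⟨h1, h2, h3, -⟩ | ⟨h1, h2, h3, -⟩
      · rw [h1, h3]; ring
      · rw [h1, h3]; ring
      · simp [h2, h3]
    have e3 := hφ (-(w - a * y))
    simp only [map_neg, map_sub, ContinuousMap.neg_apply, abs_neg, ContinuousMap.sub_apply,
      ContinuousMap.mul_apply] at e3
    rw [← e1 μ] at e3
    rw [hf, hf, e2, ← e1 L]
    linarith
  have hnn : ∀ y : C(KK, ℝ), (∀ k, |y k| ≤ 1) → f y ≤ f z := by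
    intro y hy
    have h2 := key y hy
    have h3 : 0 ≤ ∫ k, |w k - a k * y k| ∂L := integral_nonneg fun k => abs_nonneg _
    nlinarith
  have hfz0 : 0 ≤ f z := by simpa using hnn 0 (by simp)
  have hyn : ∀ y : C(KK, ℝ), (∀ k, |y k| ≤ 1) → ‖y‖ ≤ 1 := fun y hy =>
    (ContinuousMap.norm_le _ zero_le_one).2 hy
  have hfn : ‖f‖ = f z := by
    apply le_antisymm
    · refine ContinuousLinearMap.opNorm_le_of_unit_norm hfz0 fun y hy => ?_
      have hy' : ∀ k, |y k| ≤ 1 := fun k => (y.norm_coe_le_norm k).trans hy.le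
      rw [Real.norm_eq_abs, abs_le]
      have := hnn (-y) (by simpa using hy')
      rw [map_neg] at this
      exact ⟨by linarith, hnn y hy'⟩
    · refine (le_abs_self _).trans ((f.le_opNorm z).trans ?_)
      exact mul_le_of_le_one_right (norm_nonneg _) (hyn z hz1)
  have hwq : w q ≠ 0 := by
    intro h
    rcases lt_abs.1 hq with h' | h' <;> rcases cases q with c | c | c <;> linarith [c.2.1, c.2.2.2]
  obtain ⟨p, hp, hpν⟩ := exists_good μ w q hwq
  have hzp : z p * z p = 1 ∧ |z p| = 1 := by
    rcases cases p with c | c | c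
    · simp [c.1]
    · simp [c.1]
    · exact absurd c.2.1 hp
  have hzn : ‖z‖ = 1 := le_antisymm (hyn z hz1) (by
    have := z.norm_coe_le_norm p
    rwa [Real.norm_eq_abs, hzp.2] at this)
  have hmax : ∀ y : C(KK, ℝ), (∀ k, |y k| ≤ 1) → f y = f z → w p = a p * y p := by
    intro y hy he
    have h2 := key y hy
    rw [he, sub_self] at h2
    have h3 : 0 ≤ ∫ k, |w k - a k * y k| ∂L := integral_nonneg fun k => abs_nonneg _
    have h4 : ∫ k, |w k - a k * y k| ∂L = 0 := by nlinarith
    have hcont : Continuous fun k => |w k - a k * y k| := by fun_prop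
    rw [integral_eq_zero_iff_of_nonneg (fun k => abs_nonneg _) (intg L _ hcont)] at h4
    have h5 := (hcont.ae_eq_iff_eq L continuous_const).1 h4
    have h6 := congrFun h5 p
    have h7 : |w p - a p * y p| = 0 := h6
    linarith [abs_eq_zero.1 h7]
  refine ⟨f, ⟨⟨z, hzn, by rw [hfn, Real.norm_eq_abs, abs_of_nonneg hfz0]⟩, ?_⟩, ?_⟩
  · rintro ⟨-, H⟩
    have hS : SBJOrth f (evF p) := by
      intro t ht
      have hlow : ∀ y : C(KK, ℝ), (∀ k, |y k| ≤ 1) → f y + t * y p ≤ ‖f + t • evF p‖ := by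
        intro y hy
        refine (le_abs_self _).trans (((f + t • evF p).le_opNorm y).trans ?_)
        exact mul_le_of_le_one_right (norm_nonneg _) (hyn y hy)
      rw [hfn]
      by_cases hs : 0 < t * z p
      · linarith [hlow z hz1]
      · have hs' : t * z p = - |t| := by
          have := abs_mul t (z p)
          rw [hzp.2, mul_one, abs_of_nonpos (not_lt.1 hs)] at this
          linarith
        have htp : 0 < |t| := abs_pos.2 ht
        obtain ⟨b, hb1, hb2, hb3⟩ := exists_bump (μ + L) p hpν (|t| / (2 * (1 + ε))) (by positivity)
        let y : C(KK, ℝ) := z - 2 * (z * b)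
        have hyk : ∀ k, y k = z k - 2 * (z k * b k) := fun k => rfl
        have hy : ∀ k, |y k| ≤ 1 := by
          intro k
          have e : y k = z k * (1 - 2 * b k) := by rw [hyk]; ring
          rw [e, abs_mul]
          refine mul_le_one₀ (hz1 k) (abs_nonneg _) ?_
          rw [abs_le]; constructor <;> linarith [(hb2 k).1, (hb2 k).2]
        have h11 := hlow y hy
        have e1 : y p = - z p := by rw [hyk, hb1]; ring
        have hyf : f y = f z - 2 * f (z * b) := by
          have : y = z - (2:ℝ) • (z * b) := by
            ext k; simp [hyk]
          rw [this, map_sub, map_smul, smul_eq_mul]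
        rw [e1, hyf] at h11
        rw [integral_add_measure (intg μ _ (by fun_prop)) (intg L _ (by fun_prop))] at hb3
        have hbd (ν : Measure KK) [IsFiniteMeasure ν] : ∫ k, w k * (z * b) k ∂ν ≤ ∫ k, b k ∂ν := by
          refine integral_mono (intg ν _ (by fun_prop)) (intg ν _ (by fun_prop)) fun k => ?_
          have h12 : w k * z k ≤ 1 := by
            have h13 := ha1 k
            rcases cases k with c | c | c
            · rw [c.1]; linarith [c.2.2.1]
            · rw [c.1]; linarith [c.2.2.1]
            · rw [c.2.1]; linarith
          simp only [ContinuousMap.mul_apply]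
          rw [← mul_assoc]
          exact mul_le_of_le_one_left (hb2 k).1 h12
        have hbφ : φ (a * (z * b)) ≤ ∫ k, b k ∂μ := by
          refine (hφ _).trans ?_
          refine integral_mono (intg μ _ (by fun_prop)) (intg μ _ (by fun_prop)) fun k => ?_
          simp only [ContinuousMap.mul_apply, abs_mul, abs_of_nonneg (ha1 k).1, abs_of_nonneg (hb2 k).1]
          rw [← mul_assoc]
          exact mul_le_of_le_one_left (hb2 k).1 (mul_le_one₀ (ha1 k).2 (abs_nonneg _) (hz1 k))
        have hb0 (ν : Measure KK) : 0 ≤ ∫ k, b k ∂ν := integral_nonneg fun k => (hb2 k).1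
        rw [lt_div_iff₀ (by positivity)] at hb3
        have h14 : f (z * b) < |t| / 2 := by
          rw [hf]
          have := hbd μ
          have h15 := mul_le_mul_of_nonneg_left (hbd L) hε.le
          nlinarith [hb0 μ, hb0 L, mul_nonneg hε.le (hb0 μ)]
        linarith
    obtain ⟨y, hy1, hy2, hy3⟩ := H (evF p) hS
    · have hy' : ∀ k, |y k| ≤ 1 := fun k => (y.norm_coe_le_norm k).trans hy1.le
      have hyp : y p ≠ 0 := by
        rw [hfn, Real.norm_eq_abs] at hy2
        rcases (abs_eq hfz0).1 hy2 with h | h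
        · intro h0
          have := hmax y hy' h
          rw [h0, mul_zero] at this
          exact hp this
        · intro h0
          have := hmax (-y) (by simpa using hy') (by rw [map_neg, h, neg_neg])
          rw [ContinuousMap.neg_apply, h0, neg_zero, mul_zero] at this
          exact hp this
      have h8 := hy3 (-(f y) / y p)
      rw [evF_apply, smul_eq_mul, div_mul_cancel₀ _ hyp, add_neg_cancel, norm_zero, hy2, hfn] at h8
      -- f z > 0
      have h9 := key 0 (by simp)
      have h10 : f z = f 0 := by rw [map_zero]; linarith
      have := hmax 0 (by simp) h10.symm
      rw [ContinuousMap.zero_apply, mul_zero] at this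
      exact hp this
  · -- distance
    have one : ∀ y : C(KK, ℝ), (∀ k, |y k| ≤ 1) → (φ - f) y ≤ 2 * η + ε := by
      intro y hy
      have e1 := hφ (w + (2 - a) * y)
      have e2 := hφ (4 * x - w)
      have b1 : ∫ k, |(w + (2 - a) * y) k| ∂μ ≤ ∫ k, (2 * 1 - a k + w k * y k) ∂μ := by
        refine integral_mono (intg μ _ (by fun_prop)) (intg μ _ (by fun_prop)) fun k => ?_
        change |w k + (2 - a k) * y k| ≤ 2 * 1 - a k + w k * y k
        have := abs_le.1 (hy k)
        have h13 := ha1 k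
        rcases cases k with ⟨c1, c2, c3, c4⟩ | ⟨c1, c2, c3, c4⟩ | ⟨c1, c2, c3, c4⟩
        · rw [abs_le]; constructor <;> nlinarith
        · rw [abs_le]; constructor <;> nlinarith
        · rw [c2, c3, abs_le]; constructor <;> linarith
      have b2 : ∫ k, |(4 * x - w) k| ∂μ ≤ ∫ k, (2 * 1 + a k) ∂μ := by
        refine integral_mono (intg μ _ (by fun_prop)) (intg μ _ (by fun_prop)) fun k => ?_
        change |4 * x k - w k| ≤ 2 * 1 + a k
        rcases cases k with ⟨c1, c2, c3, c4⟩ | ⟨c1, c2, c3, c4⟩ | ⟨c1, c2, c3, c4⟩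
        · rw [abs_le]; constructor <;> linarith
        · rw [abs_le]; constructor <;> linarith
        · rw [c2, c3, abs_le]; constructor <;> linarith
      have b3 : -∫ k, w k * y k ∂L ≤ 1 := by
        rw [← integral_neg]
        have : ∫ k, -(w k * y k) ∂L ≤ ∫ _, (1:ℝ) ∂L := by
          refine integral_mono (intg L _ (by fun_prop)) (intg L _ (by fun_prop)) fun k => ?_
          refine (neg_le_abs _).trans ?_
          rw [abs_mul]
          exact mul_le_one₀ (ha1 k).2 (abs_nonneg _) (hy k)
        simpa using this
      rw [integral_add (intg μ _ (by fun_prop)) (intg μ _ (by fun_prop)),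
        integral_sub (intg μ _ (by fun_prop)) (intg μ _ (by fun_prop)), integral_const_mul] at b1
      rw [integral_add (intg μ _ (by fun_prop)) (intg μ _ (by fun_prop)), integral_const_mul] at b2
      have d1 : φ (w + (2 - a) * y) = φ w + 2 * φ y - φ (a * y) := by
        have : w + (2 - a) * y = w + (2:ℝ) • y - a * y := by
          ext k
          change w k + (2 - a k) * y k = w k + 2 * y k - a k * y k
          ring
        rw [this, map_sub, map_add, map_smul, smul_eq_mul]
      have d2 : φ (4 * x - w) = 4 * φ x - φ w := by
        have : 4 * x - w = (4:ℝ) • x - w := by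
          rfl
        rw [this, map_sub, map_smul, smul_eq_mul]
      rw [sub_apply, hf]
      have b4 := mul_le_mul_of_nonneg_left b3 hε.le
      linarith
    refine ContinuousLinearMap.opNorm_le_of_unit_norm (by positivity) fun y hy => ?_
    have hy' : ∀ k, |y k| ≤ 1 := fun k => (y.norm_coe_le_norm k).trans hy.le
    rw [Real.norm_eq_abs, abs_le]
    have := one (-y) (by simpa using hy')
    rw [map_neg] at this
    exact ⟨by linarith, one y hy'⟩

lemma gen_dense {E : Type*} [NormedAddCommGroup E] [NormedSpace ℝ E] (S : Set (E →L[ℝ] ℝ))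
    (h : ∀ (φ : E →L[ℝ] ℝ) (ε : ℝ), 0 < ε → ∃ f ∈ S, ‖φ - f‖ < ε) : Dense S := by
  intro φ
  rw [Metric.mem_closure_iff]
  intro ε hε
  obtain ⟨f, hf, hd⟩ := h φ ε hε
  exact ⟨f, hf, by rwa [dist_eq_norm]⟩

lemma gen_cases {E : Type*} [NormedAddCommGroup E] [NormedSpace ℝ E] (φ : E →L[ℝ] ℝ) :
    (‖φ‖ = 0 ∧ ∀ x, φ x = 0) ∨ 0 < ‖φ‖ := by
  by_cases h : φ = 0
  · left; simp [h]
  · right; exact norm_pos_iff.2 h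

end Main

/-- The set of norm attaining functionals on `C([0,1],ℝ)` without the adjusted Bhatia-Semrl
property is norm-dense in the dual of `C([0,1],ℝ)`. -/
theorem dense_normAttaining_not_hasBSa_C01 :
    Dense {f : C(Set.Icc (0:ℝ) 1, ℝ) →L[ℝ] ℝ | NormAttaining f ∧ ¬ HasBSa f} := by
  refine gen_dense _ fun φ ε hε => ?_
  have : ∃ (x : C(Set.Icc (0:ℝ) 1, ℝ)) (q : Set.Icc (0:ℝ) 1), ‖x‖ ≤ 1 ∧ 1/2 < |x q| ∧
      ‖φ‖ - ε / 8 ≤ φ x := by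
    rcases gen_cases φ with ⟨h0, h0'⟩ | hpos
    · refine ⟨1, ⟨0, by simp⟩, by simp, by norm_num, ?_⟩
      rw [h0, h0']
      linarith
    · have hm : max (‖φ‖ - ε / 8) (‖φ‖ / 2) < ‖φ‖ := max_lt (by linarith) (by linarith)
      obtain ⟨x, hx, hx'⟩ := ContinuousLinearMap.exists_lt_apply_of_lt_opNorm φ hm
      have key : ∀ x : C(Set.Icc (0:ℝ) 1, ℝ), ‖x‖ < 1 → max (‖φ‖ - ε / 8) (‖φ‖ / 2) < φ x →
          ∃ (x : C(Set.Icc (0:ℝ) 1, ℝ)) (q : Set.Icc (0:ℝ) 1), ‖x‖ ≤ 1 ∧ 1/2 < |x q| ∧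
            ‖φ‖ - ε / 8 ≤ φ x := by
        intro x hx hx'
        obtain ⟨h1, h2⟩ := max_lt_iff.1 hx'
        by_contra! H
        have h3 : ∀ q, |x q| ≤ 1/2 := by
          intro q
          by_contra! hq
          linarith [H x q hx.le hq]
        have h4 : ‖x‖ ≤ 1/2 := (ContinuousMap.norm_le _ (by norm_num)).2 h3
        have h5 := (le_abs_self _).trans (φ.le_opNorm x)
        nlinarith
      rcases lt_abs.1 hx' with h | h
      · exact key x hx h
      · exact key (-x) (by simpa using hx) (by simpa using h)
  obtain ⟨x, q, hx, hq, hφ⟩ := this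
  obtain ⟨f, hf, hd⟩ := main_step φ x hx q hq (ε/8) (ε/8) hφ (by positivity) (by positivity)
  exact ⟨f, hf, by linarith⟩
end

section
/- Let X be a real Banach space which is an ℓ₁-predual, i.e. there is an isometric linear isomorphism φ from ℓ₁ (the space of absolutely summable real sequences) onto the dual X*. Write uₖ* = φ(eₖ*), where eₖ* is the k-th standard unit vector of ℓ₁. If x* ∈ X* is nonzero and of the form x* = Σ_{k=1}^{n} aₖ uₖ* for some n ∈ ℕ and real scalars aₖ, then x* has the adjusted Bhatia-Šemrl property. -/
open scoped BigOperators

open scoped ENNReal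


namespace L1Predual

variable {X : Type*} [NormedAddCommGroup X] [NormedSpace ℝ X]

lemma decomp (φ : lp (fun _ : ℕ => ℝ) 1 ≃ₗᵢ[ℝ] (X →L[ℝ] ℝ)) (h : X →L[ℝ] ℝ) (F : Finset ℕ) :
    ∃ r : X →L[ℝ] ℝ,
      h = ∑ k ∈ F, (φ.symm h) k • φ (lp.single 1 k (1 : ℝ)) + r ∧
      ‖r‖ = ‖h‖ - ∑ k ∈ F, |(φ.symm h) k| := by
  set β := φ.symm h with hβ
  have hh : h = φ β := by simp [hβ]
  refine ⟨φ (β - ∑ i ∈ F, lp.single 1 i (β i)), ?_, ?_⟩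
  · have : ∀ k ∈ F, lp.single (E := fun _ : ℕ => ℝ) 1 k (β k) = β k • lp.single (E := fun _ : ℕ => ℝ) 1 k (1 : ℝ) := by
      intro k _
      rw [← lp.single_smul]; simp
    rw [Finset.sum_congr rfl this, hh]
    simp [map_sub, map_sum]
  · rw [hh, φ.norm_map, φ.norm_map]
    have := lp.norm_compl_sum_single (p := 1) (by simp) β F
    simpa using this

lemma norm_le_of_ball (L : X →L[ℝ] ℝ) (C : ℝ) (h : ∀ p : X, ‖p‖ ≤ 1 → L p ≤ C) : ‖L‖ ≤ C := by
  have h0 : 0 ≤ C := by simpa using h 0 (by simp)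
  refine ContinuousLinearMap.opNorm_le_of_unit_norm h0 fun x hx => ?_
  rw [Real.norm_eq_abs, abs_le]
  have h1 := h x hx.le
  have h2 := h (-x) (by simp [hx])
  rw [map_neg] at h2
  constructor <;> linarith

lemma step (φ : lp (fun _ : ℕ => ℝ) 1 ≃ₗᵢ[ℝ] (X →L[ℝ] ℝ)) (F : Finset ℕ) (s : ℕ → ℝ)
    (hs : ∀ k ∈ F, |s k| ≤ 1) (y : X) (hy : ‖y‖ ≤ 1) (ε δ : ℝ) (hε : 0 ≤ ε) (hδ : 0 < δ)
    (hys : ∀ k ∈ F, |s k - φ (lp.single 1 k (1 : ℝ)) y| ≤ ε) :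
    ∃ p : X, ‖p‖ ≤ 1 ∧ ‖p - y‖ ≤ ε + δ ∧
      ∀ k ∈ F, |s k - φ (lp.single 1 k (1 : ℝ)) p| ≤ δ := by
  set u : ℕ → (X →L[ℝ] ℝ) := fun k => φ (lp.single 1 k (1 : ℝ)) with hu
  let K : Set (X × (F → ℝ)) := {z | ∃ p q : X, ‖p‖ ≤ 1 ∧ ‖q - y‖ ≤ ε ∧
    z = (p - q, fun k : F => u k p - s k)}
  have hKc : Convex ℝ K := by
    rintro _ ⟨p, q, hp, hq, rfl⟩ _ ⟨p', q', hp', hq', rfl⟩ a b ha hb hab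
    refine ⟨a • p + b • p', a • q + b • q', ?_, ?_, ?_⟩
    · calc _ ≤ ‖a • p‖ + ‖b • p'‖ := norm_add_le _ _
        _ = a * ‖p‖ + b * ‖p'‖ := by simp [norm_smul, abs_of_nonneg ha, abs_of_nonneg hb]
        _ ≤ 1 := by nlinarith
    · have : a • q + b • q' - y = a • (q - y) + b • (q' - y) := by
        have : y = (a + b) • y := by rw [hab, one_smul]
        nth_rw 1 [this]
        module
      rw [this]
      calc _ ≤ ‖a • (q - y)‖ + ‖b • (q' - y)‖ := norm_add_le _ _
        _ = a * ‖q - y‖ + b * ‖q' - y‖ := by simp [norm_smul, abs_of_nonneg ha, abs_of_nonneg hb]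
        _ ≤ a * ε + b * ε := by gcongr
        _ = ε := by rw [← add_mul, hab, one_mul]
    · refine Prod.ext ?_ ?_
      · simp only [Prod.fst_add, Prod.smul_fst]
        module
      · funext k
        simp only [Prod.snd_add, Prod.smul_snd, Pi.add_apply, Pi.smul_apply, smul_eq_mul, map_add,
          map_smul]
        linear_combination (- s k) * hab
  have key : (0 : X × (F → ℝ)) ∈ closure K := by
    by_contra hcon
    obtain ⟨f, a, hfa, hfK⟩ := geometric_hahn_banach_point_closed hKc.closure isClosed_closure hcon
    rw [map_zero] at hfa
    let M : X →L[ℝ] ℝ := f.comp (ContinuousLinearMap.inl ℝ X (F → ℝ))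
    let γ : F → ℝ := fun k => f (0, Pi.single k 1)
    have hγ : ∀ w : F → ℝ, f (0, w) = ∑ k, γ k * w k := by
      intro w
      have h1 : ((0 : X), w) = ∑ k, w k • ((0 : X), (Pi.single k 1 : F → ℝ)) := by
        refine Prod.ext ?_ ?_
        · simp [Prod.fst_sum]
        · funext j
          simp [Prod.snd_sum, Finset.sum_apply, Pi.single_apply]
      rw [h1, map_sum]
      refine Finset.sum_congr rfl fun k _ => ?_
      rw [map_smul, smul_eq_mul, mul_comm]
    let L : X →L[ℝ] ℝ := M + ∑ k : F, γ k • u k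
    have hK' : ∀ p q : X, ‖p‖ ≤ 1 → ‖q - y‖ ≤ ε → a < L p - M q - ∑ k : F, γ k * s k := by
      intro p q hp hq
      have := hfK _ (subset_closure ⟨p, q, hp, hq, rfl⟩)
      have e : ((p - q, fun k : F => u k p - s k) : X × (F → ℝ)) =
          (p - q, 0) + (0, fun k : F => u k p - s k) := by simp
      rw [e, map_add, hγ] at this
      have e2 : f (p - q, 0) = M p - M q := by
        rw [← map_sub]; rfl
      rw [e2] at this
      simp only [L, ContinuousLinearMap.add_apply, ContinuousLinearMap.sum_apply,
        smul_apply, smul_eq_mul]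
      simp only [mul_sub, Finset.sum_sub_distrib] at this
      linarith
    let Z : (X →L[ℝ] ℝ) →ₗ[ℝ] ℝ :=
      { toFun := fun h => h y + ∑ k ∈ F, (φ.symm h) k * (s k - u k y)
        map_add' := by
          intro g h
          simp [add_mul, Finset.sum_add_distrib]
          ring
        map_smul' := by
          intro c h
          simp [mul_add, Finset.mul_sum, mul_assoc] }
    have hZ : ∀ h, Z h = h y + ∑ k ∈ F, (φ.symm h) k * (s k - u k y) := fun h => rfl
    have hZ1 : ∀ h, |Z h| ≤ ‖h‖ := by
      intro h
      obtain ⟨r, h1, h2⟩ := decomp φ h F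
      have h3 : Z h = ∑ k ∈ F, (φ.symm h) k * s k + r y := by
        rw [hZ]
        nth_rw 1 [h1]
        simp [mul_sub, Finset.sum_sub_distrib, hu]
        ring
      rw [h3]
      have h4 : |r y| ≤ ‖r‖ := by
        simpa using r.le_of_opNorm_le_of_le le_rfl hy
      have h5 : |∑ k ∈ F, (φ.symm h) k * s k| ≤ ∑ k ∈ F, |(φ.symm h) k| := by
        refine (Finset.abs_sum_le_sum_abs _ _).trans (Finset.sum_le_sum fun k hk => ?_)
        rw [abs_mul]
        exact mul_le_of_le_one_right (abs_nonneg _) (hs k hk)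
      calc _ ≤ _ := abs_add_le _ _
        _ ≤ ‖h‖ := by linarith
    have hZ2 : ∀ h, |Z h - h y| ≤ ε * ‖h‖ := by
      intro h
      obtain ⟨r, h1, h2⟩ := decomp φ h F
      rw [hZ, add_sub_cancel_left]
      have h5 : |∑ k ∈ F, (φ.symm h) k * (s k - u k y)| ≤ ∑ k ∈ F, ε * |(φ.symm h) k| := by
        refine (Finset.abs_sum_le_sum_abs _ _).trans (Finset.sum_le_sum fun k hk => ?_)
        rw [abs_mul, mul_comm]
        exact mul_le_mul_of_nonneg_right (hys k hk) (abs_nonneg _)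
      rw [← Finset.mul_sum] at h5
      refine h5.trans (mul_le_mul_of_nonneg_left ?_ hε)
      have := norm_nonneg r
      linarith
    have hZu : ∀ k ∈ F, Z (u k) = s k := by
      intro k hk
      rw [hZ]
      have : ∀ j, (φ.symm (u k)) j = if j = k then 1 else 0 := by
        intro j
        simp [hu, Pi.single_apply]
      simp [this, hk]
    have hZL : Z L = Z M + ∑ k : F, γ k * s k := by
      simp only [L, map_add, map_sum, map_smul, smul_eq_mul]
      congr 1
      exact Finset.sum_congr rfl fun k _ => by rw [hZu k k.2]
    have hA : ∀ q, ‖q - y‖ ≤ ε → ‖L‖ ≤ - a - M q - ∑ k : F, γ k * s k := by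
      intro q hq
      refine norm_le_of_ball L _ fun p hp => ?_
      have := hK' (-p) q (by simpa using hp) hq
      rw [map_neg] at this
      linarith
    have hB : ‖ε • M‖ ≤ - a - M y - ∑ k : F, γ k * s k - ‖L‖ := by
      refine norm_le_of_ball _ _ fun p hp => ?_
      have := hA (y + ε • p) (by
        rw [add_sub_cancel_left, norm_smul, Real.norm_eq_abs, abs_of_nonneg hε]
        exact mul_le_of_le_one_right hε hp)
      simp only [map_add, map_smul, smul_eq_mul] at this
      simp only [smul_apply, smul_eq_mul]
      linarith
    rw [norm_smul, Real.norm_eq_abs, abs_of_nonneg hε] at hB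
    have h1 := abs_le.1 (hZ1 L)
    have h2 := abs_le.1 (hZ2 M)
    linarith [h1.1, h1.2, h2.1, h2.2]
  rw [Metric.mem_closure_iff] at key
  obtain ⟨_, ⟨p, q, hp, hq, rfl⟩, hd⟩ := key δ hδ
  rw [dist_zero_left, Prod.norm_def, max_lt_iff] at hd
  refine ⟨p, hp, ?_, fun k hk => ?_⟩
  · have : p - y = (q - y) + (p - q) := by abel
    rw [this]
    exact (norm_add_le _ _).trans (add_le_add hq hd.1.le)
  · have := (norm_le_pi_norm (fun k : F => u k p - s k) ⟨k, hk⟩).trans hd.2.le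
    rw [Real.norm_eq_abs, abs_sub_comm] at this
    exact this

lemma interp [CompleteSpace X] (φ : lp (fun _ : ℕ => ℝ) 1 ≃ₗᵢ[ℝ] (X →L[ℝ] ℝ)) (F : Finset ℕ)
    (s : ℕ → ℝ) (hs : ∀ k ∈ F, |s k| ≤ 1) :
    ∃ p : X, ‖p‖ ≤ 1 ∧ ∀ k ∈ F, φ (lp.single 1 k (1 : ℝ)) p = s k := by
  let P : ℕ → Type _ := fun m => {y : X // ‖y‖ ≤ 1 ∧
    ∀ k ∈ F, |s k - φ (lp.single 1 k (1 : ℝ)) y| ≤ (1 / 2 : ℝ) ^ m}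
  have hst : ∀ m (y : P m), ∃ z : P (m + 1), ‖z.1 - y.1‖ ≤ (1 / 2 : ℝ) ^ m + (1 / 2 : ℝ) ^ (m + 1) := by
    intro m y
    obtain ⟨p, h1, h2, h3⟩ := step φ F s hs y.1 y.2.1 ((1 / 2 : ℝ) ^ m) ((1 / 2 : ℝ) ^ (m + 1))
      (by positivity) (by positivity) y.2.2
    exact ⟨⟨p, h1, h3⟩, h2⟩
  choose nx hnx using hst
  let Y : ∀ m, P m := fun m => Nat.rec (motive := P) ⟨0, by simp, by simpa using hs⟩ nx m
  have hY : ∀ m, ‖(Y (m + 1)).1 - (Y m).1‖ ≤ (1 / 2 : ℝ) ^ m + (1 / 2 : ℝ) ^ (m + 1) :=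
    fun m => hnx m (Y m)
  have hc : CauchySeq fun m => (Y m).1 := by
    refine cauchySeq_of_le_geometric (1 / 2) (3 / 2) (by norm_num) fun m => ?_
    rw [dist_comm, dist_eq_norm]
    refine (hY m).trans (le_of_eq ?_)
    ring
  obtain ⟨p, hp⟩ := cauchySeq_tendsto_of_complete hc
  refine ⟨p, le_of_tendsto' hp.norm fun m => (Y m).2.1, fun k hk => ?_⟩
  have h1 : Filter.Tendsto (fun m => |s k - φ (lp.single 1 k (1 : ℝ)) (Y m).1|) Filter.atTop
      (nhds |s k - φ (lp.single 1 k (1 : ℝ)) p|) :=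
    ((((φ (lp.single 1 k (1 : ℝ))).continuous.tendsto p).comp hp).const_sub (s k)).abs
  have h2 : Filter.Tendsto (fun m : ℕ => (1 / 2 : ℝ) ^ m) Filter.atTop (nhds 0) :=
    tendsto_pow_atTop_nhds_zero_of_lt_one (by norm_num) (by norm_num)
  have h3 := le_of_tendsto_of_tendsto' h1 h2 fun m => (Y m).2.2 k hk
  have h4 := abs_nonpos_iff.1 h3
  linarith

end L1Predual

open L1Predual in
/-- In an `ℓ₁`-predual `X`, every nonzero functional that is a finite linear combination of the
canonical basis vectors `uₖ* = φ(eₖ*)` has the adjusted Bhatia-Semrl property. -/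
theorem hasBSa_of_finite_combination_l1_predual (X : Type*) [NormedAddCommGroup X]
    [NormedSpace ℝ X] [CompleteSpace X]
    (φ : lp (fun _ : ℕ => ℝ) 1 ≃ₗᵢ[ℝ] (X →L[ℝ] ℝ))
    (n : ℕ) (a : Fin n → ℝ) (x : X →L[ℝ] ℝ)
    (hx : x = ∑ k : Fin n, a k • φ (lp.single 1 (k : ℕ) (1 : ℝ)))
    (hx0 : x ≠ 0) :
    HasBSa x := by
  set u : ℕ → (X →L[ℝ] ℝ) := fun k => φ (lp.single 1 k (1 : ℝ)) with hu
  set A := φ.symm x with hA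
  have hAn : ∀ j, n ≤ j → A j = 0 := by
    intro j hj
    have : A = ∑ k : Fin n, a k • lp.single (E := fun _ : ℕ => ℝ) 1 (k : ℕ) (1 : ℝ) := by
      rw [hA, hx]; simp [map_sum]
    rw [this]
    simp only [lp.coeFn_sum, Finset.sum_apply, lp.coeFn_smul, Pi.smul_apply, lp.coeFn_single,
      smul_eq_mul]
    refine Finset.sum_eq_zero fun k _ => ?_
    rw [Pi.single_eq_of_ne (by have := k.2; omega), mul_zero]
  let F : Finset ℕ := (Finset.range n).filter fun k => A k ≠ 0
  have hF : ∀ j, j ∉ F → A j = 0 := by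
    intro j hj
    by_contra h
    refine hj (Finset.mem_filter.2 ⟨Finset.mem_range.2 ?_, h⟩)
    by_contra h'
    exact h (hAn j (not_lt.1 h'))
  have hF' : ∀ j ∈ F, A j ≠ 0 := fun j hj => (Finset.mem_filter.1 hj).2
  have hAF : A = ∑ k ∈ F, lp.single (E := fun _ : ℕ => ℝ) 1 k (A k) := by
    ext j
    simp only [lp.coeFn_sum, Finset.sum_apply, lp.coeFn_single, Finset.sum_pi_single]
    split_ifs with h
    · rfl
    · exact hF j h
  have hnx : ‖x‖ = ∑ k ∈ F, |A k| := by
    have h1 := lp.norm_compl_sum_single (p := 1) (by simp) A F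
    rw [← hAF] at h1
    have h2 : ‖A‖ = ‖x‖ := by rw [hA, φ.symm.norm_map]
    simp at h1
    linarith
  have hxF : x = ∑ k ∈ F, A k • u k := by
    obtain ⟨r, h1, h2⟩ := decomp φ x F
    have : r = 0 := by
      rw [← norm_eq_zero, h2, hnx, sub_self]
    rw [this, add_zero] at h1
    exact h1
  have hatt : ∀ y : X, ‖y‖ ≤ 1 → (∀ k ∈ F, u k y = SignType.sign (A k)) →
      ‖y‖ = 1 ∧ ‖x y‖ = ‖x‖ := by
    intro y hy h
    have h1 : x y = ‖x‖ := by
      rw [hnx]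
      nth_rw 1 [hxF]
      simp only [ContinuousLinearMap.sum_apply, smul_apply, smul_eq_mul]
      refine Finset.sum_congr rfl fun k hk => ?_
      rw [h k hk, self_mul_sign]
    have hpos : 0 < ‖x‖ := norm_pos_iff.2 hx0
    refine ⟨le_antisymm hy ?_, by rw [h1, norm_norm]⟩
    have h2 := x.le_opNorm y
    rw [h1, norm_norm] at h2
    nlinarith
  have hsg : ∀ r : ℝ, |((SignType.sign r : SignType) : ℝ)| ≤ 1 := by
    intro r
    rcases lt_trichotomy r 0 with h | h | h <;> simp [h]
  refine ⟨?_, ?_⟩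
  · obtain ⟨y, h1, h2⟩ := interp φ F (fun k => SignType.sign (A k)) fun k _ => hsg _
    obtain ⟨h3, h4⟩ := hatt y h1 h2
    exact ⟨y, h3, h4⟩
  intro g hg
  set b := φ.symm g with hb
  set S : ℝ := ∑ k ∈ F, (SignType.sign (A k) : ℝ) * b k with hS
  set R : ℝ := ‖g‖ - ∑ k ∈ F, |b k| with hR
  -- small t
  obtain ⟨τ, hτ, hτF⟩ : ∃ τ : ℝ, 0 < τ ∧ ∀ k ∈ F, τ * |b k| ≤ |A k| := by
    have : ∀ G : Finset ℕ, (∀ k ∈ G, A k ≠ 0) →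
        ∃ τ : ℝ, 0 < τ ∧ ∀ k ∈ G, τ * |b k| ≤ |A k| := by
      intro G
      induction G using Finset.induction_on with
      | empty => intro _; exact ⟨1, one_pos, by simp⟩
      | insert j G hj ih =>
        intro h
        obtain ⟨τ, h1, h2⟩ := ih fun k hk => h k (Finset.mem_insert_of_mem hk)
        have hj0 : 0 < |A j| := abs_pos.2 (h j (Finset.mem_insert_self _ _))
        refine ⟨min τ (|A j| / (|b j| + 1)), by positivity, fun k hk => ?_⟩
        rcases Finset.mem_insert.1 hk with rfl | hk
        · calc _ ≤ |A k| / (|b k| + 1) * |b k| := by gcongr; exact min_le_right _ _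
            _ ≤ |A k| := by
              rw [div_mul_eq_mul_div, div_le_iff₀ (by positivity)]
              nlinarith
        · exact le_trans (by gcongr; exact min_le_left _ _) (h2 k hk)
    exact this F hF'
  have habs : ∀ t : ℝ, |t| = τ → ∀ k ∈ F, |A k + t * b k| =
      |A k| + t * ((SignType.sign (A k) : ℝ) * b k) := by
    intro t ht k hk
    have h1 : |t * b k| ≤ |A k| := by rw [abs_mul, ht]; exact hτF k hk
    have h2 := abs_le.1 h1
    rcases lt_or_gt_of_ne (hF' k hk) with h | h
    · rw [abs_of_neg h] at h2 ⊢
      rw [abs_of_nonpos (by linarith), sign_neg h]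
      simp; ring
    · rw [abs_of_pos h] at h2 ⊢
      rw [abs_of_nonneg (by linarith), sign_pos h]
      simp
  have hSR : ∀ t : ℝ, |t| = τ → 0 < t * S + τ * R := by
    intro t ht
    have ht0 : t ≠ 0 := by
      rintro rfl
      simp at ht
      linarith
    have h1 := hg t ht0
    obtain ⟨r, h2, h3⟩ := decomp φ g F
    have h4 : x + t • g = ∑ k ∈ F, (A k + t * b k) • u k + t • r := by
      nth_rw 1 [hxF, h2]
      simp only [add_smul, Finset.sum_add_distrib, smul_add, Finset.smul_sum, mul_smul, hu, hb]
      abel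
    have h5 : ‖x + t • g‖ ≤ ∑ k ∈ F, |A k + t * b k| + τ * R := by
      rw [h4]
      refine (norm_add_le _ _).trans (add_le_add ?_ ?_)
      · refine (norm_sum_le _ _).trans (Finset.sum_le_sum fun k _ => ?_)
        rw [norm_smul, hu, φ.norm_map, lp.norm_single (by simp)]
        simp
      · rw [norm_smul, Real.norm_eq_abs, ht, h3]
    rw [Finset.sum_congr rfl (habs t ht), Finset.sum_add_distrib, ← Finset.mul_sum, ← hS,
      ← hnx] at h5
    linarith
  have hSR1 : 0 < S + R := by
    have := hSR τ (abs_of_pos hτ)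
    rw [← mul_add] at this
    exact pos_of_mul_pos_right this hτ.le
  have hSR2 : 0 < -S + R := by
    have := hSR (-τ) (by rw [abs_neg, abs_of_pos hτ])
    rw [neg_mul, ← mul_neg, ← mul_add] at this
    exact pos_of_mul_pos_right this hτ.le
  obtain ⟨G, hFG, hG⟩ : ∃ G : Finset ℕ, F ⊆ G ∧
      ‖g‖ - ∑ k ∈ G, |b k| < min (S + R) (-S + R) / 2 := by
    have h1 : HasSum (fun k => |b k|) ‖g‖ := by
      have := lp.hasSum_norm (p := 1) (by simp) b
      have h2 : ‖b‖ = ‖g‖ := by rw [hb, φ.symm.norm_map]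
      rw [h2] at this
      simpa using this
    have h2 : 0 < min (S + R) (-S + R) / 2 := by
      have := lt_min hSR1 hSR2
      linarith
    have h3 := h1.eventually (lt_mem_nhds (sub_lt_self ‖g‖ h2))
    obtain ⟨G, h4, h5⟩ := (h3.and (Filter.eventually_ge_atTop F)).exists
    exact ⟨G, h5, by linarith⟩
  have hmin1 := min_le_left (S + R) (-S + R)
  have hmin2 := min_le_right (S + R) (-S + R)
  have hex : ∀ σ : ℝ, |σ| ≤ 1 → ∃ y : X, ‖y‖ ≤ 1 ∧ (∀ k ∈ F, u k y = SignType.sign (A k)) ∧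
      |g y - (S + σ * (∑ k ∈ G, |b k| - ∑ k ∈ F, |b k|))| ≤ ‖g‖ - ∑ k ∈ G, |b k| := by
    intro σ hσ
    obtain ⟨y, h1, h2⟩ := interp φ G
      (fun k => if k ∈ F then (SignType.sign (A k) : ℝ) else σ * SignType.sign (b k)) (by
        intro k _
        dsimp only
        split_ifs
        · exact hsg _
        · rw [abs_mul]
          exact mul_le_one₀ hσ (abs_nonneg _) (hsg _))
    refine ⟨y, h1, fun k hk => by simpa [hk] using h2 k (hFG hk), ?_⟩
    obtain ⟨r, h3, h4⟩ := decomp φ g G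
    have h5 : |r y| ≤ ‖r‖ := by
      simpa using r.le_of_opNorm_le_of_le le_rfl h1
    have h6 : g y = ∑ k ∈ G, b k * u k y + r y := by
      nth_rw 1 [h3]
      simp [hu, hb]
    have h7 : ∑ k ∈ G, b k * u k y = S + σ * (∑ k ∈ G, |b k| - ∑ k ∈ F, |b k|) := by
      rw [← Finset.sum_sdiff hFG, ← Finset.sum_sdiff (f := fun k => |b k|) hFG, add_sub_cancel_right,
        add_comm, Finset.mul_sum, hS]
      congr 1
      · refine Finset.sum_congr rfl fun k hk => ?_
        have := h2 k (hFG hk)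
        rw [if_pos hk] at this
        rw [show u k y = _ from this, mul_comm]
      · refine Finset.sum_congr rfl fun k hk => ?_
        have hk' := Finset.mem_sdiff.1 hk
        have := h2 k hk'.1
        rw [if_neg hk'.2] at this
        rw [show u k y = _ from this, ← self_mul_sign (b k)]
        ring
    rw [h6, h7, add_sub_cancel_left, ← h4]
    exact h5
  obtain ⟨y1, p1, p2, p3⟩ := hex 1 (by simp)
  obtain ⟨y2, q1, q2, q3⟩ := hex (-1) (by simp)
  have p4 : 0 < g y1 := by
    have := (abs_le.1 p3).1
    linarith
  have q4 : g y2 < 0 := by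
    have := (abs_le.1 q3).2
    linarith
  set D := g y1 - g y2 with hD
  have hD0 : 0 < D := by linarith
  set α := -g y2 / D with hα
  set β := g y1 / D with hβ
  have hα0 : 0 ≤ α := div_nonneg (by linarith) hD0.le
  have hβ0 : 0 ≤ β := div_nonneg (by linarith) hD0.le
  have hαβ : α + β = 1 := by
    rw [hα, hβ, ← add_div, div_eq_one_iff_eq hD0.ne']
    linarith
  obtain ⟨h3, h4⟩ := hatt (α • y1 + β • y2) (by
    calc _ ≤ ‖α • y1‖ + ‖β • y2‖ := norm_add_le _ _
      _ = α * ‖y1‖ + β * ‖y2‖ := by simp [norm_smul, abs_of_nonneg hα0, abs_of_nonneg hβ0]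
      _ ≤ 1 := by nlinarith) (by
    intro k hk
    rw [map_add, map_smul, map_smul, p2 k hk, q2 k hk, smul_eq_mul, smul_eq_mul, ← add_mul, hαβ,
      one_mul])
  refine ⟨α • y1 + β • y2, h3, h4, ?_⟩
  have h5 : g (α • y1 + β • y2) = 0 := by
    rw [map_add, map_smul, map_smul, smul_eq_mul, smul_eq_mul, hα, hβ]
    field_simp
    ring
  intro t
  rw [h5, smul_zero, add_zero]
end

section
/- Let c₀ be the Banach space of real sequences converging to 0 with the supremum norm. Then BSa(c₀,ℝ) = NA(c₀,ℝ): a bounded linear functional on c₀ has the adjusted Bhatia-Šemrl property if and only if it attains its norm. -/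
open scoped BigOperators

open ZeroAtInfty

lemma c0_norm_le (x : C₀(ℕ, ℝ)) {r : ℝ} (hr : 0 ≤ r) : ‖x‖ ≤ r ↔ ∀ i, |x i| ≤ r := by
  rw [← ZeroAtInftyContinuousMap.norm_toBCF_eq_norm, BoundedContinuousFunction.norm_le hr]
  rfl

lemma c0_tendsto (x : C₀(ℕ, ℝ)) : Filter.Tendsto x Filter.atTop (nhds 0) := by
  have := x.zero_at_infty'
  rw [Filter.cocompact_eq_cofinite, Nat.cofinite_eq_atTop] at this
  exact this

lemma c0_exists_head (N : ℕ) (c : ℕ → ℝ) :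
    ∃ h : C₀(ℕ, ℝ), ∀ i, h i = if i < N then c i else 0 := by
  refine ⟨⟨⟨fun i => if i < N then c i else 0, continuous_of_discreteTopology⟩, ?_⟩, fun i => rfl⟩
  rw [Filter.cocompact_eq_cofinite, Nat.cofinite_eq_atTop]
  refine tendsto_const_nhds.congr' ?_
  filter_upwards [Filter.eventually_ge_atTop N] with i hi
  simp [not_lt.mpr hi]

lemma c0_coe_sum (N : ℕ) (c : ℕ → ℝ) (e : ℕ → C₀(ℕ, ℝ)) (j : ℕ) :
    (∑ i ∈ Finset.range N, c i • e i) j = ∑ i ∈ Finset.range N, c i * e i j := by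
  induction N with
  | zero => simp
  | succ n ih => simp [Finset.sum_range_succ, ih]

lemma c0_tail (f : C₀(ℕ, ℝ) →L[ℝ] ℝ) (x₀ : C₀(ℕ, ℝ)) (h1 : ‖x₀‖ = 1) (hf : f x₀ = ‖f‖) :
    ∃ N : ℕ, ∃ a : ℕ → ℝ, ∀ x : C₀(ℕ, ℝ), f x = ∑ i ∈ Finset.range N, a i * x i := by
  have hev : ∀ᶠ i in Filter.atTop, |x₀ i| < 1/2 := by
    have := (c0_tendsto x₀).abs
    rw [abs_zero] at this
    exact this.eventually_lt_const (by norm_num)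
  obtain ⟨N, hN⟩ := Filter.eventually_atTop.1 hev
  have hx₀ := (c0_norm_le x₀ zero_le_one).1 h1.le
  have hball : ∀ z : C₀(ℕ, ℝ), ‖z‖ ≤ 1 → f z ≤ ‖f‖ := fun z hz =>
    (le_abs_self _).trans ((f.le_opNorm z).trans (mul_le_of_le_one_right (norm_nonneg _) hz))
  have hsmall : ∀ y : C₀(ℕ, ℝ), (∀ i < N, y i = 0) → ‖y‖ ≤ 1/2 → f y ≤ 0 := by
    intro y hy hy2
    have hy2 := (c0_norm_le y (by norm_num)).1 hy2
    have := hball (x₀ + y) ((c0_norm_le _ zero_le_one).2 fun i => by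
      rcases lt_or_ge i N with h | h
      · simpa [hy i h] using hx₀ i
      · have := hN i h
        have := hy2 i
        have := abs_add_le (x₀ i) (y i)
        simp only [ZeroAtInftyContinuousMap.add_apply]
        linarith)
    rw [map_add, hf] at this
    linarith
  have hle : ∀ y : C₀(ℕ, ℝ), (∀ i < N, y i = 0) → f y ≤ 0 := by
    intro y hy
    have hpos : 0 < 2 * (‖y‖ + 1) := by positivity
    have := hsmall ((2 * (‖y‖ + 1))⁻¹ • y) (fun i hi => by simp [hy i hi]) (by
      rw [norm_smul, Real.norm_eq_abs, abs_of_pos (inv_pos.2 hpos), inv_mul_le_iff₀ hpos]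
      linarith [norm_nonneg y])
    rw [map_smul, smul_eq_mul] at this
    by_contra hc
    push Not at hc
    have := mul_pos (inv_pos.2 hpos) hc
    linarith
  have hz : ∀ y : C₀(ℕ, ℝ), (∀ i < N, y i = 0) → f y = 0 := by
    intro y hy
    have h2 := hle (-y) (fun i hi => by simp [hy i hi])
    rw [map_neg] at h2
    linarith [hle y hy]
  have he : ∀ k : ℕ, ∃ h : C₀(ℕ, ℝ), ∀ i, h i = if i = k then 1 else 0 := by
    intro k
    obtain ⟨h, hh⟩ := c0_exists_head (k+1) (fun i => if i = k then 1 else 0)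
    refine ⟨h, fun i => ?_⟩
    rw [hh]
    split_ifs <;> first | rfl | omega
  choose e he using he
  refine ⟨N, fun i => f (e i), fun x => ?_⟩
  have := hz (x - ∑ i ∈ Finset.range N, x i • e i) (fun i hi => by
    rw [ZeroAtInftyContinuousMap.sub_apply, c0_coe_sum]
    simp [he, hi])
  rw [map_sub, map_sum, sub_eq_zero] at this
  rw [this]
  exact Finset.sum_congr rfl fun i _ => by rw [map_smul, smul_eq_mul, mul_comm]

lemma c0_key (f : C₀(ℕ, ℝ) →L[ℝ] ℝ) (x₀ : C₀(ℕ, ℝ)) (h1 : ‖x₀‖ = 1) (hf : f x₀ = ‖f‖) :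
    ∃ C : ℝ, 0 ≤ C ∧ ∀ x : C₀(ℕ, ℝ), ‖x‖ ≤ 1 →
      ∃ x' : C₀(ℕ, ℝ), ‖x'‖ ≤ 1 ∧ f x' = ‖f‖ ∧ ‖x' - x‖ ≤ C * (‖f‖ - f x) := by
  obtain ⟨N, a, ha⟩ := c0_tail f x₀ h1 hf
  have hC : 0 ≤ ∑ i ∈ Finset.range N, |a i|⁻¹ := Finset.sum_nonneg fun i _ => by positivity
  refine ⟨∑ i ∈ Finset.range N, |a i|⁻¹, hC, fun x hx => ?_⟩
  have hball : ∀ z : C₀(ℕ, ℝ), ‖z‖ ≤ 1 → f z ≤ ‖f‖ := fun z hz =>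
    (le_abs_self _).trans ((f.le_opNorm z).trans (mul_le_of_le_one_right (norm_nonneg _) hz))
  have hx1 := (c0_norm_le x zero_le_one).1 hx
  have hterm : ∀ z : C₀(ℕ, ℝ), ‖z‖ ≤ 1 → ∀ i, a i * z i ≤ |a i| := fun z hz i => by
    refine (le_abs_self _).trans ?_
    rw [abs_mul]
    exact mul_le_of_le_one_right (abs_nonneg _) ((c0_norm_le z zero_le_one).1 hz i)
  obtain ⟨h, hh⟩ := c0_exists_head N (fun i => if a i = 0 then 0 else a i / |a i| - x i)
  have hx' : ∀ i, (x + h) i = if i < N ∧ a i ≠ 0 then a i / |a i| else x i := by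
    intro i
    rw [ZeroAtInftyContinuousMap.add_apply, hh]
    by_cases h1 : i < N <;> by_cases h2 : a i = 0 <;> simp [h1, h2]
  have hn : ‖x + h‖ ≤ 1 := (c0_norm_le _ zero_le_one).2 fun i => by
    rw [hx']
    split_ifs with hi
    · rw [abs_div, abs_abs, div_self (abs_ne_zero.2 hi.2)]
    · exact hx1 i
  have hfx' : f (x + h) = ∑ i ∈ Finset.range N, |a i| := by
    rw [ha]
    refine Finset.sum_congr rfl fun i hi => ?_
    rw [hx']
    by_cases h2 : a i = 0
    · simp [h2]
    · rw [if_pos ⟨Finset.mem_range.1 hi, h2⟩]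
      have := abs_ne_zero.2 h2
      field_simp
      rw [sq_abs]
  have hfeq : f (x + h) = ‖f‖ := by
    refine le_antisymm (hball _ hn) ?_
    rw [hfx', ← hf, ha]
    exact Finset.sum_le_sum fun i _ => hterm x₀ h1.le i
  have hd : 0 ≤ ‖f‖ - f x := sub_nonneg.2 (hball x hx)
  refine ⟨x + h, hn, hfeq, ?_⟩
  rw [add_sub_cancel_left, c0_norm_le _ (mul_nonneg hC hd)]
  intro i
  rw [hh]
  by_cases hi : i < N
  · by_cases h2 : a i = 0
    · simpa [h2] using mul_nonneg hC hd
    · rw [if_pos hi, if_neg h2]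
      have h3 := abs_pos.2 h2
      have e1 : |a i / |a i| - x i| = |a i|⁻¹ * (|a i| - a i * x i) := by
        have : a i / |a i| - x i = (a i / |a i|) * (|a i|⁻¹ * (|a i| - a i * x i)) := by
          have h4 := sq_abs (a i)
          field_simp
          linear_combination (-x i) * h4
        rw [this, abs_mul, abs_div, abs_abs, div_self h3.ne', one_mul, abs_of_nonneg]
        exact mul_nonneg (by positivity) (sub_nonneg.2 (hterm x hx i))
      rw [e1]
      refine mul_le_mul ?_ ?_ (sub_nonneg.2 (hterm x hx i)) hC
      · exact Finset.single_le_sum (f := fun i => |a i|⁻¹) (fun i _ => by positivity)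
          (Finset.mem_range.2 hi)
      · rw [← hfeq, hfx', ha x, ← Finset.sum_sub_distrib]
        exact Finset.single_le_sum (f := fun i => |a i| - a i * x i)
          (fun i _ => sub_nonneg.2 (hterm x hx i)) (Finset.mem_range.2 hi)
  · simpa [hi] using mul_nonneg hC hd

lemma c0_sign (f g : C₀(ℕ, ℝ) →L[ℝ] ℝ) (x₀ : C₀(ℕ, ℝ)) (h1 : ‖x₀‖ = 1) (hf : f x₀ = ‖f‖)
    (hg : SBJOrth f g) : ∃ x : C₀(ℕ, ℝ), ‖x‖ ≤ 1 ∧ f x = ‖f‖ ∧ g x ≤ 0 := by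
  by_contra hc
  push Not at hc
  obtain ⟨C, hC, hK⟩ := c0_key f x₀ h1 hf
  have hball : ∀ z : C₀(ℕ, ℝ), ‖z‖ ≤ 1 → f z ≤ ‖f‖ := fun z hz =>
    (le_abs_self _).trans ((f.le_opNorm z).trans (mul_le_of_le_one_right (norm_nonneg _) hz))
  have hD : 0 < ‖g‖ * C + 1 := by positivity
  set s := (‖g‖ * C + 1)⁻¹ with hs
  have hspos : 0 < s := inv_pos.2 hD
  have hs1 : s * (‖g‖ * C) ≤ 1 := by
    have : s * (‖g‖ * C + 1) = 1 := inv_mul_cancel₀ hD.ne'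
    linarith
  have hup : ∀ x : C₀(ℕ, ℝ), ‖x‖ ≤ 1 → (f + (-s) • g) x ≤ ‖f‖ := by
    intro x hx
    obtain ⟨x', hx', hfx', hd⟩ := hK x hx
    have h0 := hc x' hx' hfx'
    have h2 : g x' - g x ≤ ‖g‖ * (C * (‖f‖ - f x)) := by
      rw [← map_sub]
      exact (le_abs_self _).trans ((g.le_opNorm _).trans
        (mul_le_mul_of_nonneg_left hd (norm_nonneg _)))
    have h3 : s * (-g x) ≤ s * (‖g‖ * (C * (‖f‖ - f x))) :=
      mul_le_mul_of_nonneg_left (by linarith) hspos.le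
    have h4 := mul_le_mul_of_nonneg_right hs1 (sub_nonneg.2 (hball x hx))
    simp only [add_apply, smul_apply, smul_eq_mul]
    nlinarith
  have hle : ‖f + (-s) • g‖ ≤ ‖f‖ := by
    refine ContinuousLinearMap.opNorm_le_of_unit_norm (norm_nonneg f) fun x hx => ?_
    rw [Real.norm_eq_abs, abs_le]
    have h2 := hup (-x) (by rw [norm_neg, hx])
    rw [map_neg] at h2
    exact ⟨by linarith, hup x hx.le⟩
  exact absurd (hg (-s) (by simpa using hspos.ne')) (not_lt.2 hle)

/-- A bounded linear functional on `c₀` has the adjusted Bhatia-Semrl property iff it attains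
its norm. -/
theorem hasBSa_iff_normAttaining_c0 (f : C₀(ℕ, ℝ) →L[ℝ] ℝ) :
    HasBSa f ↔ NormAttaining f := by
  refine ⟨fun h => h.1, fun h => ⟨h, fun g hg => ?_⟩⟩
  obtain ⟨x₁, h1, h2⟩ := h
  by_cases hf0 : f = 0
  · exact ⟨x₁, h1, h2, fun t => by rw [hf0]; simp only [zero_apply, norm_zero]; exact norm_nonneg _⟩
  have hfpos : 0 < ‖f‖ := (norm_pos_iff (a := f)).2 hf0
  obtain ⟨x₀, h1, hf⟩ : ∃ x₀ : C₀(ℕ, ℝ), ‖x₀‖ = 1 ∧ f x₀ = ‖f‖ := by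
    rw [Real.norm_eq_abs] at h2
    rcases abs_choice (f x₁) with h | h
    · exact ⟨x₁, h1, by rw [← h2, h]⟩
    · exact ⟨-x₁, by rw [norm_neg, h1], by rw [map_neg, ← h2, h]⟩
  obtain ⟨x, hx, hfx, hgx⟩ := c0_sign f g x₀ h1 hf hg
  obtain ⟨y, hy, hfy, hgy⟩ := c0_sign f (-g) x₀ h1 hf (fun t ht => by
    have := hg (-t) (by simpa using ht)
    rwa [neg_smul, ← smul_neg] at this)
  have hgy : 0 ≤ g y := by simpa using hgy
  obtain ⟨z, hz, hfz, hgz⟩ : ∃ z : C₀(ℕ, ℝ), ‖z‖ ≤ 1 ∧ f z = ‖f‖ ∧ g z = 0 := by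
    rcases hgx.eq_or_lt with h | h
    · exact ⟨x, hx, hfx, h⟩
    have hp : 0 < g y - g x := by linarith
    have hab : g y / (g y - g x) + (-g x) / (g y - g x) = 1 := by field_simp; ring
    have ha : 0 ≤ g y / (g y - g x) := by positivity
    have hb : 0 ≤ (-g x) / (g y - g x) := div_nonneg (by linarith) hp.le
    refine ⟨(g y / (g y - g x)) • x + ((-g x) / (g y - g x)) • y, ?_, ?_, ?_⟩
    · have := convex_closedBall (0 : C₀(ℕ, ℝ)) 1 (by simpa using hx : x ∈ Metric.closedBall 0 1)
        (by simpa using hy : y ∈ Metric.closedBall 0 1) ha hb hab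
      simpa using this
    · rw [map_add, map_smul, map_smul, hfx, hfy, ← add_smul, hab, one_smul]
    · rw [map_add, map_smul, map_smul, smul_eq_mul, smul_eq_mul]
      ring
  refine ⟨z, le_antisymm hz ?_, by rw [hfz, Real.norm_eq_abs, abs_of_pos hfpos], fun t => by simp [hgz]⟩
  have := (le_abs_self _).trans (f.le_opNorm z)
  rw [hfz] at this
  exact le_of_mul_le_mul_left (by linarith) hfpos
end

section
/- Let c₀ be the Banach space of real sequences converging to 0 with the supremum norm. The set BSa(c₀,ℝ) of bounded linear functionals on c₀ having the adjusted Bhatia-Šemrl property is norm-dense in the dual space c₀*. -/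
open scoped BigOperators

open ZeroAtInfty

namespace BSaC0

open Filter Topology

noncomputable def e (i : ℕ) : C₀(ℕ, ℝ) where
  toFun := fun j => if j = i then 1 else 0
  continuous_toFun := continuous_of_discreteTopology
  zero_at_infty' := by
    rw [cocompact_eq_cofinite, Nat.cofinite_eq_atTop]
    refine tendsto_const_nhds.congr' ?_
    filter_upwards [eventually_gt_atTop i] with j hj
    simp [hj.ne']

lemma e_apply (i j : ℕ) : e i j = if j = i then 1 else 0 := rfl

lemma abs_apply_le (x : C₀(ℕ, ℝ)) (i : ℕ) : |x i| ≤ ‖x‖ := by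
  have := x.toBCF.norm_coe_le_norm i
  rw [ZeroAtInftyContinuousMap.norm_toBCF_eq_norm] at this
  simpa using this

lemma norm_le_of (x : C₀(ℕ, ℝ)) {C : ℝ} (hC : 0 ≤ C) (h : ∀ i, |x i| ≤ C) : ‖x‖ ≤ C := by
  rw [← ZeroAtInftyContinuousMap.norm_toBCF_eq_norm]
  exact (BoundedContinuousFunction.norm_le hC).2 h

noncomputable def ev (i : ℕ) : C₀(ℕ, ℝ) →L[ℝ] ℝ :=
  LinearMap.mkContinuous
    { toFun := fun x => x i
      map_add' := fun _ _ => rfl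
      map_smul' := fun _ _ => rfl } 1 (fun x => by
        simpa using abs_apply_le x i)

lemma ev_apply (i : ℕ) (x : C₀(ℕ, ℝ)) : ev i x = x i := rfl

noncomputable def P (F : Finset ℕ) (x : C₀(ℕ, ℝ)) : C₀(ℕ, ℝ) := ∑ i ∈ F, x i • e i

noncomputable def tr (F : Finset ℕ) (f : C₀(ℕ, ℝ) →L[ℝ] ℝ) : C₀(ℕ, ℝ) →L[ℝ] ℝ :=
  ∑ i ∈ F, f (e i) • ev i

lemma sum_e_apply (F : Finset ℕ) (a : ℕ → ℝ) (j : ℕ) :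
    (∑ i ∈ F, a i • e i : C₀(ℕ, ℝ)) j = if j ∈ F then a j else 0 := by
  rw [← ev_apply, map_sum]
  simp [ev_apply, e_apply]

lemma P_apply (F : Finset ℕ) (x : C₀(ℕ, ℝ)) (j : ℕ) :
    P F x j = if j ∈ F then x j else 0 := sum_e_apply F (fun i => x i) j

lemma tr_apply (F : Finset ℕ) (f : C₀(ℕ, ℝ) →L[ℝ] ℝ) (x : C₀(ℕ, ℝ)) :
    tr F f x = ∑ i ∈ F, f (e i) * x i := by
  simp [tr, ev_apply]

lemma tr_eq (F : Finset ℕ) (f : C₀(ℕ, ℝ) →L[ℝ] ℝ) (x : C₀(ℕ, ℝ)) :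
    tr F f x = f (P F x) := by
  rw [tr_apply, P, map_sum]
  simp [mul_comm]

lemma P_tendsto (x : C₀(ℕ, ℝ)) :
    Tendsto (fun N => P (Finset.range N) x) atTop (𝓝 x) := by
  rw [Metric.tendsto_atTop]
  intro ε hε
  have h := x.zero_at_infty'
  rw [cocompact_eq_cofinite, Nat.cofinite_eq_atTop, Metric.tendsto_atTop] at h
  obtain ⟨N, hN⟩ := h (ε / 2) (by positivity)
  refine ⟨N, fun n hn => ?_⟩
  rw [dist_eq_norm]
  refine lt_of_le_of_lt (norm_le_of _ (C := ε / 2) (by positivity) ?_) (by linarith)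
  intro i
  rw [ZeroAtInftyContinuousMap.sub_apply, P_apply]
  split_ifs with hi
  · simp; positivity
  · have := hN i (by simp at hi; omega)
    rw [Real.dist_eq, sub_zero] at this
    rw [zero_sub, abs_neg]
    exact this.le

lemma approx (f : C₀(ℕ, ℝ) →L[ℝ] ℝ) {ε : ℝ} (hε : 0 < ε) :
    ∃ N, ‖f - tr (Finset.range N) f‖ ≤ ε := by
  have h1 : ∃ x : C₀(ℕ, ℝ), ‖x‖ ≤ 1 ∧ ‖f‖ - ε < |f x| := by
    rcases lt_or_ge (‖f‖ - ε) 0 with h | h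
    · exact ⟨0, by simp, by simpa using h⟩
    · obtain ⟨x, hx, hx'⟩ := f.exists_lt_apply_of_lt_opNorm (r := ‖f‖ - ε) (by linarith)
      exact ⟨x, hx.le, hx'⟩
  obtain ⟨x, hx, hfx⟩ := h1
  have h2 : Tendsto (fun N => |f (P (Finset.range N) x)|) atTop (𝓝 |f x|) :=
    ((f.continuous.tendsto x).comp (P_tendsto x)).abs
  obtain ⟨N, hN⟩ := (h2.eventually (lt_mem_nhds hfx)).exists
  refine ⟨N, ContinuousLinearMap.opNorm_le_of_unit_norm hε.le ?_⟩
  intro y hy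
  set F := Finset.range N
  have h3 : (f - tr F f) y = f (y - P F y) := by
    simp [tr_eq]
  rw [h3]
  have key : ∀ s : ℝ, |s| ≤ 1 → |f (P F x) + s * f (y - P F y)| ≤ ‖f‖ := by
    intro s hs
    have : f (P F x) + s * f (y - P F y) = f (P F x + s • (y - P F y)) := by simp
    rw [this]
    refine f.unit_le_opNorm _ (norm_le_of _ zero_le_one fun i => ?_)
    rw [ZeroAtInftyContinuousMap.add_apply, ZeroAtInftyContinuousMap.smul_apply,
      ZeroAtInftyContinuousMap.sub_apply, P_apply, P_apply]
    split_ifs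
    · simpa using (abs_apply_le x i).trans hx
    · rw [zero_add, sub_zero, smul_eq_mul, abs_mul]
      have := abs_apply_le y i
      nlinarith [abs_nonneg s, abs_nonneg (y i)]
  have k1 := abs_le.1 (key 1 (by simp))
  have k2 := abs_le.1 (key (-1) (by simp))
  rw [Real.norm_eq_abs]
  rcases abs_cases (f (P F x)) with h | h <;>
  rcases abs_cases (f (y - P F y)) with h' | h' <;> linarith

lemma abs_add_small {c b t : ℝ} (hc : c ≠ 0) (h : |t| * |b| ≤ |c|) :
    |c + t * b| = |c| + t * (SignType.sign c * b) := by
  rw [← abs_mul] at h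
  rcases lt_or_gt_of_ne hc with hc | hc
  · rw [sign_neg hc]
    rw [abs_of_neg hc] at h ⊢
    have := abs_le.1 h
    rw [abs_of_nonpos (by linarith)]
    push_cast; simp; ring
  · rw [sign_pos hc]
    rw [abs_of_pos hc] at h ⊢
    have := abs_le.1 h
    rw [abs_of_nonneg (by linarith)]
    push_cast; simp

lemma zero_BSa : HasBSa (0 : C₀(ℕ, ℝ) →L[ℝ] ℝ) := by
  have h1 : ‖e 0‖ = 1 := by
    refine le_antisymm (norm_le_of _ zero_le_one fun i => ?_) ?_
    · rw [e_apply]; split_ifs <;> simp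
    · simpa [e_apply] using abs_apply_le (e 0) 0
  exact ⟨⟨e 0, h1, by simp⟩, fun S _ => ⟨e 0, h1, by simp, fun t => by simp; positivity⟩⟩

lemma main (F : Finset ℕ) (f : C₀(ℕ, ℝ) →L[ℝ] ℝ) (hf : tr F f = f)
    (hF : ∀ i ∈ F, f (e i) ≠ 0) : HasBSa f := by
  by_cases hf0 : f = 0
  · rw [hf0]; exact zero_BSa
  have hfpos : 0 < ‖f‖ := norm_pos_iff (E := C₀(ℕ, ℝ) →L[ℝ] ℝ) |>.2 hf0
  set s : ℕ → ℝ := fun i => (SignType.sign (f (e i)) : ℝ) with hs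
  have hs1 : ∀ i, |s i| ≤ 1 := by
    intro i
    rcases lt_trichotomy (f (e i)) 0 with h | h | h
    · simp [hs, sign_neg h]
    · simp [hs, h]
    · simp [hs, sign_pos h]
  set x0 : C₀(ℕ, ℝ) := ∑ i ∈ F, s i • e i with hx0
  have hgx0 : ∀ g : C₀(ℕ, ℝ) →L[ℝ] ℝ, g x0 = ∑ i ∈ F, s i * g (e i) := by
    intro g; simp [hx0, map_sum]
  have hfx0 : f x0 = ∑ i ∈ F, |f (e i)| := by
    rw [hgx0]
    exact Finset.sum_congr rfl fun i _ => sign_mul_self _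
  have hx0n : ∀ (y : C₀(ℕ, ℝ)) (r : ℝ), ‖y‖ ≤ 1 → |r| ≤ 1 → ‖x0 + r • (y - P F y)‖ ≤ 1 := by
    intro y r hy hr
    refine norm_le_of _ zero_le_one fun i => ?_
    rw [ZeroAtInftyContinuousMap.add_apply, ZeroAtInftyContinuousMap.smul_apply,
      ZeroAtInftyContinuousMap.sub_apply, P_apply, hx0, sum_e_apply]
    split_ifs
    · simpa using hs1 i
    · rw [zero_add, sub_zero, smul_eq_mul, abs_mul]
      have := abs_apply_le y i
      nlinarith [abs_nonneg r, abs_nonneg (y i)]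
  have hbound : ∀ h : C₀(ℕ, ℝ) →L[ℝ] ℝ, ‖tr F h‖ ≤ ∑ i ∈ F, |h (e i)| := by
    intro h
    refine ContinuousLinearMap.opNorm_le_of_unit_norm
      (Finset.sum_nonneg fun _ _ => abs_nonneg _) fun z hz => ?_
    rw [tr_apply]
    refine (Finset.abs_sum_le_sum_abs _ _).trans (Finset.sum_le_sum fun i _ => ?_)
    rw [abs_mul]
    have := abs_apply_le z i
    nlinarith [abs_nonneg (h (e i))]
  have hx0le : ‖x0‖ ≤ 1 := by simpa using hx0n 0 0 (by simp) (by simp)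
  have hnorm : ‖f‖ = f x0 := by
    apply le_antisymm
    · rw [hfx0]; conv_lhs => rw [← hf]
      exact hbound f
    · exact (le_abs_self _).trans (f.unit_le_opNorm _ hx0le)
  have hatt : ∀ x : C₀(ℕ, ℝ), ‖x‖ ≤ 1 → f x = f x0 → ‖x‖ = 1 ∧ ‖f x‖ = ‖f‖ := by
    intro x hx hfx
    have h2 : ‖f x‖ = ‖f‖ := by
      rw [hfx, ← hnorm, Real.norm_eq_abs, abs_of_pos hfpos]
    refine ⟨le_antisymm hx ?_, h2⟩
    have := f.le_opNorm x
    rw [h2] at this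
    by_contra hlt
    push Not at hlt
    nlinarith
  refine ⟨⟨x0, hatt x0 hx0le rfl⟩, fun g hg => ?_⟩
  have hlt : |g x0| < ‖g - tr F g‖ := by
    by_contra hge
    push Not at hge
    have hδ : ∃ δ : ℝ, 0 < δ ∧ ∀ i ∈ F, δ * |g (e i)| ≤ |f (e i)| := by
      have h1 : ∀ᶠ δ : ℝ in 𝓝[>] 0, ∀ i ∈ F, δ * |g (e i)| ≤ |f (e i)| := by
        rw [Filter.eventually_all_finset]
        intro i hi
        have h2 : Tendsto (fun δ : ℝ => δ * |g (e i)|) (𝓝[>] 0) (𝓝 (0 * |g (e i)|)) :=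
          ((continuous_id.mul continuous_const).tendsto 0).mono_left nhdsWithin_le_nhds
        rw [zero_mul] at h2
        exact (h2.eventually (gt_mem_nhds (abs_pos.2 (hF i hi)))).mono fun _ h => h.le
      obtain ⟨δ, h, h'⟩ := (h1.and self_mem_nhdsWithin).exists
      exact ⟨δ, h', h⟩
    obtain ⟨δ, hδ0, hδ⟩ := hδ
    have key : ∀ t : ℝ, |t| = δ → ‖f + t • g‖ ≤ ‖f‖ + t * g x0 + δ * ‖g - tr F g‖ := by
      intro t ht
      have hdec : f + t • g = tr F (f + t • g) + t • (g - tr F g) := by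
        ext z
        have : f z = f (P F z) := by rw [← tr_eq, hf]
        simp [tr_eq, ← this]
        ring
      rw [hdec]
      refine (norm_add_le (E := C₀(ℕ, ℝ) →L[ℝ] ℝ) _ _).trans ?_
      have hsm : ‖t • (g - tr F g)‖ ≤ |t| * ‖g - tr F g‖ :=
        ContinuousLinearMap.opNorm_smul_le t (g - tr F g)
      rw [ht] at hsm
      refine add_le_add ?_ hsm
      refine (hbound _).trans (le_of_eq ?_)
      rw [hnorm, hfx0, hgx0, Finset.mul_sum, ← Finset.sum_add_distrib]
      refine Finset.sum_congr rfl fun i hi => ?_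
      have := abs_add_small (b := g (e i)) (t := t) (hF i hi) (by rw [ht]; exact hδ i hi)
      simpa using this
    rcases le_total 0 (g x0) with h | h
    · have a := key (-δ) (by rw [abs_neg, abs_of_pos hδ0])
      have b := hg (-δ) (by linarith)
      rw [abs_of_nonneg h] at hge
      nlinarith
    · have a := key δ (abs_of_pos hδ0)
      have b := hg δ hδ0.ne'
      rw [abs_of_nonpos h] at hge
      nlinarith
  obtain ⟨y, hy, hgy⟩ := (g - tr F g).exists_lt_apply_of_lt_opNorm hlt
  have hw : (g - tr F g) y = g (y - P F y) := by simp [tr_eq]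
  rw [hw, Real.norm_eq_abs] at hgy
  have hwpos : 0 < |g (y - P F y)| := (abs_nonneg _).trans_lt hgy
  have hwne : g (y - P F y) ≠ 0 := abs_pos.1 hwpos
  set r := -(g x0) / g (y - P F y) with hr
  have hr1 : |r| ≤ 1 := by
    rw [hr, abs_div, abs_neg, div_le_one hwpos]; exact hgy.le
  have hfw : f (y - P F y) = 0 := by
    rw [map_sub, ← tr_eq, hf, sub_self]
  have hgz : g (x0 + r • (y - P F y)) = 0 := by
    rw [map_add, map_smul, smul_eq_mul, hr, div_mul_cancel₀ _ hwne]; ring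
  obtain ⟨h1, h2⟩ := hatt _ (hx0n y r hy.le hr1) (by rw [map_add, map_smul, hfw]; simp)
  exact ⟨_, h1, h2, fun t => by rw [hgz]; simp⟩

end BSaC0

/-- The set of functionals on `c₀` with the adjusted Bhatia-Semrl property is norm-dense in
the dual of `c₀`. -/
theorem dense_hasBSa_c0 :
    Dense {f : C₀(ℕ, ℝ) →L[ℝ] ℝ | HasBSa f} := by
  refine (Metric.dense_iff (α := C₀(ℕ, ℝ) →L[ℝ] ℝ)).2 ?_
  intro f ε hε
  obtain ⟨N, hN⟩ := BSaC0.approx f (half_pos hε)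
  set F := (Finset.range N).filter (fun i => f (BSaC0.e i) ≠ 0) with hF
  have hT : BSaC0.tr (Finset.range N) f = BSaC0.tr F f := by
    unfold BSaC0.tr
    rw [hF, Finset.sum_filter_of_ne]
    intro i _ h h0
    exact h (by rw [h0, zero_smul])
  have hTe : ∀ i ∈ F, BSaC0.tr F f (BSaC0.e i) = f (BSaC0.e i) := by
    intro i hi
    rw [BSaC0.tr_apply]
    simp only [BSaC0.e_apply, mul_ite, mul_one, mul_zero, Finset.sum_ite_eq', hi, if_true]
  refine ⟨BSaC0.tr F f, ?_, BSaC0.main F _ ?_ ?_⟩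
  · rw [Metric.mem_ball, dist_comm]
    have hd : dist f (BSaC0.tr F f) = ‖f - BSaC0.tr F f‖ :=
      dist_eq_norm (E := C₀(ℕ, ℝ) →L[ℝ] ℝ) f (BSaC0.tr F f)
    rw [hd, ← hT]
    linarith
  · conv_lhs => unfold BSaC0.tr
    conv_rhs => unfold BSaC0.tr
    refine Finset.sum_congr rfl fun i hi => ?_
    have := hTe i hi
    unfold BSaC0.tr at this
    rw [this]
  · intro i hi
    rw [hTe i hi]
    exact (Finset.mem_filter.1 hi).2
end

section
/- Let L¹[0,1] be the Lebesgue space of integrable real functions on [0,1]. The set BSa(L¹[0,1],ℝ) of bounded linear functionals on L¹[0,1] having the adjusted Bhatia-Šemrl property is norm-dense in the dual space L¹[0,1]*. -/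
open scoped BigOperators

open MeasureTheory

namespace BSaAux

variable {α : Type*} [MeasurableSpace α] {μ : Measure α}

lemma integrable_mul_Lp {φ : α → ℝ} {C : ℝ} (hm : Measurable φ)
    (hb : ∀ a, |φ a| ≤ C) (x : Lp ℝ 1 μ) : Integrable (fun a => φ a * x a) μ :=
  (L1.integrable_coeFn x).bdd_mul hm.aestronglyMeasurable (Filter.Eventually.of_forall hb)

lemma abs_integral_le {φ : α → ℝ} {C : ℝ} 
    (hb : ∀ᵐ a ∂μ, |φ a| ≤ C) (x : Lp ℝ 1 μ) : |∫ a, φ a * x a ∂μ| ≤ C * ‖x‖ := by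
  rw [L1.norm_eq_integral_norm, ← integral_const_mul]
  rw [← Real.norm_eq_abs]
  refine norm_integral_le_of_norm_le ((L1.integrable_coeFn x).norm.const_mul C) ?_
  filter_upwards [hb] with a ha
  rw [norm_mul]
  exact mul_le_mul_of_nonneg_right ha (norm_nonneg _)

lemma exists_T {φ : α → ℝ} {C : ℝ} (hm : Measurable φ)
    (hb : ∀ a, |φ a| ≤ C) : ∃ T : Lp ℝ 1 μ →L[ℝ] ℝ, ∀ x, T x = ∫ a, φ a * x a ∂μ := by
  refine ⟨LinearMap.mkContinuous
    { toFun := fun x => ∫ a, φ a * x a ∂μ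
      map_add' := ?_
      map_smul' := ?_ } C ?_, fun x => rfl⟩
  · intro x y
    rw [← integral_add (integrable_mul_Lp hm hb x) (integrable_mul_Lp hm hb y)]
    refine integral_congr_ae ?_
    filter_upwards [Lp.coeFn_add x y] with a ha
    rw [ha, Pi.add_apply, mul_add]
  · intro c x
    simp only [RingHom.id_apply, smul_eq_mul]
    rw [← integral_const_mul]
    refine integral_congr_ae ?_
    filter_upwards [Lp.coeFn_smul c x] with a ha
    rw [ha, Pi.smul_apply, smul_eq_mul]
    ring
  · intro x
    exact abs_integral_le (Filter.Eventually.of_forall hb) x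

lemma norm_le_of_rep {φ : α → ℝ} {C : ℝ} (hC : 0 ≤ C) (T : Lp ℝ 1 μ →L[ℝ] ℝ)
    (hT : ∀ x, T x = ∫ a, φ a * x a ∂μ) (hb : ∀ᵐ a ∂μ, |φ a| ≤ C) : ‖T‖ ≤ C := by
  refine T.opNorm_le_bound hC fun x => ?_
  rw [hT]
  exact abs_integral_le hb x

lemma exists_J [IsFiniteMeasure μ] : ∃ J : Lp ℝ 2 μ →L[ℝ] Lp ℝ 1 μ, ∀ x, J x =ᵐ[μ] x := by
  have hmem : ∀ x : Lp ℝ 2 μ, MemLp x 1 μ := fun x =>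
    (Lp.memLp x).mono_exponent (by norm_num)
  obtain ⟨K, hK⟩ : ∃ K : ENNReal, K ≠ ⊤ ∧ ∀ x : Lp ℝ 2 μ, eLpNorm x 1 μ ≤ eLpNorm x 2 μ * K := by
    refine ⟨μ Set.univ ^ (1 / (1:ENNReal).toReal - 1 / (2:ENNReal).toReal), ?_, fun x => ?_⟩
    · exact ENNReal.rpow_ne_top_of_nonneg (by norm_num) (measure_ne_top _ _)
    · exact eLpNorm_le_eLpNorm_mul_rpow_measure_univ (by norm_num) (Lp.aestronglyMeasurable x)
  refine ⟨LinearMap.mkContinuous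
    { toFun := fun x => (hmem x).toLp x
      map_add' := ?_
      map_smul' := ?_ } K.toReal ?_, fun x => (hmem x).coeFn_toLp⟩
  · intro x y
    ext1
    filter_upwards [(hmem (x+y)).coeFn_toLp, (hmem x).coeFn_toLp, (hmem y).coeFn_toLp,
      Lp.coeFn_add x y, Lp.coeFn_add ((hmem x).toLp x) ((hmem y).toLp y)] with a h1 h2 h3 h4 h5
    rw [h1, h4, h5, Pi.add_apply, Pi.add_apply, h2, h3]
  · intro c x
    ext1
    simp only [RingHom.id_apply]
    filter_upwards [(hmem (c • x)).coeFn_toLp, (hmem x).coeFn_toLp,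
      Lp.coeFn_smul c x, Lp.coeFn_smul c ((hmem x).toLp x)] with a h1 h2 h4 h5
    rw [h1, h4, h5, Pi.smul_apply, Pi.smul_apply, h2]
  · intro x
    simp only [LinearMap.coe_mk, AddHom.coe_mk]
    rw [Lp.norm_toLp, Lp.norm_def, mul_comm, ← ENNReal.toReal_mul]
    exact ENNReal.toReal_mono (ENNReal.mul_ne_top (Lp.eLpNorm_ne_top x) hK.1) (hK.2 x)

lemma represent [IsFiniteMeasure μ] (f : Lp ℝ 1 μ →L[ℝ] ℝ) :
    ∃ φ : α → ℝ, Measurable φ ∧ (∀ a, |φ a| ≤ ‖f‖) ∧ ∀ x, f x = ∫ a, φ a * x a ∂μ := by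
  obtain ⟨J, hJ⟩ := exists_J (μ := μ)
  set g : Lp ℝ 2 μ := (InnerProductSpace.toDual ℝ (Lp ℝ 2 μ)).symm (f.comp J) with hg
  have hgi : Integrable g μ := ((Lp.memLp g).mono_exponent (by norm_num : (1:ENNReal) ≤ 2)).integrable le_rfl
  have key : ∀ (E : Set α) (hE : MeasurableSet E) (c : ℝ),
      f (indicatorConstLp 1 hE (measure_ne_top μ E) c) = c * ∫ a in E, g a ∂μ := by
    intro E hE c
    have h1 : J (indicatorConstLp 2 hE (measure_ne_top μ E) c)
        = indicatorConstLp 1 hE (measure_ne_top μ E) c := by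
      ext1
      exact (hJ _).trans (indicatorConstLp_coeFn.trans indicatorConstLp_coeFn.symm)
    rw [← h1]
    have h2 : inner ℝ g (indicatorConstLp 2 hE (measure_ne_top μ E) c)
        = (f.comp J) (indicatorConstLp 2 hE (measure_ne_top μ E) c) := by
      rw [hg, InnerProductSpace.toDual_symm_apply]
    rw [← ContinuousLinearMap.comp_apply, ← h2, real_inner_comm,
      L2.inner_indicatorConstLp_eq_setIntegral_inner ℝ g hE c, ← integral_const_mul]
    refine integral_congr_ae (Filter.Eventually.of_forall fun a => ?_)
    simp [mul_comm]
  have bd : ∀ (E : Set α), MeasurableSet E → |∫ a in E, g a ∂μ| ≤ ‖f‖ * μ.real E := by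
    intro E hE
    have := key E hE 1
    rw [one_mul] at this
    rw [← this]
    refine (f.le_opNorm _).trans (mul_le_mul_of_nonneg_left ?_ (norm_nonneg _))
    rw [norm_indicatorConstLp (by norm_num) (by norm_num)]
    simp
  have b1 : ∀ᵐ a ∂μ, g a ≤ ‖f‖ := by
    refine ae_le_of_forall_setIntegral_le hgi (integrable_const _) fun E hE _ => ?_
    rw [setIntegral_const, smul_eq_mul, mul_comm]
    exact (le_abs_self _).trans (bd E hE)
  have b2 : ∀ᵐ a ∂μ, -‖f‖ ≤ g a := by
    refine ae_le_of_forall_setIntegral_le (integrable_const _) hgi fun E hE _ => ?_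
    rw [setIntegral_const, smul_eq_mul, mul_comm]
    linarith [neg_abs_le (∫ a in E, g a ∂μ), bd E hE]
  have hsm := Lp.stronglyMeasurable g
  refine ⟨fun a => max (-‖f‖) (min (g a) ‖f‖), ?_, ?_, ?_⟩
  · exact measurable_const.max (hsm.measurable.min measurable_const)
  · intro a
    exact abs_le.2 ⟨le_max_left _ _, max_le (by linarith [norm_nonneg f]) (min_le_right _ _)⟩
  · obtain ⟨T, hT⟩ := exists_T (μ := μ) (φ := fun a => max (-‖f‖) (min (g a) ‖f‖)) (C := ‖f‖)
      (measurable_const.max (hsm.measurable.min measurable_const))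
      (fun a => abs_le.2 ⟨le_max_left _ _, max_le (by linarith [norm_nonneg f]) (min_le_right _ _)⟩)
    intro x
    rw [← hT]
    refine Lp.induction (p := 1) (by norm_num) (fun x => f x = T x) ?_ ?_ ?_ x
    · intro c s hs hμs
      rw [Lp.simpleFunc.coe_indicatorConst, key, hT, ← integral_const_mul, ← integral_indicator hs]
      refine integral_congr_ae ?_
      filter_upwards [b1, b2, indicatorConstLp_coeFn (p := 1) (hs := hs) (hμs := hμs.ne) (c := c)]
        with a h1 h2 h3
      rw [h3, min_eq_left h1, max_eq_right h2]
      by_cases ha : a ∈ s <;> simp [ha, mul_comm]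
    · intro u v hu hv _ h1 h2
      rw [map_add, map_add, h1, h2]
    · exact isClosed_eq f.continuous T.continuous

lemma exists_xB [IsFiniteMeasure μ] {s : α → ℝ} (hs : Measurable s) (hs1 : ∀ a, |s a| = 1)
    {B : Set α} (hB : MeasurableSet B) (hμ : μ B ≠ 0) :
    ∃ x : Lp ℝ 1 μ, ‖x‖ = 1 ∧ ∀ ψ : α → ℝ,
      ∫ a, ψ a * x a ∂μ = (μ.real B)⁻¹ * ∫ a in B, ψ a * s a ∂μ := by
  have hpos : 0 < μ.real B := ENNReal.toReal_pos hμ (measure_ne_top _ _)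
  have hmem : MemLp (B.indicator fun a => (μ.real B)⁻¹ * s a) 1 μ := by
    refine MemLp.indicator hB ?_
    refine MemLp.of_bound (measurable_const.mul hs).aestronglyMeasurable (μ.real B)⁻¹
      (Filter.Eventually.of_forall fun a => ?_)
    rw [norm_mul, Real.norm_eq_abs (s a), hs1, mul_one, Real.norm_of_nonneg (by positivity)]
  refine ⟨hmem.toLp _, ?_, fun ψ => ?_⟩
  · rw [L1.norm_eq_integral_norm]
    have : ∫ a, ‖hmem.toLp _ a‖ ∂μ = ∫ a in B, (μ.real B)⁻¹ ∂μ := by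
      rw [← integral_indicator hB]
      refine integral_congr_ae ?_
      filter_upwards [hmem.coeFn_toLp] with a ha
      rw [ha]
      by_cases h : a ∈ B <;> simp [h, hs1]
    rw [this, setIntegral_const, smul_eq_mul, mul_inv_cancel₀ hpos.ne']
  · rw [← integral_const_mul, ← integral_indicator hB]
    refine integral_congr_ae ?_
    filter_upwards [hmem.coeFn_toLp] with a ha
    rw [ha]
    by_cases h : a ∈ B
    · simp [h]; ring
    · simp [h]

lemma main [IsFiniteMeasure μ] (f : Lp ℝ 1 μ →L[ℝ] ℝ) {ε : ℝ} (hε : 0 < ε) (hεC : ε < ‖f‖) :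
    ∃ T : Lp ℝ 1 μ →L[ℝ] ℝ, HasBSa T ∧ ‖T - f‖ ≤ ε := by
  obtain ⟨φ, hφm, hφb, hφ⟩ := represent f
  set C := ‖f‖ with hC
  have hC0 : 0 < C := hε.trans hεC
  set s : α → ℝ := fun a => if 0 ≤ φ a then 1 else -1 with hs
  have hsm : Measurable s :=
    Measurable.ite (measurableSet_le measurable_const hφm) measurable_const measurable_const
  have hsφ : ∀ a, φ a = |φ a| * s a := by
    intro a
    by_cases h : 0 ≤ φ a
    · simp [hs, h, abs_of_nonneg h]
    · simp [hs, h, abs_of_neg (not_le.1 h)]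
  have hscase : ∀ a, s a = 1 ∨ s a = -1 := by
    intro a
    by_cases h : 0 ≤ φ a <;> simp [hs, h]
  have hs1 : ∀ a, |s a| = 1 := by
    intro a
    rcases hscase a with h | h <;> simp [h]
  set A : Set α := {a | C - ε ≤ |φ a|} with hA
  have hAm : MeasurableSet A := measurableSet_le measurable_const hφm.abs
  have hAμ : μ A ≠ 0 := by
    intro h0
    have : ‖f‖ ≤ C - ε := by
      refine norm_le_of_rep (by linarith) f hφ ?_
      have h1 : ∀ᵐ a ∂μ, a ∉ A := measure_eq_zero_iff_ae_notMem.1 h0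
      filter_upwards [h1] with a ha
      exact (not_le.1 ha).le
    linarith
  classical
  set φ' : α → ℝ := fun a => if a ∈ A then C * s a else φ a with hφ'
  have hφ'm : Measurable φ' := Measurable.ite hAm (measurable_const.mul hsm) hφm
  have hφ'A : ∀ a ∈ A, φ' a = C * s a := fun a ha => by simp [hφ', ha]
  have hφ'n : ∀ a, a ∉ A → φ' a = φ a := fun a ha => by simp [hφ', ha]
  have hφ'b : ∀ a, |φ' a| ≤ C := by
    intro a
    by_cases ha : a ∈ A
    · rw [hφ'A a ha, abs_mul, hs1, mul_one, abs_of_pos hC0]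
    · rw [hφ'n a ha]; exact hφb a
  obtain ⟨T, hT⟩ := exists_T (μ := μ) hφ'm hφ'b
  -- T on x_B
  have hTB : ∀ B : Set α, MeasurableSet B → B ⊆ A → μ B ≠ 0 →
      (μ.real B)⁻¹ * ∫ a in B, φ' a * s a ∂μ = C := by
    intro B hB hBA hμB
    have hpos : 0 < μ.real B := ENNReal.toReal_pos hμB (measure_ne_top _ _)
    have : ∫ a in B, φ' a * s a ∂μ = ∫ a in B, C ∂μ := by
      refine setIntegral_congr_fun hB fun a ha => ?_
      rw [hφ'A a (hBA ha)]
      rcases hscase a with h | h <;> rw [h] <;> ring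
    rw [this, setIntegral_const, smul_eq_mul, ← mul_assoc, inv_mul_cancel₀ hpos.ne', one_mul]
  have hTle : ‖T‖ ≤ C := norm_le_of_rep hC0.le T hT (Filter.Eventually.of_forall hφ'b)
  obtain ⟨xA, hxA, hxA'⟩ := exists_xB (μ := μ) hsm hs1 hAm hAμ
  have hTxA : T xA = C := by rw [hT, hxA', hTB A hAm subset_rfl hAμ]
  have hTn : ‖T‖ = C := by
    refine le_antisymm hTle ?_
    have := T.le_opNorm xA
    rw [hTxA, hxA, mul_one] at this
    exact (le_abs_self C).trans this
  refine ⟨T, ⟨⟨xA, hxA, ?_⟩, ?_⟩, ?_⟩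
  · rw [hTxA, hTn, Real.norm_of_nonneg hC0.le]
  · intro S hS
    obtain ⟨ψ, hψm, hψb, hψ⟩ := represent S
    -- one-sided case is impossible
    have contra : ∀ σ : ℝ, |σ| = 1 → ¬ (∀ᵐ a ∂μ, a ∈ A → 0 ≤ σ * (ψ a * s a)) := by
      intro σ hσ hae
      set D := ‖S‖ with hD
      have hD0 : 0 ≤ D := norm_nonneg S
      set τ := ε / (D + 1) with hτ
      have hτ0 : 0 < τ := by positivity
      have hτD : τ * D ≤ ε := by
        rw [hτ, div_mul_eq_mul_div, div_le_iff₀ (by linarith)]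
        nlinarith
      have hσ0 : σ ≠ 0 := by
        rintro rfl
        simp at hσ
      have hlt := hS (-σ * τ) (mul_ne_zero (neg_ne_zero.2 hσ0) hτ0.ne')
      have hle : ‖T + (-σ * τ) • S‖ ≤ C := by
        refine norm_le_of_rep (φ := fun a => φ' a + (-σ * τ) * ψ a) hC0.le _ (fun x => ?_) ?_
        · have i1 := integrable_mul_Lp (μ := μ) hφ'm hφ'b x
          have i2 := integrable_mul_Lp (μ := μ) hψm hψb x
          rw [ContinuousLinearMap.add_apply, ContinuousLinearMap.smul_apply, hT, hψ, smul_eq_mul,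
            ← integral_const_mul, ← integral_add i1 (i2.const_mul _)]
          refine integral_congr_ae (Filter.Eventually.of_forall fun a => ?_)
          simp only
          ring
        · filter_upwards [hae] with a ha
          have hu : |σ * τ * ψ a| ≤ ε := by
            rw [abs_mul, abs_mul, hσ, one_mul, abs_of_pos hτ0]
            exact (mul_le_mul_of_nonneg_left (hψb a) hτ0.le).trans hτD
          by_cases haA : a ∈ A
          · have e : φ' a + -σ * τ * ψ a = (C - τ * (σ * (ψ a * s a))) * s a := by
              rw [hφ'A a haA]
              rcases hscase a with h | h <;> rw [h] <;> ring
            have hv : τ * (σ * (ψ a * s a)) ≤ ε := by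
              refine le_trans (le_of_eq_of_le ?_ (le_abs_self (σ * τ * ψ a * s a))) ?_
              · ring
              · rw [abs_mul, hs1, mul_one]; exact hu
            have hw : 0 ≤ τ * (σ * (ψ a * s a)) := mul_nonneg hτ0.le (ha haA)
            rw [e, abs_mul, hs1, mul_one, abs_le]
            constructor <;> linarith
          · have hlt : |φ a| < C - ε := not_le.1 haA
            rw [hφ'n a haA]
            have := abs_add_le (φ a) (-σ * τ * ψ a)
            have e : |-σ * τ * ψ a| = |σ * τ * ψ a| := by
              rw [← abs_neg]; congr 1; ring
            linarith
      linarith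
    set B1 : Set α := A ∩ {a | ψ a * s a ≤ 0} with hB1
    set B2 : Set α := A ∩ {a | 0 ≤ ψ a * s a} with hB2
    have hB1m : MeasurableSet B1 := hAm.inter (measurableSet_le (hψm.mul hsm) measurable_const)
    have hB2m : MeasurableSet B2 := hAm.inter (measurableSet_le measurable_const (hψm.mul hsm))
    have hμ1 : μ B1 ≠ 0 := by
      intro h0
      refine contra 1 (by simp) ?_
      filter_upwards [measure_eq_zero_iff_ae_notMem.1 h0] with a ha haA
      by_contra hcon
      exact ha ⟨haA, by simp only [Set.mem_setOf_eq]; linarith⟩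
    have hμ2 : μ B2 ≠ 0 := by
      intro h0
      refine contra (-1) (by simp) ?_
      filter_upwards [measure_eq_zero_iff_ae_notMem.1 h0] with a ha haA
      by_contra hcon
      exact ha ⟨haA, by simp only [Set.mem_setOf_eq]; linarith⟩
    obtain ⟨x1, hx1, hx1'⟩ := exists_xB (μ := μ) hsm hs1 hB1m hμ1
    obtain ⟨x2, hx2, hx2'⟩ := exists_xB (μ := μ) hsm hs1 hB2m hμ2
    have hT1 : T x1 = C := by rw [hT, hx1', hTB B1 hB1m Set.inter_subset_left hμ1]
    have hT2 : T x2 = C := by rw [hT, hx2', hTB B2 hB2m Set.inter_subset_left hμ2]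
    have hS1 : S x1 ≤ 0 := by
      rw [hψ, hx1']
      exact mul_nonpos_of_nonneg_of_nonpos (by positivity)
        (setIntegral_nonpos hB1m fun a ha => ha.2)
    have hS2 : 0 ≤ S x2 := by
      rw [hψ, hx2']
      exact mul_nonneg (by positivity) (setIntegral_nonneg hB2m fun a ha => ha.2)
    obtain ⟨p, q, hp, hq, hpq, h0⟩ : ∃ p q : ℝ, 0 ≤ p ∧ 0 ≤ q ∧ p + q = 1 ∧
        p * S x1 + q * S x2 = 0 := by
      by_cases h : S x2 - S x1 = 0
      · exact ⟨1, 0, by norm_num, le_rfl, by norm_num, by linarith⟩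
      · have hd : 0 < S x2 - S x1 := lt_of_le_of_ne (by linarith) (Ne.symm h)
        refine ⟨S x2 / (S x2 - S x1), -S x1 / (S x2 - S x1), by positivity,
          div_nonneg (by linarith) hd.le, ?_, ?_⟩
        · field_simp; ring
        · field_simp; ring
    have hTx : T (p • x1 + q • x2) = C := by
      rw [map_add, map_smul, map_smul, hT1, hT2, smul_eq_mul, smul_eq_mul, ← add_mul, hpq, one_mul]
    have hSx : S (p • x1 + q • x2) = 0 := by
      rw [map_add, map_smul, map_smul, smul_eq_mul, smul_eq_mul, h0]
    refine ⟨p • x1 + q • x2, le_antisymm ?_ ?_, ?_, ?_⟩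
    · refine (norm_add_le _ _).trans ?_
      rw [norm_smul, norm_smul, hx1, hx2, Real.norm_of_nonneg hp, Real.norm_of_nonneg hq]
      linarith
    · have := T.le_opNorm (p • x1 + q • x2)
      rw [hTx, hTn, Real.norm_of_nonneg hC0.le] at this
      exact (le_mul_iff_one_le_right hC0).1 this
    · rw [hTx, hTn, Real.norm_of_nonneg hC0.le]
    · intro t
      rw [hSx, smul_zero, add_zero]
  · refine norm_le_of_rep (φ := fun a => φ' a - φ a) hε.le _ (fun x => ?_) ?_
    · have i1 := integrable_mul_Lp (μ := μ) hφ'm hφ'b x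
      have i2 := integrable_mul_Lp (μ := μ) hφm hφb x
      rw [ContinuousLinearMap.sub_apply, hT, hφ, ← integral_sub i1 i2]
      refine integral_congr_ae (Filter.Eventually.of_forall fun a => ?_)
      simp only
      ring
    · refine Filter.Eventually.of_forall fun a => ?_
      by_cases haA : a ∈ A
      · have e : φ' a - φ a = (C - |φ a|) * s a := by
          rw [hφ'A a haA, sub_mul, ← hsφ]
        have h1 : C - ε ≤ |φ a| := haA
        rw [e, abs_mul, hs1, mul_one, abs_of_nonneg (by linarith [hφb a])]
        linarith
      · rw [hφ'n a haA, sub_self, abs_zero]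
        exact hε.le

lemma dense_gen [IsFiniteMeasure μ] (hμ : μ Set.univ ≠ 0) :
    Dense {f : (Lp ℝ 1 μ) →L[ℝ] ℝ | HasBSa f} := by
  rw [Metric.dense_iff]
  intro f r hr
  by_cases hf : f = 0
  · subst hf
    obtain ⟨x, hx, -⟩ := exists_xB (μ := μ) (s := fun _ => 1) measurable_const (by simp)
      MeasurableSet.univ hμ
    refine ⟨0, Metric.mem_ball_self hr, ⟨x, hx, by simp⟩, fun S _ => ⟨x, hx, by simp, ?_⟩⟩
    intro t
    rw [ContinuousLinearMap.zero_apply, norm_zero]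
    exact norm_nonneg _
  · have hC : 0 < ‖f‖ := norm_pos_iff.2 hf
    obtain ⟨T, hT, hTf⟩ := main f (ε := min (r / 2) (‖f‖ / 2)) (by positivity)
      ((min_le_right _ _).trans_lt (by linarith))
    refine ⟨T, ?_, hT⟩
    rw [mem_ball_iff_norm]
    exact hTf.trans_lt ((min_le_left _ _).trans_lt (by linarith))

end BSaAux

/-- The set of functionals on `L¹[0,1]` with the adjusted Bhatia-Semrl property is norm-dense
in the dual of `L¹[0,1]`. -/
theorem dense_hasBSa_L1 :
    Dense {f : (Lp ℝ 1 (volume : Measure (Set.Icc (0:ℝ) 1))) →L[ℝ] ℝ | HasBSa f} := by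
  have h1 : (volume : Measure (Set.Icc (0:ℝ) 1)) Set.univ = 1 := by
    rw [Measure.Subtype.volume_univ measurableSet_Icc.nullMeasurableSet]
    simp
  haveI : IsFiniteMeasure (volume : Measure (Set.Icc (0:ℝ) 1)) := ⟨by rw [h1]; norm_num⟩
  exact BSaAux.dense_gen (by rw [h1]; norm_num)
end

section
/- Let L¹[0,1] be the Lebesgue space of integrable real functions on [0,1]. The set of bounded linear functionals on L¹[0,1] which attain their norm but do not have the adjusted Bhatia-Šemrl property is norm-dense in the dual space L¹[0,1]*. -/
open scoped BigOperators

open MeasureTheory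

section Aux

variable {α : Type*} [MeasurableSpace α] {μ : Measure α} [IsProbabilityMeasure μ]

/-- `T` is represented by the function `h`. -/
def RepBy (μ : Measure α) (T : (Lp ℝ 1 μ) →L[ℝ] ℝ) (h : α → ℝ) : Prop :=
  ∀ x : Lp ℝ 1 μ, T x = ∫ a, h a * x a ∂μ

theorem int_mul {h : α → ℝ} (hm : Measurable h) {M : ℝ} (hb : ∀ a, |h a| ≤ M)
    (x : Lp ℝ 1 μ) : Integrable (fun a => h a * x a) μ :=
  (L1.integrable_coeFn x).bdd_mul hm.aestronglyMeasurable
    (Filter.Eventually.of_forall fun a => by simpa using hb a)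

theorem abs_int_mul_le {h : α → ℝ} (hm : Measurable h) {M : ℝ} (hb : ∀ a, |h a| ≤ M)
    (x : Lp ℝ 1 μ) : |∫ a, h a * x a ∂μ| ≤ M * ‖x‖ := by
  rw [L1.norm_eq_integral_norm, ← integral_const_mul]
  refine (abs_integral_le_integral_abs).trans ?_
  refine integral_mono (int_mul hm hb x).abs ((L1.integrable_coeFn x).norm.const_mul M) ?_
  intro a
  simp only [abs_mul, Real.norm_eq_abs]
  exact mul_le_mul_of_nonneg_right (hb a) (abs_nonneg _)

theorem exists_rep {h : α → ℝ} (hm : Measurable h) {M : ℝ} (hb : ∀ a, |h a| ≤ M) :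
    ∃ T, RepBy μ T h := by
  refine ⟨LinearMap.mkContinuous
    { toFun := fun x => ∫ a, h a * x a ∂μ
      map_add' := ?_
      map_smul' := ?_ } M ?_, ?_⟩
  · intro x y
    rw [← integral_add (int_mul hm hb x) (int_mul hm hb y)]
    refine integral_congr_ae ?_
    filter_upwards [Lp.coeFn_add x y] with a ha
    rw [ha, Pi.add_apply]; ring
  · intro c x
    rw [RingHom.id_apply, smul_eq_mul, ← integral_const_mul]
    refine integral_congr_ae ?_
    filter_upwards [Lp.coeFn_smul c x] with a ha
    rw [ha, Pi.smul_apply, smul_eq_mul]; ring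
  · intro x
    exact abs_int_mul_le hm hb x
  · intro x
    rfl

theorem RepBy.norm_le {T : (Lp ℝ 1 μ) →L[ℝ] ℝ} {h : α → ℝ} (hT : RepBy μ T h) (hm : Measurable h)
    {M : ℝ} (hM : 0 ≤ M) (hb : ∀ a, |h a| ≤ M) : ‖T‖ ≤ M := by
  refine T.opNorm_le_bound hM fun x => ?_
  rw [hT x]
  exact abs_int_mul_le hm hb x

theorem RepBy.apply_ind {T : (Lp ℝ 1 μ) →L[ℝ] ℝ} {h : α → ℝ} (hT : RepBy μ T h)
    {s : Set α} (hs : MeasurableSet s) (c : ℝ) :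
    T (indicatorConstLp 1 hs (measure_ne_top μ s) c) = (∫ a in s, h a ∂μ) * c := by
  rw [hT, ← integral_mul_const, ← integral_indicator hs]
  refine integral_congr_ae ?_
  filter_upwards [indicatorConstLp_coeFn (p := 1) (hs := hs) (hμs := measure_ne_top μ s) (c := c)]
    with a ha
  rw [ha]
  by_cases has : a ∈ s <;> simp [has]

theorem norm_ind {s : Set α} (hs : MeasurableSet s) (c : ℝ) :
    ‖indicatorConstLp (E := ℝ) 1 hs (measure_ne_top μ s) c‖ = |c| * μ.real s := by
  rw [norm_indicatorConstLp (by simp) (by simp)]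
  simp

theorem RepBy.le_norm {T : (Lp ℝ 1 μ) →L[ℝ] ℝ} {h : α → ℝ} (hT : RepBy μ T h) (hm : Measurable h)
    {M : ℝ} (hb : ∀ a, |h a| ≤ M) {s : Set α} (hs : MeasurableSet s) (hpos : 0 < μ s)
    {c : ℝ} (hc : ∀ a ∈ s, c ≤ h a) : c ≤ ‖T‖ := by
  have hp : 0 < μ.real s := ENNReal.toReal_pos hpos.ne' (measure_ne_top μ s)
  have h1 := T.le_opNorm (indicatorConstLp 1 hs (measure_ne_top μ s) (1:ℝ))
  rw [norm_ind, hT.apply_ind] at h1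
  have hint : Integrable h μ := Integrable.of_bound hm.aestronglyMeasurable M
    (Filter.Eventually.of_forall fun a => by simpa using hb a)
  have h2 : c * μ.real s ≤ ∫ a in s, h a ∂μ := by
    have := setIntegral_mono_on (μ := μ) (s := s) (f := fun _ => c) (g := h)
      (integrable_const c).integrableOn hint.integrableOn hs hc
    simpa [mul_comm] using this
  have h3 := le_abs_self ((∫ a in s, h a ∂μ) * 1)
  rw [Real.norm_eq_abs] at h1
  simp only [abs_one, one_mul] at h1
  by_contra hlt
  push Not at hlt
  nlinarith

theorem core {T : (Lp ℝ 1 μ) →L[ℝ] ℝ} {h : α → ℝ} (hT : RepBy μ T h) (hm : Measurable h)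
    {N : ℝ} (hN : 0 < N) (hb : ∀ a, |h a| ≤ N) {A : Set α} (hA : MeasurableSet A)
    (hApos : 0 < μ A) (hhA : ∀ a ∈ A, h a = N) (hhA' : ∀ a, a ∉ A → |h a| < N)
    (hlim : ∀ δ > 0, 0 < μ {a | a ∉ A ∧ N - δ < h a}) :
    NormAttaining T ∧ ¬ HasBSa T := by
  have hnorm : ‖T‖ = N := le_antisymm (hT.norm_le hm hN.le hb)
    (hT.le_norm hm hb hA hApos fun a ha => (hhA a ha).ge)
  have hp : 0 < μ.real A := ENNReal.toReal_pos hApos.ne' (measure_ne_top μ A)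
  refine ⟨⟨indicatorConstLp 1 hA (measure_ne_top μ A) (μ.real A)⁻¹, ?_, ?_⟩, ?_⟩
  · rw [norm_ind, abs_of_pos (inv_pos.2 hp), inv_mul_cancel₀ hp.ne']
  · rw [hnorm, hT.apply_ind, setIntegral_congr_fun hA (g := fun _ => N) hhA]
    simp only [setIntegral_const, smul_eq_mul, Real.norm_eq_abs]
    rw [mul_right_comm, mul_inv_cancel₀ hp.ne', one_mul, abs_of_pos hN]
  rintro ⟨-, hbs⟩
  classical
  set g : α → ℝ := A.piecewise (fun _ => 1) (fun _ => -1) with hg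
  have gA : ∀ a ∈ A, g a = 1 := fun a ha => by simp [hg, ha]
  have gA' : ∀ a, a ∉ A → g a = -1 := fun a ha => by simp [hg, ha]
  have gm : Measurable g := measurable_const.piecewise hA measurable_const
  have gb : ∀ a, |g a| ≤ 1 := fun a => by
    by_cases ha : a ∈ A
    · simp [gA a ha]
    · simp [gA' a ha]
  obtain ⟨S, hS⟩ := exists_rep (μ := μ) gm gb
  have hsum : ∀ t : ℝ, RepBy μ (T + t • S) (fun a => h a + t * g a) := by
    intro t x
    simp only [_root_.add_apply, _root_.smul_apply, smul_eq_mul]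
    rw [hT x, hS x, ← integral_const_mul,
      ← integral_add (int_mul hm hb x) ((int_mul gm gb x).const_mul t)]
    congr 1; ext a; ring
  have hsumm : ∀ t : ℝ, Measurable (fun a => h a + t * g a) := fun t => hm.add (gm.const_mul t)
  have hsumb : ∀ t : ℝ, ∀ a, |h a + t * g a| ≤ N + |t| := by
    intro t a
    refine (abs_add_le _ _).trans (add_le_add (hb a) ?_)
    rw [abs_mul]
    exact mul_le_of_le_one_right (abs_nonneg _) (gb a)
  have hst : SBJOrth T S := by
    intro t ht
    rw [hnorm]
    rcases lt_or_gt_of_ne ht with ht | ht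
    · have hms : MeasurableSet {a | a ∉ A ∧ N - (-t/2) < h a} :=
        hA.compl.inter (measurableSet_lt measurable_const hm)
      have := (hsum t).le_norm (hsumm t) (hsumb t) (c := N + (-t/2)) hms
        (hlim (-t/2) (by linarith)) (by
          rintro a ⟨ha, ha2⟩
          rw [gA' a ha]; linarith)
      linarith
    · have := (hsum t).le_norm (hsumm t) (hsumb t) (c := N + t) hA hApos (by
          intro a ha
          rw [gA a ha, hhA a ha]; linarith)
      linarith
  obtain ⟨x, hx1, hx2, hx3⟩ := hbs S hst
  rw [hnorm] at hx2
  -- sign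
  obtain ⟨s, hs, hsx⟩ : ∃ s : ℝ, |s| = 1 ∧ s * T x = N := by
    rw [Real.norm_eq_abs] at hx2
    rcases abs_eq hN.le |>.1 hx2 with h1 | h1
    · exact ⟨1, by simp, by linarith⟩
    · exact ⟨-1, by simp, by linarith⟩
  have hxi := L1.integrable_coeFn x
  have hz : ∫ a, (N * |x a| - s * (h a * x a)) ∂μ = 0 := by
    rw [integral_sub (hxi.abs.const_mul N) ((int_mul hm hb x).const_mul s), integral_const_mul,
      integral_const_mul, ← hT x, hsx]
    have := L1.norm_eq_integral_norm x
    simp only [Real.norm_eq_abs] at this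
    rw [← this, hx1]; ring
  have hle : ∀ a, s * (h a * x a) ≤ |h a| * |x a| := fun a => by
    refine (le_abs_self _).trans ?_
    rw [abs_mul, hs, one_mul, abs_mul]
  have hnn : ∀ a, 0 ≤ N * |x a| - s * (h a * x a) := fun a => by
    have := mul_le_mul_of_nonneg_right (hb a) (abs_nonneg (x a))
    linarith [hle a]
  have hae := (integral_eq_zero_iff_of_nonneg (μ := μ) hnn
    ((hxi.abs.const_mul N).sub ((int_mul hm hb x).const_mul s))).1 hz
  have hfin : s * S x = 1 := by
    rw [hS x, ← integral_const_mul, ← hx1, L1.norm_eq_integral_norm x]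
    refine integral_congr_ae ?_
    filter_upwards [hae] with a ha
    simp only [Pi.zero_apply] at ha
    simp only [Real.norm_eq_abs]
    by_cases haA : a ∈ A
    · rw [hhA a haA] at ha
      rw [gA a haA]
      have : N * (|x a| - s * x a) = 0 := by linarith
      rcases mul_eq_zero.1 this with h0 | h0 <;> linarith
    · have h1 := hhA' a haA
      have h2 := hle a
      have h3 : |x a| = 0 := by
        by_contra hne
        have : 0 < |x a| := lt_of_le_of_ne (abs_nonneg _) (Ne.symm hne)
        nlinarith
      rw [h3, abs_eq_zero.1 h3]; simp
  have hTS : T x = N * S x := by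
    have hs0 : s ≠ 0 := by rintro rfl; simp at hs
    apply mul_left_cancel₀ hs0
    rw [hsx]; linear_combination (-N) * hfin
  have := hx3 (-N)
  rw [hx2, hTS, smul_eq_mul] at this
  have h0 : N * S x + -N * S x = 0 := by ring
  rw [h0, norm_zero] at this
  linarith

theorem exists_incl : ∃ ι : (Lp ℝ 2 μ) →L[ℝ] (Lp ℝ 1 μ), ∀ x, (ι x : α → ℝ) =ᵐ[μ] x := by
  have hmem : ∀ x : Lp ℝ 2 μ, MemLp x 1 μ := fun x => (Lp.memLp x).mono_exponent (by norm_num)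
  refine ⟨LinearMap.mkContinuous
    { toFun := fun x => (hmem x).toLp x
      map_add' := ?_
      map_smul' := ?_ } 1 ?_, ?_⟩
  · intro x y
    rw [← MemLp.toLp_add]
    exact MemLp.toLp_congr _ _ (Lp.coeFn_add x y)
  · intro c x
    rw [RingHom.id_apply, ← MemLp.toLp_const_smul]
    exact MemLp.toLp_congr _ _ (Lp.coeFn_smul c x)
  · intro x
    rw [one_mul]
    change ‖(hmem x).toLp x‖ ≤ ‖x‖
    rw [Lp.norm_toLp, Lp.norm_def]
    exact ENNReal.toReal_mono (Lp.eLpNorm_ne_top x)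
      (eLpNorm_le_eLpNorm_of_exponent_le (by norm_num) (Lp.aestronglyMeasurable x))
  · intro x
    exact MemLp.coeFn_toLp (hmem x)

theorem rep_of_ind {T : (Lp ℝ 1 μ) →L[ℝ] ℝ} {h : α → ℝ} (hm : Measurable h)
    {M : ℝ} (hb : ∀ a, |h a| ≤ M)
    (hi : ∀ (s : Set α) (hs : MeasurableSet s),
      T (indicatorConstLp 1 hs (measure_ne_top μ s) 1) = ∫ a in s, h a ∂μ) : RepBy μ T h := by
  obtain ⟨T', hT'⟩ := exists_rep (μ := μ) hm hb
  suffices T = T' by rw [this]; exact hT'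
  ext x
  refine Lp.induction (p := 1) (by simp) (motive := fun x => T x = T' x) ?_ ?_ ?_ x
  · intro c s hs hμ
    rw [Lp.simpleFunc.coe_indicatorConst]
    have : indicatorConstLp 1 hs hμ.ne c = c • indicatorConstLp (μ := μ) 1 hs hμ.ne (1:ℝ) := by
      apply Lp.ext
      filter_upwards [indicatorConstLp_coeFn (p := 1) (hs := hs) (hμs := hμ.ne) (c := c),
        indicatorConstLp_coeFn (p := 1) (hs := hs) (hμs := hμ.ne) (c := (1:ℝ)),
        Lp.coeFn_smul c (indicatorConstLp (μ := μ) 1 hs hμ.ne (1:ℝ))] with a h1 h2 h3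
      rw [h1, h3, Pi.smul_apply, h2]
      by_cases has : a ∈ s <;> simp [has]
    rw [this, map_smul, map_smul, hT'.apply_ind, hi, mul_one]
  · intro f g hf hg _ h1 h2
    rw [map_add, map_add, h1, h2]
  · exact isClosed_eq T.continuous T'.continuous

theorem exists_density (T : (Lp ℝ 1 μ) →L[ℝ] ℝ) :
    ∃ h : α → ℝ, Measurable h ∧ (∀ a, |h a| ≤ ‖T‖) ∧ RepBy μ T h := by
  obtain ⟨ι, hι⟩ := exists_incl (μ := μ)
  set h0 : Lp ℝ 2 μ := (InnerProductSpace.toDual ℝ (Lp ℝ 2 μ)).symm (T.comp ι) with hh0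
  have h0i : Integrable h0 μ := (Lp.memLp h0).integrable (by norm_num)
  have key : ∀ (s : Set α) (hs : MeasurableSet s),
      T (indicatorConstLp 1 hs (measure_ne_top μ s) 1) = ∫ a in s, h0 a ∂μ := by
    intro s hs
    have h1 := L2.inner_indicatorConstLp_one (𝕜 := ℝ) hs (measure_ne_top μ s) h0
    rw [real_inner_comm, hh0, InnerProductSpace.toDual_symm_apply] at h1
    rw [← h1]
    simp only [ContinuousLinearMap.comp_apply]
    congr 1
    apply Lp.ext
    refine Filter.EventuallyEq.trans ?_ (hι _).symm
    exact indicatorConstLp_coeFn.trans indicatorConstLp_coeFn.symm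
  have kb : ∀ (s : Set α), MeasurableSet s → |∫ a in s, h0 a ∂μ| ≤ ‖T‖ * μ.real s := by
    intro s hs
    rw [← key s hs]
    have := T.le_opNorm (indicatorConstLp 1 hs (measure_ne_top μ s) 1)
    rwa [norm_ind, abs_one, one_mul, Real.norm_eq_abs] at this
  have hu : (h0 : α → ℝ) ≤ᵐ[μ] fun _ => ‖T‖ := by
    refine ae_le_of_forall_setIntegral_le h0i (integrable_const _) fun s hs _ => ?_
    have := (abs_le.1 (kb s hs)).2
    simpa [mul_comm] using this
  have hl : (fun _ => -‖T‖) ≤ᵐ[μ] (h0 : α → ℝ) := by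
    refine ae_le_of_forall_setIntegral_le (integrable_const _) h0i fun s hs _ => ?_
    have := (abs_le.1 (kb s hs)).1
    simp only [setIntegral_const, smul_eq_mul]
    linarith
  have hTn := norm_nonneg T
  have hm : Measurable fun a => max (-‖T‖) (min ‖T‖ (h0 a)) :=
    measurable_const.max (measurable_const.min (Lp.stronglyMeasurable h0).measurable)
  have hb : ∀ a, |max (-‖T‖) (min ‖T‖ (h0 a))| ≤ ‖T‖ := fun a =>
    abs_le.2 ⟨le_max_left _ _, max_le (by linarith) (min_le_left _ _)⟩
  refine ⟨_, hm, hb, rep_of_ind hm hb fun s hs => ?_⟩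
  rw [key s hs]
  refine integral_congr_ae (ae_restrict_of_ae ?_)
  filter_upwards [hu, hl] with a h1 h2
  rw [min_eq_right h1, max_eq_right h2]

end Aux

theorem neg_good {X : Type*} [NormedAddCommGroup X] [NormedSpace ℝ X] {T : X →L[ℝ] ℝ}
    (h : NormAttaining T ∧ ¬ HasBSa T) : NormAttaining (-T) ∧ ¬ HasBSa (-T) := by
  obtain ⟨⟨x, hx, hx'⟩, h2⟩ := h
  have hna : NormAttaining T := ⟨x, hx, hx'⟩
  refine ⟨⟨x, hx, by simpa using hx'⟩, fun hb => h2 ⟨hna, fun S hS => ?_⟩⟩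
  have e : ∀ (t : ℝ), ‖-T + t • (-S)‖ = ‖T + t • S‖ := fun t => by
    rw [← norm_neg]; congr 1; simp; abel
  obtain ⟨y, hy, hy1, hy2⟩ := hb.2 (-S) (fun t ht => by rw [e, norm_neg]; exact hS t ht)
  refine ⟨y, hy, by simpa using hy1, fun t => ?_⟩
  have := hy2 t
  rw [_root_.neg_apply, _root_.neg_apply, norm_neg, ← norm_neg (-T y + _)]
    at this
  refine this.trans (le_of_eq ?_)
  congr 1; simp; ring

theorem approx {μ : Measure (Set.Icc (0:ℝ) 1)} [IsProbabilityMeasure μ] [NullSingletonClass μ]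
    (T : (Lp ℝ 1 μ) →L[ℝ] ℝ)
    {h : Set.Icc (0:ℝ) 1 → ℝ} (hm : Measurable h) {M : ℝ} (hb : ∀ a, |h a| ≤ M)
    (hT : RepBy μ T h) {ε : ℝ} (hε : 0 < ε)
    (hC : μ {a | M - ε < h a} ≠ 0) :
    ∃ T' : (Lp ℝ 1 μ) →L[ℝ] ℝ,
      (NormAttaining T' ∧ ¬ HasBSa T') ∧ ‖T - T'‖ ≤ 2 * ε := by
  classical
  set C : Set (Set.Icc (0:ℝ) 1) := {a | M - ε < h a} with hCdef
  have hCm : MeasurableSet C := measurableSet_lt measurable_const hm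
  obtain ⟨p, hpC, hp⟩ := exists_mem_forall_mem_nhdsWithin_pos_measure hC
  have hd1 : ∀ a : Set.Icc (0:ℝ) 1, dist a p ≤ 1 := fun a => by
    rw [Subtype.dist_eq, Real.dist_eq]
    have h1 := a.2; have h2 := p.2
    rw [abs_le]; constructor <;> linarith [h1.1, h1.2, h2.1, h2.2]
  have hdm : Measurable fun a : Set.Icc (0:ℝ) 1 => dist a p := measurable_id.dist measurable_const
  obtain ⟨r, hr, hrA⟩ : ∃ r > 0, 0 < μ {a | a ∈ C ∧ r ≤ dist a p} := by
    by_contra! hcon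
    apply hC
    have hsub : C ⊆ {p} ∪ ⋃ n : ℕ, {a | a ∈ C ∧ 1 / ((n:ℝ)+1) ≤ dist a p} := by
      intro a ha
      by_cases hap : a = p
      · left; exact hap
      · right
        obtain ⟨n, hn⟩ := exists_nat_one_div_lt (dist_pos.2 hap)
        exact Set.mem_iUnion.2 ⟨n, ha, hn.le⟩
    refine measure_mono_null hsub (measure_union_null (measure_singleton p) ?_)
    exact measure_iUnion_null fun n => le_antisymm (hcon _ (by positivity)) bot_le
  set A : Set (Set.Icc (0:ℝ) 1) := {a | a ∈ C ∧ r ≤ dist a p} with hA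
  have hAm : MeasurableSet A := hCm.inter (measurableSet_le measurable_const hdm)
  set B : Set (Set.Icc (0:ℝ) 1) := {a | a ∈ C ∧ 0 < dist a p} with hB
  have hBm : MeasurableSet B := hCm.inter (measurableSet_lt measurable_const hdm)
  set k : Set.Icc (0:ℝ) 1 → ℝ :=
    A.piecewise (fun _ => M + ε) (B.piecewise (fun a => M + ε - ε * dist a p) h) with hk
  have kA : ∀ a ∈ A, k a = M + ε := fun a ha => by simp [hk, ha]
  have kB : ∀ a, a ∉ A → a ∈ B → k a = M + ε - ε * dist a p := fun a ha hb => by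
    simp [hk, ha, hb]
  have kC : ∀ a, a ∉ A → a ∉ B → k a = h a := fun a ha hb => by simp [hk, ha, hb]
  have km : Measurable k := measurable_const.piecewise hAm
    (Measurable.piecewise hBm (measurable_const.sub (hdm.const_mul ε)) hm)
  have hM : 0 ≤ M := (abs_nonneg _).trans (hb p)
  have kA' : ∀ a, a ∉ A → |k a| < M + ε := fun a ha => by
    by_cases hab : a ∈ B
    · rw [kB a ha hab, abs_lt]
      have := hab.2
      have := hd1 a
      constructor <;> nlinarith
    · rw [kC a ha hab]; linarith [hb a]
  have kb : ∀ a, |k a| ≤ M + ε := fun a => by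
    by_cases ha : a ∈ A
    · rw [kA a ha, abs_of_pos (by linarith)]
    · exact (kA' a ha).le
  obtain ⟨T', hT'⟩ := exists_rep (μ := μ) km kb
  refine ⟨T', core hT' km (by linarith) kb hAm hrA kA kA' ?_, ?_⟩
  · intro δ hδ
    have hpos : 0 < min r (δ / ε) := lt_min hr (by positivity)
    have h1 := hp _ (inter_mem_nhdsWithin C (Metric.ball_mem_nhds p hpos))
    have h2 : μ ((C ∩ Metric.ball p (min r (δ / ε))) \ {p}) =
      μ (C ∩ Metric.ball p (min r (δ / ε))) := measure_sdiff_null (measure_singleton p)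
    rw [← h2] at h1
    refine h1.trans_le (measure_mono ?_)
    rintro a ⟨⟨haC, hab⟩, hap⟩
    rw [Metric.mem_ball, lt_min_iff] at hab
    have hnA : a ∉ A := fun hh => absurd hh.2 (not_le.2 hab.1)
    have hBa : a ∈ B := ⟨haC, dist_pos.2 hap⟩
    refine ⟨hnA, ?_⟩
    rw [kB a hnA hBa]
    have := (lt_div_iff₀ hε).1 hab.2
    linarith
  · have hrep : RepBy μ (T - T') (fun a => h a - k a) := by
      intro x
      rw [_root_.sub_apply, hT x, hT' x,
        ← integral_sub (int_mul hm hb x) (int_mul km kb x)]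
      congr 1; ext a; ring
    refine hrep.norm_le (hm.sub km) (by linarith) fun a => ?_
    have hba := abs_le.1 (hb a)
    by_cases ha : a ∈ A
    · have : M - ε < h a := ha.1
      rw [kA a ha, abs_le]; constructor <;> linarith
    · by_cases hab : a ∈ B
      · have : M - ε < h a := hab.1
        rw [kB a ha hab, abs_le]
        have := hab.2
        have := hd1 a
        constructor <;> nlinarith
      · rw [kC a ha hab]; simp; linarith

/-- The set of norm attaining functionals on `L¹[0,1]` without the adjusted Bhatia-Semrl
property is norm-dense in the dual of `L¹[0,1]`. -/
theorem dense_normAttaining_not_hasBSa_L1 :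
    Dense {f : (Lp ℝ 1 (volume : Measure (Set.Icc (0:ℝ) 1))) →L[ℝ] ℝ |
      NormAttaining f ∧ ¬ HasBSa f} := by
  rw [Metric.dense_iff]
  intro T δ hδ
  obtain ⟨h, hm, hb, hT⟩ := exists_density T
  suffices ∃ T', (NormAttaining T' ∧ ¬ HasBSa T') ∧ ‖T - T'‖ ≤ 2 * (δ / 3) by
    obtain ⟨T', h1, h2⟩ := this
    refine ⟨T', ?_, h1⟩
    rw [Metric.mem_ball, dist_comm, dist_eq_norm]
    linarith
  by_cases hC : (volume : Measure (Set.Icc (0:ℝ) 1)) {a | ‖T‖ - δ / 3 < h a} = 0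
  · have hneg : RepBy volume (-T) (fun a => - h a) := by
      intro x
      rw [_root_.neg_apply, hT x, ← integral_neg]
      congr 1; ext a; ring
    by_cases hC' : (volume : Measure (Set.Icc (0:ℝ) 1)) {a | ‖T‖ - δ / 3 < - h a} = 0
    · exfalso
      have h1 : ∀ᵐ a : Set.Icc (0:ℝ) 1, |h a| ≤ ‖T‖ - δ / 3 := by
        have e1 : ∀ᵐ a : Set.Icc (0:ℝ) 1, ¬ (‖T‖ - δ / 3 < h a) := by
          rw [ae_iff]; simpa only [not_not] using hC
        have e2 : ∀ᵐ a : Set.Icc (0:ℝ) 1, ¬ (‖T‖ - δ / 3 < - h a) := by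
          rw [ae_iff]; simpa only [not_not] using hC'
        filter_upwards [e1, e2] with a h1 h2
        rw [abs_le]; constructor <;> linarith
      obtain ⟨a, ha⟩ := h1.exists
      have hnn : 0 ≤ ‖T‖ - δ / 3 := (abs_nonneg _).trans ha
      have : ‖T‖ ≤ ‖T‖ - δ / 3 := by
        refine T.opNorm_le_bound hnn fun x => ?_
        rw [hT x, L1.norm_eq_integral_norm, ← integral_const_mul]
        refine (norm_integral_le_integral_norm _).trans ?_
        refine integral_mono_ae (int_mul hm hb x).norm
          ((L1.integrable_coeFn x).norm.const_mul _) ?_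
        filter_upwards [h1] with a ha
        rw [norm_mul]
        exact mul_le_mul_of_nonneg_right ha (norm_nonneg _)
      linarith
    · obtain ⟨T', h1, h2⟩ := approx (-T) hm.neg (M := ‖T‖) (fun a => by simpa using hb a) hneg
        (ε := δ / 3) (by linarith) hC'
      refine ⟨-T', neg_good h1, ?_⟩
      rw [← norm_neg]
      rwa [show -(T - -T') = -T - T' by abel]
  · exact approx T hm hb hT (by linarith) hC
end
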